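/- arXiv:1408.4726 — 8 statements merged into one kernel-verified Lean document; each statement's English description precedes it below -/
import Mathlib

section
/- Let E be a real inner product space of finite dimension n ≥ 2 and let ‖·‖ be an arbitrary norm on E (not necessarily induced by the inner product), with closed balls B̄(y,t) = {z ∈ E : ‖z − y‖ ≤ t} and unit ball C = B̄(0,1). Let Ω ⊆ E be open, let f : Ω → ℝ be continuously Fréchet differentiable with Df(x) ≠ 0 for every x ∈ Ω, and set Σ = {x ∈ Ω : f(x) = 0}. Let σ_Σ be the Borel measure A ↦ H^{n−1}(A ∩ Σ), where H^{n−1} is the (n−1)-dimensional Hausdorff measure induced by the inner-product distance. Then for every x ∈ Σ one has inf_{r>0} sup{ σ_Σ(B̄(y,t)) / t^{n−1} : y ∈ E, 0 < t < r, ‖x − y‖ ≤ t } = sup_{z ∈ C} H^{n−1}( (z + C) ∩ N(ν(x)) ), where ν(x) = ∇f(x)/|∇f(x)| and N(ν(x)) = {w ∈ E : ⟨w, ν(x)⟩ = 0}. In other words, the spherical Federer density of σ_Σ at x with respect to ‖·‖ equals β(‖·‖, ν(x)). (This is the upper blow-up theorem for the perimeter measure of a parametrized regular hypersurface, in the abelian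 instance of a stratified group, where every norm is a homogeneous distance and the homogeneous dimension is Q = n.) -/
open MeasureTheory Metric Set
open scoped Pointwise RealInnerProductSpace ENNReal Topology

section NormComparison

variable {E : Type*} [NormedAddCommGroup E] [NormedSpace ℝ E] [FiniteDimensional ℝ E]

/-- In finite dimension, a definite seminorm is equivalent to the norm. -/
theorem Seminorm.exists_equiv_norm (p : Seminorm ℝ E) (hp : ∀ z, p z = 0 → z = 0) :
    ∃ K : ℝ, 0 < K ∧ (∀ z, p z ≤ K * ‖z‖) ∧ ∀ z, ‖z‖ ≤ K * p z := by
  have hc : Continuous p := p.convexOn.locallyLipschitz.continuous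
  obtain ⟨C, hC0, hC⟩ := p.bound_of_continuous_normedSpace hc
  have hlow : ∃ m : ℝ, 0 < m ∧ ∀ z ∈ sphere (0 : E) 1, m ≤ p z := by
    rcases (sphere (0 : E) 1).eq_empty_or_nonempty with h | h
    · exact ⟨1, one_pos, by simp [h]⟩
    · obtain ⟨u, hu, hmin⟩ := (isCompact_sphere (0 : E) 1).exists_isMinOn h hc.continuousOn
      refine ⟨p u, ?_, fun z hz => hmin hz⟩
      refine lt_of_le_of_ne (apply_nonneg p u) fun h0 => ?_
      have : u = 0 := hp u h0.symm
      simp [this] at hu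
  obtain ⟨m, hm, hmp⟩ := hlow
  refine ⟨max C m⁻¹, lt_max_of_lt_left hC0, fun z => ?_, fun z => ?_⟩
  · exact (hC z).trans (by gcongr; exact le_max_left _ _)
  · rcases eq_or_ne z 0 with rfl | hz
    · simp
    have hz' : 0 < ‖z‖ := norm_pos_iff.2 hz
    have h1 := hmp (‖z‖⁻¹ • z) (by simp [norm_smul, hz'.ne'])
    rw [map_smul_eq_mul, norm_inv, norm_norm] at h1
    have h2 : ‖z‖ ≤ m⁻¹ * p z := by
      rw [inv_mul_eq_div, le_div_iff₀ hm]
      calc ‖z‖ * m ≤ ‖z‖ * (‖z‖⁻¹ * p z) := by gcongr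
        _ = p z := by field_simp
    exact h2.trans (mul_le_mul_of_nonneg_right (le_max_right _ _) (apply_nonneg p z))

end NormComparison

/-- A map that contracts distances on `S` at most by a factor `K` contracts the Hausdorff measure
of `S` at most by `K ^ d`. -/
theorem hausdorffMeasure_le_mul_image {X Y : Type*} [MetricSpace X] [MeasurableSpace X]
    [BorelSpace X] [MetricSpace Y] [MeasurableSpace Y] [BorelSpace Y] {d : ℝ} (hd : 0 ≤ d)
    {K : NNReal} {Φ : X → Y} {S : Set X}
    (h : ∀ a ∈ S, ∀ b ∈ S, dist a b ≤ K * dist (Φ a) (Φ b)) :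
    μH[d] S ≤ (K : ℝ≥0∞) ^ d * μH[d] (Φ '' S) := by
  rcases S.eq_empty_or_nonempty with rfl | ⟨s, hs⟩
  · simp
  have : Nonempty X := ⟨s⟩
  have hinj : InjOn Φ S := fun a ha b hb hab => by
    have := h a ha b hb
    rw [hab, dist_self, mul_zero] at this
    exact dist_le_zero.1 this
  have hL : LipschitzOnWith K (Function.invFunOn Φ S) (Φ '' S) := by
    refine LipschitzOnWith.of_dist_le_mul ?_
    rintro _ ⟨a, ha, rfl⟩ _ ⟨b, hb, rfl⟩
    rw [hinj.leftInvOn_invFunOn ha, hinj.leftInvOn_invFunOn hb]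
    exact h a ha b hb
  have := hL.hausdorffMeasure_image_le hd
  rwa [hinj.invFunOn_image Subset.rfl] at this

section Graph

variable {E : Type*} [NormedAddCommGroup E] [InnerProductSpace ℝ E]

/-- Scaling of the Hausdorff measure of hyperplane sections of balls. -/
theorem hausdorffMeasure_ball_inter_hyperplane_smul [MeasurableSpace E] [BorelSpace E]
    (p : Seminorm ℝ E) {d : ℝ} (hd : 0 ≤ d) (ν z : E) {s : ℝ} (hs : 0 < s) :
    μH[d] ({w : E | p (w - s • z) ≤ s} ∩ {w : E | ⟪w, ν⟫ = 0}) =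
      ENNReal.ofReal s ^ d * μH[d] ({w : E | p (w - z) ≤ 1} ∩ {w : E | ⟪w, ν⟫ = 0}) := by
  have hset : {w : E | p (w - s • z) ≤ s} ∩ {w : E | ⟪w, ν⟫ = 0} =
      s • ({w : E | p (w - z) ≤ 1} ∩ {w : E | ⟪w, ν⟫ = 0}) := by
    ext w
    rw [mem_smul_set_iff_inv_smul_mem₀ hs.ne']
    have h1 : w - s • z = s • (s⁻¹ • w - z) := by
      rw [smul_sub, smul_inv_smul₀ hs.ne']
    simp only [mem_inter_iff, mem_ofPred_eq, h1, map_smul_eq_mul, inner_smul_left,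
      Real.norm_of_nonneg hs.le]
    refine and_congr ?_ ?_
    · rw [mul_le_iff_le_one_right hs]
    · simp [hs.ne']
  rw [hset, Measure.hausdorffMeasure_smul₀ hd hs.ne', ENNReal.smul_def, smul_eq_mul,
    ENNReal.coe_rpow_of_nonneg _ hd, ← enorm_eq_nnnorm, Real.enorm_eq_ofReal hs.le]

/-- Near a zero at which `f` has strict derivative `a⟪ν, ·⟫`, the zero set is a graph with small
Lipschitz constant over the hyperplane orthogonal to `ν`. -/
theorem exists_local_graph {Ω : Set E} (hΩ : IsOpen Ω) {f : E → ℝ} (hf : ContinuousOn f Ω)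
    {x ν : E} (hxΩ : x ∈ Ω) (hfx : f x = 0) (hν : ‖ν‖ = 1) {a : ℝ} (ha : 0 < a)
    {L : E →L[ℝ] ℝ} (hL : HasStrictFDerivAt f L x) (hLν : ∀ w, L w = a * ⟪w, ν⟫)
    {ε : ℝ} (hε : 0 < ε) (hε1 : ε ≤ 1) :
    ∃ δ : ℝ, 0 < δ ∧
      (∀ p ∈ ball x δ, ∀ q ∈ ball x δ, f p = 0 → f q = 0 → |⟪p - q, ν⟫| ≤ ε * ‖p - q‖) ∧
      (∀ w : E, ⟪w, ν⟫ = 0 → ‖w‖ < δ →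
        ∃ s : ℝ, |s| ≤ ε * ‖w‖ ∧ x + (w + s • ν) ∈ Ω ∧ f (x + (w + s • ν)) = 0) := by
  have hc : 0 < a * (ε / 2) := by positivity
  obtain ⟨U, hU, hUL⟩ := hL.approximates_deriv_on_nhds (c := ⟨a * (ε / 2), hc.le⟩) (Or.inr hc)
  obtain ⟨ρ, hρ, hρU⟩ := Metric.mem_nhds_iff.1 (Filter.inter_mem hU (hΩ.mem_nhds hxΩ))
  have key : ∀ p ∈ ball x ρ, ∀ q ∈ ball x ρ,
      |f p - f q - a * ⟪p - q, ν⟫| ≤ a * (ε / 2) * ‖p - q‖ := fun p hp q hq => by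
    have := hUL p (hρU hp).1 q (hρU hq).1
    rw [hLν, Real.norm_eq_abs] at this
    exact this
  have hνν : ⟪ν, ν⟫ = (1 : ℝ) := by rw [real_inner_self_eq_norm_sq, hν]; norm_num
  refine ⟨ρ / 2, by positivity, fun p hp q hq hfp hfq => ?_, fun w hw hwρ => ?_⟩
  · have h := key p (ball_subset_ball (by linarith) hp) q (ball_subset_ball (by linarith) hq)
    rw [hfp, hfq, sub_zero, zero_sub, abs_neg, abs_mul, abs_of_pos ha, mul_assoc] at h
    have h2 := le_of_mul_le_mul_left h ha
    nlinarith [norm_nonneg (p - q)]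
  · have hnorm : ∀ s ∈ Icc (-(ε * ‖w‖)) (ε * ‖w‖), ‖w + s • ν‖ ≤ 2 * ‖w‖ := fun s hs => by
      have h1 : |s| ≤ ε * ‖w‖ := abs_le.2 hs
      have h2 : ‖w + s • ν‖ ≤ ‖w‖ + |s| := by
        simpa [norm_smul, hν] using norm_add_le w (s • ν)
      nlinarith [norm_nonneg w]
    have hball : ∀ s ∈ Icc (-(ε * ‖w‖)) (ε * ‖w‖), x + (w + s • ν) ∈ ball x ρ := fun s hs => by
      rw [mem_ball, dist_eq_norm, add_sub_cancel_left]
      linarith [hnorm s hs]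
    have hval : ∀ s ∈ Icc (-(ε * ‖w‖)) (ε * ‖w‖),
        |f (x + (w + s • ν)) - a * s| ≤ a * (ε * ‖w‖) := fun s hs => by
      have h := key _ (hball s hs) x (mem_ball_self hρ)
      rw [hfx, sub_zero, add_sub_cancel_left, inner_add_left, hw, inner_smul_left, hνν] at h
      simp only [conj_trivial, zero_add, mul_one] at h
      refine h.trans ?_
      calc a * (ε / 2) * ‖w + s • ν‖ ≤ a * (ε / 2) * (2 * ‖w‖) := by
            gcongr; exact hnorm s hs
        _ = a * (ε * ‖w‖) := by ring
    have hle : -(ε * ‖w‖) ≤ ε * ‖w‖ := by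
      have : 0 ≤ ε * ‖w‖ := by positivity
      linarith
    have hcont : ContinuousOn (fun s : ℝ => f (x + (w + s • ν)))
        (Icc (-(ε * ‖w‖)) (ε * ‖w‖)) :=
      hf.comp (by fun_prop) fun s hs => (hρU (hball s hs)).2
    have hlo := (abs_le.1 (hval _ (left_mem_Icc.2 hle))).2
    have hhi := (abs_le.1 (hval _ (right_mem_Icc.2 hle))).1
    obtain ⟨s, hs, hfs⟩ := intermediate_value_Icc hle hcont
      (show (0 : ℝ) ∈ _ from ⟨by linarith, by linarith⟩)
    exact ⟨s, abs_le.2 hs, (hρU (hball s hs)).2, hfs⟩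

/-- The orthogonal projection of the difference `z - x` to the hyperplane orthogonal to `ν`. -/
def projSub (x ν z : E) : E := (z - x) - ⟪z - x, ν⟫ • ν

theorem projSub_sub (x ν z z' : E) :
    projSub x ν z - projSub x ν z' = (z - z') - ⟪z - z', ν⟫ • ν := by
  have : z - z' = (z - x) - (z' - x) := by abel
  rw [this, inner_sub_left, sub_smul, projSub, projSub]
  abel

theorem inner_projSub {x ν : E} (hν : ‖ν‖ = 1) (z : E) : ⟪projSub x ν z, ν⟫ = 0 := by
  rw [projSub, inner_sub_left, inner_smul_left, real_inner_self_eq_norm_sq, hν]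
  simp

theorem lipschitzWith_projSub {x ν : E} (hν : ‖ν‖ = 1) : LipschitzWith 1 (projSub x ν) := by
  refine LipschitzWith.of_dist_le_mul fun z z' => ?_
  rw [dist_eq_norm, dist_eq_norm, projSub_sub, NNReal.coe_one, one_mul]
  refine le_of_pow_le_pow_left₀ two_ne_zero (norm_nonneg _) ?_
  rw [norm_sub_sq_real, inner_smul_right, norm_smul, hν, mul_one, Real.norm_eq_abs, sq_abs]
  nlinarith [sq_nonneg ⟪z - z', ν⟫]

section Density

variable [MeasurableSpace E] [BorelSpace E] {p : Seminorm ℝ E} {K : ℝ} {f : E → ℝ} {Ω : Set E}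
  {x ν : E} {d ε δ : ℝ}

/-- Upper bound for the measure of the intersection of a small ball with a level set that is a
graph with Lipschitz constant `ε`. -/
theorem hausdorffMeasure_ball_inter_graph_le (hK : 0 < K) (hpK : ∀ z, p z ≤ K * ‖z‖)
    (hKp : ∀ z, ‖z‖ ≤ K * p z) (hν : ‖ν‖ = 1) (hd : 0 ≤ d) (hε : 0 < ε) (hε1 : ε < 1)
    (hfx : f x = 0)
    (hgraph : ∀ q ∈ ball x δ, ∀ q' ∈ ball x δ, f q = 0 → f q' = 0 →
      |⟪q - q', ν⟫| ≤ ε * ‖q - q'‖)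
    {y : E} {t : ℝ} (ht : 0 < t) (htδ : K * (2 * t) < δ) (hxy : p (x - y) ≤ t) :
    μH[d] ({z : E | p (z - y) ≤ t} ∩ {q ∈ Ω | f q = 0}) ≤
      ENNReal.ofReal ((1 - ε)⁻¹ * (1 + 2 * K ^ 2 * ε)) ^ d * ENNReal.ofReal t ^ d *
        ⨆ (z : E) (_ : p z ≤ 1), μH[d] ({w : E | p (w - z) ≤ 1} ∩ {w : E | ⟪w, ν⟫ = 0}) := by
  set S := {z : E | p (z - y) ≤ t} ∩ {q ∈ Ω | f q = 0}
  set β := ⨆ (z : E) (_ : p z ≤ 1), μH[d] ({w : E | p (w - z) ≤ 1} ∩ {w : E | ⟪w, ν⟫ = 0}) with hβ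
  have hnear : ∀ z ∈ S, ‖z - x‖ ≤ K * (2 * t) := fun z hz => by
    have h1 : p (z - x) ≤ p (z - y) + p (x - y) := by
      have := map_sub_le_add p (z - y) (x - y)
      rwa [sub_sub_sub_cancel_right] at this
    have h2 : p (z - y) ≤ t := hz.1
    exact (hKp _).trans (by gcongr; linarith)
  have hball : ∀ z ∈ S, z ∈ ball x δ := fun z hz => by
    rw [mem_ball, dist_eq_norm]
    exact (hnear z hz).trans_lt htδ
  have hxball : x ∈ ball x δ := mem_ball_self (lt_of_le_of_lt (by positivity) htδ)
  have h1ε : 0 < 1 - ε := by linarith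
  have hexp : ∀ z ∈ S, ∀ z' ∈ S,
      dist z z' ≤ (Real.toNNReal (1 - ε)⁻¹ : ℝ) * dist (projSub x ν z) (projSub x ν z') :=
    fun z hz z' hz' => by
      have h := hgraph z (hball z hz) z' (hball z' hz') hz.2.2 hz'.2.2
      rw [Real.coe_toNNReal _ (by positivity), dist_eq_norm, dist_eq_norm, projSub_sub,
        inv_mul_eq_div, le_div_iff₀ h1ε]
      have h2 := norm_sub_norm_le (z - z') (⟪z - z', ν⟫ • ν)
      rw [norm_smul, hν, mul_one, Real.norm_eq_abs] at h2
      linarith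
  set s := t * (1 + 2 * K ^ 2 * ε) with hs
  have hs0 : 0 < s := by positivity
  have hts : t ≤ s := le_mul_of_one_le_right ht.le (by have : 0 ≤ 2 * K ^ 2 * ε := by positivity
                                                       linarith)
  have himage : projSub x ν '' S ⊆
      {w : E | p (w - s • (s⁻¹ • (y - x))) ≤ s} ∩ {w : E | ⟪w, ν⟫ = 0} := by
    rintro _ ⟨z, hz, rfl⟩
    refine ⟨?_, inner_projSub hν z⟩
    have h := hgraph z (hball z hz) x hxball hz.2.2 hfx
    have h1 : projSub x ν z - (y - x) = (z - y) - ⟪z - x, ν⟫ • ν := by rw [projSub]; abel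
    have h2 : p (⟪z - x, ν⟫ • ν) ≤ ε * (K * (2 * t)) * K := by
      rw [map_smul_eq_mul, Real.norm_eq_abs]
      have h3 : p ν ≤ K := by simpa [hν] using hpK ν
      refine mul_le_mul (h.trans ?_) h3 (apply_nonneg p ν) (by positivity)
      gcongr
      exact hnear z hz
    rw [mem_ofPred_eq, smul_inv_smul₀ hs0.ne', h1]
    have h4 : p (z - y) ≤ t := hz.1
    calc _ ≤ _ := map_sub_le_add p _ _
      _ ≤ t + ε * (K * (2 * t)) * K := add_le_add h4 h2
      _ = s := by rw [hs]; ring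
  have hz1 : p (s⁻¹ • (y - x)) ≤ 1 := by
    rw [map_smul_eq_mul, norm_inv, Real.norm_of_nonneg hs0.le, inv_mul_le_iff₀ hs0, mul_one,
      map_sub_rev]
    exact hxy.trans hts
  calc μH[d] S ≤ _ := hausdorffMeasure_le_mul_image hd hexp
    _ ≤ ENNReal.ofReal (1 - ε)⁻¹ ^ d * (ENNReal.ofReal s ^ d * _) := by
        refine mul_le_mul_right ((measure_mono himage).trans_eq
          (hausdorffMeasure_ball_inter_hyperplane_smul p hd ν _ hs0)) _
    _ ≤ ENNReal.ofReal (1 - ε)⁻¹ ^ d * (ENNReal.ofReal s ^ d * β) := by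
        gcongr
        rw [hβ]
        exact le_iSup₂_of_le _ hz1 le_rfl
    _ = _ := by
        rw [← mul_assoc, ← ENNReal.mul_rpow_of_nonneg _ _ hd, ← ENNReal.mul_rpow_of_nonneg _ _ hd,
          ← ENNReal.ofReal_mul (by positivity), ← ENNReal.ofReal_mul (by positivity)]
        congr 3
        rw [hs]; ring

/-- Lower bound for the measure of the intersection of a small ball with a level set that is a
graph with Lipschitz constant `ε`. -/
theorem le_hausdorffMeasure_ball_inter_graph (hK : 0 < K) (hpK : ∀ z, p z ≤ K * ‖z‖)
    (hKp : ∀ z, ‖z‖ ≤ K * p z) (hν : ‖ν‖ = 1) (hd : 0 ≤ d) (hε : 0 < ε)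
    (hε1 : 2 * K ^ 2 * ε < 1)
    (hgraph : ∀ w : E, ⟪w, ν⟫ = 0 → ‖w‖ < δ →
        ∃ s : ℝ, |s| ≤ ε * ‖w‖ ∧ x + (w + s • ν) ∈ Ω ∧ f (x + (w + s • ν)) = 0)
    {z : E} (hz : p z ≤ 1) {t : ℝ} (ht : 0 < t) (htδ : K * (2 * t) < δ) :
    ENNReal.ofReal (1 - 2 * K ^ 2 * ε) ^ d * ENNReal.ofReal t ^ d *
        μH[d] ({w : E | p (w - z) ≤ 1} ∩ {w : E | ⟪w, ν⟫ = 0}) ≤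
      μH[d] ({w : E | p (w - (x + (t * (1 - 2 * K ^ 2 * ε)) • z)) ≤ t} ∩
        {q ∈ Ω | f q = 0}) := by
  have hc : 0 < 1 - 2 * K ^ 2 * ε := by linarith
  have hνν : ⟪ν, ν⟫ = (1 : ℝ) := by rw [real_inner_self_eq_norm_sq, hν]; norm_num
  set s := t * (1 - 2 * K ^ 2 * ε) with hs
  have hs0 : 0 < s := by positivity
  have hst : s ≤ t := by
    have : 0 ≤ t * (2 * K ^ 2 * ε) := by positivity
    rw [hs]; linarith
  rw [← ENNReal.mul_rpow_of_nonneg _ _ hd, ← ENNReal.ofReal_mul hc.le,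
    mul_comm (1 - 2 * K ^ 2 * ε) t, ← hs,
    ← hausdorffMeasure_ball_inter_hyperplane_smul p hd ν z hs0]
  set S := {w : E | p (w - (x + s • z)) ≤ t} ∩ {q ∈ Ω | f q = 0}
  have himage : {w : E | p (w - s • z) ≤ s} ∩ {w : E | ⟪w, ν⟫ = 0} ⊆ projSub x ν '' S := by
    rintro w ⟨hw, hwν⟩
    rw [mem_ofPred_eq] at hw hwν
    have h1 : p w ≤ 2 * t := by
      have h2 := map_add_le_add p (w - s • z) (s • z)
      rw [sub_add_cancel, map_smul_eq_mul, Real.norm_of_nonneg hs0.le] at h2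
      nlinarith
    have h2 : ‖w‖ ≤ K * (2 * t) := (hKp w).trans (by gcongr)
    obtain ⟨σ, hσ, hΩσ, hfσ⟩ := hgraph w hwν (h2.trans_lt htδ)
    refine ⟨x + (w + σ • ν), ⟨?_, hΩσ, hfσ⟩, ?_⟩
    · have h3 : x + (w + σ • ν) - (x + s • z) = (w - s • z) + σ • ν := by abel
      have h4 : p (σ • ν) ≤ ε * (K * (2 * t)) * K := by
        rw [map_smul_eq_mul, Real.norm_eq_abs]
        have h5 : p ν ≤ K := by simpa [hν] using hpK ν
        refine mul_le_mul (hσ.trans ?_) h5 (apply_nonneg p ν) (by positivity)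
        gcongr
      rw [mem_ofPred_eq, h3]
      calc _ ≤ _ := map_add_le_add p _ _
        _ ≤ s + ε * (K * (2 * t)) * K := add_le_add hw h4
        _ = t := by rw [hs]; ring
    · rw [projSub, add_sub_cancel_left, inner_add_left, hwν, inner_smul_left, hνν]
      simp
  calc _ ≤ _ := measure_mono himage
    _ ≤ _ := (lipschitzWith_projSub hν).hausdorffMeasure_image_le hd S
    _ = μH[d] S := by simp

end Density

end Graph

/-- **Upper blow-up theorem** (abelian instance): let `E` be an `n`-dimensional real
inner product space (`n ≥ 2`), let `Nm` be an arbitrary norm on `E`, let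
`Σ = {p ∈ Ω | f p = 0}` be the zero level set of a `C¹` function `f` on an open set
`Ω` with nonvanishing differential, and let `σ_Σ = H^{n-1} ⌞ Σ`. Then the spherical
Federer density of `σ_Σ` at `x ∈ Σ` with respect to `Nm` equals
`β(Nm, ν(x)) = sup_{z ∈ C} H^{n-1}((z + C) ∩ N(ν(x)))`, where `C` is the `Nm`-unit
ball and `ν(x) = ∇f(x)/|∇f(x)|`. -/
theorem upper_blowup_of_perimeter
    {E : Type*} [NormedAddCommGroup E] [InnerProductSpace ℝ E]
    [FiniteDimensional ℝ E] [MeasurableSpace E] [BorelSpace E]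
    (n : ℕ) (hn : Module.finrank ℝ E = n) (hn2 : 2 ≤ n)
    (Nm : E → ℝ)
    (hNm0 : ∀ z : E, Nm z = 0 ↔ z = 0)
    (hNmsmul : ∀ (a : ℝ) (z : E), Nm (a • z) = |a| * Nm z)
    (hNmadd : ∀ z w : E, Nm (z + w) ≤ Nm z + Nm w)
    (Ω : Set E) (hΩ : IsOpen Ω)
    (f : E → ℝ) (hf : ContDiffOn ℝ 1 f Ω)
    (hf' : ∀ p ∈ Ω, fderiv ℝ f p ≠ 0)
    (x : E) (hxΩ : x ∈ Ω) (hfx : f x = 0) :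
    (⨅ (r : ℝ) (_ : 0 < r), ⨆ (y : E) (t : ℝ) (_ : 0 < t) (_ : t < r)
        (_ : Nm (x - y) ≤ t),
        μH[(n : ℝ) - 1] ({z : E | Nm (z - y) ≤ t} ∩ {p ∈ Ω | f p = 0}) /
          ENNReal.ofReal t ^ ((n : ℝ) - 1)) =
      ⨆ (z : E) (_ : Nm z ≤ 1),
        μH[(n : ℝ) - 1] ({w : E | Nm (w - z) ≤ 1} ∩
          {w : E | ⟪w, ‖gradient f x‖⁻¹ • gradient f x⟫ = 0}) := by
  have hd : (0 : ℝ) ≤ (n : ℝ) - 1 := by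
    have : (2 : ℝ) ≤ n := by exact_mod_cast hn2
    linarith
  let p : Seminorm ℝ E := Seminorm.of Nm hNmadd hNmsmul
  have hp : ∀ z, p z = Nm z := fun z => rfl
  simp only [← hp]
  set g := gradient f x with hg
  have hfd : ContDiffAt ℝ 1 f x := hf.contDiffAt (hΩ.mem_nhds hxΩ)
  have hL : HasStrictFDerivAt f (fderiv ℝ f x) x := hfd.hasStrictFDerivAt one_ne_zero
  have hgL : ∀ w, fderiv ℝ f x w = ⟪g, w⟫ := fun w => by
    rw [hg, ← toDual_gradient, InnerProductSpace.toDual_apply_apply]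
  have hg0 : g ≠ 0 := fun h => hf' x hxΩ (by ext w; simp [hgL, h])
  have hgpos : 0 < ‖g‖ := norm_pos_iff.2 hg0
  set ν := ‖g‖⁻¹ • g with hν
  have hν1 : ‖ν‖ = 1 := by simp [hν, norm_smul, hgpos.ne']
  have hLν : ∀ w, fderiv ℝ f x w = ‖g‖ * ⟪w, ν⟫ := fun w => by
    rw [hgL, hν, inner_smul_right, mul_inv_cancel_left₀ hgpos.ne', real_inner_comm]
  obtain ⟨K, hK, hpK, hKp⟩ := p.exists_equiv_norm fun z hz => (hNm0 z).1 hz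
  have hgraph := fun (ε : ℝ) (hε : 0 < ε) (hε1 : ε ≤ 1) =>
    exists_local_graph hΩ hf.continuousOn hxΩ hfx hν1 hgpos hL hLν hε hε1
  have hlim : ∀ (u : ℝ → ℝ) (b : ℝ≥0∞), ContinuousAt u 0 → u 0 = 1 →
      Filter.Tendsto (fun ε => ENNReal.ofReal (u ε) ^ ((n : ℝ) - 1) * b) (𝓝[>] 0) (𝓝 b) := by
    intro u b hu hu1
    have h1 : Filter.Tendsto (fun ε => ENNReal.ofReal (u ε) ^ ((n : ℝ) - 1)) (𝓝[>] 0) (𝓝 1) := by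
      have h2 := (ENNReal.tendsto_ofReal hu.tendsto).ennrpow_const ((n : ℝ) - 1)
      rw [hu1, ENNReal.ofReal_one, ENNReal.one_rpow] at h2
      exact h2.mono_left nhdsWithin_le_nhds
    simpa using ENNReal.Tendsto.mul_const h1 (Or.inl one_ne_zero)
  have hdiv : ∀ t : ℝ, 0 < t → ENNReal.ofReal t ^ ((n : ℝ) - 1) ≠ 0 ∧
      ENNReal.ofReal t ^ ((n : ℝ) - 1) ≠ ∞ := fun t ht =>
    ⟨(ENNReal.rpow_pos (ENNReal.ofReal_pos.2 ht) ENNReal.ofReal_ne_top).ne',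
      ENNReal.rpow_ne_top_of_nonneg hd ENNReal.ofReal_ne_top⟩
  refine le_antisymm ?_ ?_
  · refine ge_of_tendsto (hlim (fun ε => (1 - ε)⁻¹ * (1 + 2 * K ^ 2 * ε)) _ ?_ (by simp)) ?_
    · exact ContinuousAt.mul (ContinuousAt.inv₀ (by fun_prop) (by simp)) (by fun_prop)
    filter_upwards [Ioo_mem_nhdsGT (zero_lt_one' ℝ)] with ε hε
    obtain ⟨δ, hδ, hδ1, -⟩ := hgraph ε hε.1 hε.2.le
    refine iInf₂_le_of_le (δ / (2 * K)) (by positivity) ?_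
    simp only [iSup_le_iff]
    intro y t ht htδ hxy
    rw [lt_div_iff₀ (by positivity)] at htδ
    rw [ENNReal.div_le_iff (hdiv t ht).1 (hdiv t ht).2, mul_right_comm]
    exact hausdorffMeasure_ball_inter_graph_le hK hpK hKp hν1 hd hε.1 hε.2 hfx hδ1 ht
      (by linarith) hxy
  · refine le_iInf₂ fun r hr => iSup₂_le fun z hz => ?_
    refine le_of_tendsto (hlim (fun ε => 1 - 2 * K ^ 2 * ε) _ (by fun_prop) (by simp)) ?_
    have hpos : 0 < min 1 (2 * K ^ 2)⁻¹ := by positivity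
    filter_upwards [Ioo_mem_nhdsGT hpos] with ε hε
    obtain ⟨δ, hδ, -, hδ2⟩ := hgraph ε hε.1 (hε.2.le.trans (min_le_left _ _))
    have hε1 : 2 * K ^ 2 * ε < 1 := by
      have := hε.2.trans_le (min_le_right _ _)
      rwa [← one_div, lt_div_iff₀' (by positivity)] at this
    obtain ⟨t, ht, htm⟩ := exists_between (show 0 < min r (δ / (2 * K)) by positivity)
    have htδ : t * (2 * K) < δ := (lt_div_iff₀ (by positivity)).1 (htm.trans_le (min_le_right _ _))
    have hc : 0 < t * (1 - 2 * K ^ 2 * ε) := mul_pos ht (by linarith)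
    have hxy : p (x - (x + (t * (1 - 2 * K ^ 2 * ε)) • z)) ≤ t := by
      rw [sub_add_cancel_left, map_neg_eq_map, map_smul_eq_mul, Real.norm_of_nonneg hc.le]
      have : 0 ≤ t * (2 * K ^ 2 * ε) := mul_nonneg ht.le (mul_nonneg (by positivity) hε.1.le)
      nlinarith
    refine le_iSup_of_le (x + (t * (1 - 2 * K ^ 2 * ε)) • z) <| le_iSup_of_le t <|
      le_iSup_of_le ht <| le_iSup_of_le (htm.trans_le (min_le_left _ _)) <|
      le_iSup_of_le hxy ?_
    rw [ENNReal.le_div_iff_mul_le (Or.inl (hdiv t ht).1) (Or.inl (hdiv t ht).2), mul_right_comm]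
    exact le_hausdorffMeasure_ball_inter_graph hK hpK hKp hν1 hd hε.1 hε1 hδ2 hz ht
      (by linarith)
end

section
/- Let E be a real inner product space of finite dimension n ≥ 2 and let ‖·‖ be an arbitrary norm on E with unit ball C = {z ∈ E : ‖z‖ ≤ 1}. Let Ω ⊆ E be open, f : Ω → ℝ continuously Fréchet differentiable with Df(x) ≠ 0 for all x ∈ Ω, Σ = {x ∈ Ω : f(x) = 0}, and ν(x) = ∇f(x)/|∇f(x)|. Let S_0^{n−1} be the spherical Hausdorff measure of dimension n−1 with respect to ‖·‖ with constant 2^{−(n−1)}. Then for every Borel set A ⊆ Σ, H^{n−1}(A) = ∫_A β(‖·‖, ν(x)) dS_0^{n−1}(x), where β(‖·‖, ν) = sup_{z ∈ C} H^{n−1}((z + C) ∩ N(ν)) and H^{n−1} is the Euclidean (inner-product) Hausdorff measure. Equivalently, the perimeter/intrinsic measure σ_Σ = H^{n−1}⌞Σ of the hypersurface Σ satisfies σ_Σ = β(‖·‖, ν_Σ) · S_0^{n−1}⌞Σ. (This is the area formula for the perimeter measure of a parametrized regular hypersurface, in the abelian instance where every norm is a homogeneous distance and Q = n.) -/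
open MeasureTheory Metric Set
open scoped Pointwise RealInnerProductSpace ENNReal Topology

section Spherical

variable {E : Type*} [NormedAddCommGroup E] [NormedSpace ℝ E]

/-- The size-`δ` spherical premeasure: coverings by balls of the seminorm `p` of radius `t j`
with `2 * t j ≤ δ`, each contributing `(t j) ^ d`. -/
noncomputable def sphericalPre (p : Seminorm ℝ E) (d δ : ℝ) (A : Set E) : ℝ≥0∞ :=
  ⨅ (y : ℕ → E) (t : ℕ → ℝ)
    (_ : (∀ j, 0 ≤ t j) ∧ (∀ j, 2 * t j ≤ δ) ∧ A ⊆ ⋃ j, {z : E | p (z - y j) ≤ t j}),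
    ∑' j, ENNReal.ofReal (t j) ^ d

theorem sphericalPre_le_tsum {ι : Type*} [Countable ι] {p : Seminorm ℝ E} {d δ : ℝ}
    (hd : 0 < d) (hδ : 0 < δ) {A : Set E} (y : ι → E) (t : ι → ℝ) (ht : ∀ i, 0 ≤ t i)
    (htδ : ∀ i, 2 * t i ≤ δ) (hA : A ⊆ ⋃ i, {z : E | p (z - y i) ≤ t i}) :
    sphericalPre p d δ A ≤ ∑' i, ENNReal.ofReal (t i) ^ d := by
  obtain ⟨e, he⟩ := exists_injective_nat ι
  have key : ∀ j, (∃ i, e i = j ∧ Function.extend e t 0 j = t i) ∨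
      Function.extend e t 0 j = 0 := by
    intro j
    by_cases hj : ∃ i, e i = j
    · obtain ⟨i, rfl⟩ := hj
      exact Or.inl ⟨i, rfl, he.extend_apply _ _ _⟩
    · exact Or.inr (Function.extend_apply' _ _ _ hj)
  have hcov : (∀ j, 0 ≤ Function.extend e t 0 j) ∧ (∀ j, 2 * Function.extend e t 0 j ≤ δ) ∧
      A ⊆ ⋃ j, {z : E | p (z - Function.extend e y 0 j) ≤ Function.extend e t 0 j} := by
    refine ⟨fun j => ?_, fun j => ?_, hA.trans (iUnion_subset fun i => ?_)⟩
    · rcases key j with ⟨i, -, h⟩ | h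
      · exact h ▸ ht i
      · exact h.ge
    · rcases key j with ⟨i, -, h⟩ | h
      · exact h ▸ htδ i
      · rw [h]; linarith
    · refine subset_iUnion_of_subset (e i) ?_
      rw [he.extend_apply, he.extend_apply]
  refine (iInf₂_le_of_le (Function.extend e y 0) (Function.extend e t 0)
    (iInf_le _ hcov)).trans_eq ?_
  rw [← tsum_extend_zero he]
  refine tsum_congr fun j => ?_
  by_cases hj : ∃ i, e i = j
  · obtain ⟨i, rfl⟩ := hj
    rw [he.extend_apply, he.extend_apply]
  · rw [Function.extend_apply' _ _ _ hj, Function.extend_apply' _ _ _ hj]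
    simp [hd]

theorem sphericalPre_mono {p : Seminorm ℝ E} {d δ : ℝ} {A B : Set E} (h : A ⊆ B) :
    sphericalPre p d δ A ≤ sphericalPre p d δ B :=
  iInf_mono fun _ => iInf_mono fun _ => iInf_mono' fun hB =>
    ⟨⟨hB.1, hB.2.1, h.trans hB.2.2⟩, le_rfl⟩

theorem exists_cover_of_sphericalPre_lt {p : Seminorm ℝ E} {d δ : ℝ} {A : Set E} {c : ℝ≥0∞}
    (h : sphericalPre p d δ A < c) :
    ∃ (y : ℕ → E) (t : ℕ → ℝ), (∀ j, 0 ≤ t j) ∧ (∀ j, 2 * t j ≤ δ) ∧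
      A ⊆ ⋃ j, {z : E | p (z - y j) ≤ t j} ∧ ∑' j, ENNReal.ofReal (t j) ^ d < c := by
  simp only [sphericalPre, iInf_lt_iff] at h
  obtain ⟨y, t, ⟨h1, h2, h3⟩, h4⟩ := h
  exact ⟨y, t, h1, h2, h3, h4⟩

theorem sphericalPre_union_le {p : Seminorm ℝ E} {d δ : ℝ} (hd : 0 < d) (hδ : 0 < δ)
    (A B : Set E) :
    sphericalPre p d δ (A ∪ B) ≤ sphericalPre p d δ A + sphericalPre p d δ B := by
  refine ENNReal.le_of_forall_pos_le_add fun ε hε hfin => ?_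
  have hA := (ENNReal.add_lt_top.1 hfin).1
  have hB := (ENNReal.add_lt_top.1 hfin).2
  have hε2 : (ε / 2 : ℝ≥0∞) ≠ 0 := by simpa using hε.ne'
  obtain ⟨y, t, h1, h2, h3, h4⟩ :=
    exists_cover_of_sphericalPre_lt (ENNReal.lt_add_right hA.ne hε2)
  obtain ⟨y', t', h1', h2', h3', h4'⟩ :=
    exists_cover_of_sphericalPre_lt (ENNReal.lt_add_right hB.ne hε2)
  refine (sphericalPre_le_tsum (ι := ℕ ⊕ ℕ) hd hδ (Sum.elim y y') (Sum.elim t t')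
    ?_ ?_ ?_).trans ?_
  · rintro (i | i)
    exacts [h1 i, h1' i]
  · rintro (i | i)
    exacts [h2 i, h2' i]
  · rw [iUnion_sum]
    exact union_subset_union h3 h3'
  · rw [ENNReal.summable.tsum_sum ENNReal.summable]
    calc _ ≤ (sphericalPre p d δ A + ε / 2) + (sphericalPre p d δ B + ε / 2) :=
          add_le_add h4.le h4'.le
      _ = _ := by rw [add_add_add_comm, ENNReal.add_halves]

/-- A self-map of `B` that is a small Lipschitz perturbation of the identity barely increases
the spherical premeasure. -/
theorem sphericalPre_image_le {p : Seminorm ℝ E} {a b d δ ε : ℝ} (ha : 0 < a) (hb : 0 < b)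
    (hap : ∀ z, a * ‖z‖ ≤ p z) (hpb : ∀ z, p z ≤ b * ‖z‖) (hd : 0 < d) (hδ : 0 < δ)
    (hε : 0 ≤ ε) {B : Set E} {g : E → E}
    (hg : ∀ u ∈ B, ∀ v ∈ B, ‖(g u - g v) - (u - v)‖ ≤ ε * ‖u - v‖) :
    sphericalPre p d δ (g '' B) ≤ ENNReal.ofReal (1 + 2 * b / a * ε) ^ d *
      sphericalPre p d (δ / (1 + 2 * b / a * ε)) B := by
  set K := 1 + 2 * b / a * ε with hK
  have hK0 : 0 < K := by positivity
  have hKd : ENNReal.ofReal K ^ d ≠ 0 := by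
    simp [ENNReal.rpow_eq_zero_iff, hK0]
  have hKt : ENNReal.ofReal K ^ d ≠ ∞ := ENNReal.rpow_ne_top_of_nonneg hd.le ENNReal.ofReal_ne_top
  rw [mul_comm, ← ENNReal.div_le_iff_le_mul (Or.inl hKd) (Or.inl hKt)]
  refine le_iInf fun y => le_iInf fun t => le_iInf fun h => ?_
  obtain ⟨h1, h2, h3⟩ := h
  rw [ENNReal.div_le_iff_le_mul (Or.inl hKd) (Or.inl hKt), ← ENNReal.tsum_mul_right]
  have : ∀ j, ∃ y' : E, ∀ z ∈ B, p (z - y j) ≤ t j → p (g z - y') ≤ K * t j := by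
    intro j
    by_cases hne : ∃ z₀ ∈ B, p (z₀ - y j) ≤ t j
    · obtain ⟨z₀, hz₀, hp₀⟩ := hne
      refine ⟨y j + (g z₀ - z₀), fun z hz hpz => ?_⟩
      have e1 : g z - (y j + (g z₀ - z₀)) = (z - y j) + ((g z - g z₀) - (z - z₀)) := by abel
      have e2 : p (z - z₀) ≤ t j + t j := by
        have : z - z₀ = (z - y j) - (z₀ - y j) := by abel
        rw [this]
        exact (map_sub_le_add p _ _).trans (add_le_add hpz hp₀)
      have e3 : ‖z - z₀‖ ≤ 2 * t j / a := by
        rw [le_div_iff₀ ha]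
        linarith [hap (z - z₀)]
      rw [e1]
      calc p ((z - y j) + ((g z - g z₀) - (z - z₀)))
          ≤ t j + b * (ε * (2 * t j / a)) :=
            (map_add_le_add p _ _).trans (add_le_add hpz ((hpb _).trans (by
              gcongr; exact (hg z hz z₀ hz₀).trans (by gcongr))))
        _ = K * t j := by rw [hK]; field_simp
    · push Not at hne
      exact ⟨0, fun z hz hpz => absurd hpz (hne z hz).not_ge⟩
  choose y' hy' using this
  refine (sphericalPre_le_tsum hd hδ y' (fun j => K * t j) (fun j => by have := h1 j; positivity)
    (fun j => ?_) ?_).trans_eq ?_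
  · have := h2 j
    rw [le_div_iff₀ hK0] at this
    linarith
  · rintro _ ⟨z, hz, rfl⟩
    obtain ⟨j, hj⟩ := mem_iUnion.1 (h3 hz)
    exact mem_iUnion.2 ⟨j, hy' j z hz hj⟩
  · refine tsum_congr fun j => ?_
    rw [ENNReal.ofReal_mul hK0.le, ENNReal.mul_rpow_of_nonneg _ _ hd.le, mul_comm]

theorem sphericalPre_le_hausdorffMeasure [MeasurableSpace E] [BorelSpace E]
    {p : Seminorm ℝ E} {b d δ : ℝ} (hb : 0 < b)
    (hpb : ∀ z, p z ≤ b * ‖z‖) (hd : 0 < d) (hδ : 0 < δ) (A : Set E) :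
    sphericalPre p d δ A ≤ ENNReal.ofReal b ^ d * μH[d] A := by
  have hbd : ENNReal.ofReal b ^ d ≠ 0 := by
    simp [ENNReal.rpow_eq_zero_iff, hb]
  have hbt : ENNReal.ofReal b ^ d ≠ ∞ := ENNReal.rpow_ne_top_of_nonneg hd.le ENNReal.ofReal_ne_top
  rw [mul_comm, ← ENNReal.div_le_iff_le_mul (Or.inl hbd) (Or.inl hbt),
    Measure.hausdorffMeasure_apply]
  have hr : 0 < δ / (2 * b) := by positivity
  refine le_iSup₂_of_le (ENNReal.ofReal (δ / (2 * b))) (by simpa using hr) ?_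
  refine le_iInf fun T => le_iInf fun hAT => le_iInf fun hT => ?_
  rw [ENNReal.div_le_iff_le_mul (Or.inl hbd) (Or.inl hbt), ← ENNReal.tsum_mul_right]
  have hTt : ∀ j, ediam (T j) ≠ ∞ := fun j => ne_top_of_le_ne_top ENNReal.ofReal_ne_top (hT j)
  have : ∀ j, ∃ y : E, (T j).Nonempty → y ∈ T j := by
    intro j
    by_cases h : (T j).Nonempty
    · exact ⟨h.some, fun h' => h.some_mem⟩
    · exact ⟨0, fun h' => absurd h' h⟩
  choose y hy using this
  refine (sphericalPre_le_tsum hd hδ y (fun j => b * (ediam (T j)).toReal)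
    (fun j => by positivity) (fun j => ?_) ?_).trans ?_
  · have := ENNReal.toReal_le_of_le_ofReal hr.le (hT j)
    rw [le_div_iff₀ (by positivity)] at this
    linarith
  · intro z hz
    obtain ⟨j, hj⟩ := mem_iUnion.1 (hAT hz)
    refine mem_iUnion.2 ⟨j, (hpb _).trans ?_⟩
    gcongr
    rw [← dist_eq_norm, dist_edist]
    exact ENNReal.toReal_mono (hTt j) (edist_le_ediam_of_mem hj (hy j ⟨z, hj⟩))
  · refine ENNReal.tsum_le_tsum fun j => ?_
    rw [ENNReal.ofReal_mul hb.le, ENNReal.ofReal_toReal (hTt j),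
      ENNReal.mul_rpow_of_nonneg _ _ hd.le, mul_comm]
    gcongr
    by_cases h : (T j).Nonempty
    · simp [h]
    · rw [not_nonempty_iff_eq_empty.1 h]
      simp [hd]

/-- `S` is the `d`-dimensional spherical Hausdorff measure of the seminorm `p`. -/
def IsSphericalMeasure [MeasurableSpace E] (p : Seminorm ℝ E) (d : ℝ) (S : Measure E) : Prop :=
  ∀ A : Set E, S A = ⨆ (δ : ℝ) (_ : 0 < δ), sphericalPre p d δ A

variable [MeasurableSpace E] {p : Seminorm ℝ E} {d : ℝ} {S : Measure E}

theorem IsSphericalMeasure.pre_le (hS : IsSphericalMeasure p d S) {δ : ℝ} (hδ : 0 < δ)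
    (A : Set E) : sphericalPre p d δ A ≤ S A := by
  rw [hS]
  exact le_iSup₂_of_le δ hδ le_rfl

theorem IsSphericalMeasure.image_le (hS : IsSphericalMeasure p d S) {a b ε : ℝ}
    (ha : 0 < a) (hb : 0 < b) (hap : ∀ z, a * ‖z‖ ≤ p z) (hpb : ∀ z, p z ≤ b * ‖z‖)
    (hd : 0 < d) (hε : 0 ≤ ε) {B : Set E} {g : E → E}
    (hg : ∀ u ∈ B, ∀ v ∈ B, ‖(g u - g v) - (u - v)‖ ≤ ε * ‖u - v‖) :
    S (g '' B) ≤ ENNReal.ofReal (1 + 2 * b / a * ε) ^ d * S B := by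
  rw [hS (g '' B)]
  refine iSup₂_le fun δ hδ => (sphericalPre_image_le ha hb hap hpb hd hδ hε hg).trans ?_
  gcongr
  exact hS.pre_le (by positivity) B

theorem IsSphericalMeasure.null_of_hausdorffMeasure_null [BorelSpace E]
    (hS : IsSphericalMeasure p d S)
    {b : ℝ} (hb : 0 < b) (hpb : ∀ z, p z ≤ b * ‖z‖) (hd : 0 < d) {A : Set E}
    (hA : μH[d] A = 0) : S A = 0 := by
  rw [hS, ← nonpos_iff_eq_zero]
  refine iSup₂_le fun δ hδ => (sphericalPre_le_hausdorffMeasure hb hpb hd hδ A).trans ?_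
  simp [hA]

end Spherical

section Flat

variable {E : Type*} [NormedAddCommGroup E] [InnerProductSpace ℝ E] {p : Seminorm ℝ E} {a b : ℝ}
  (N : Submodule ℝ E)

theorem ball_slice_subset (ha : 0 < a) (hap : ∀ z, a * ‖z‖ ≤ p z) (x : N) {r : ℝ} (hr : 0 < r)
    {z : E} (hz : p z ≤ 1) :
    {w : N | p (w - (x + r • z)) ≤ r} ⊆ closedBall x (r * (2 / a)) := by
  intro w hw
  rw [mem_closedBall, dist_eq_norm, mul_div_assoc', le_div_iff₀ ha, mul_comm, Submodule.coe_norm]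
  refine (hap _).trans ?_
  have e : ((w - x : N) : E) = ((w : E) - (x + r • z)) + r • z := by
    rw [Submodule.coe_sub]; abel
  rw [e]
  refine (map_add_le_add p _ _).trans ?_
  rw [map_smul_eq_mul, Real.norm_of_nonneg hr.le]
  nlinarith [mem_ofPred_eq ▸ hw]

variable [MeasurableSpace E] [BorelSpace E]

/-- The largest measure of the trace on `N` of a unit ball of `p` centred in the unit ball. -/
noncomputable def sliceSup (p : Seminorm ℝ E) (d : ℝ) (N : Set E) : ℝ≥0∞ :=
  ⨆ (z : E) (_ : p z ≤ 1), μH[d] ({w : E | p (w - z) ≤ 1} ∩ N)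

theorem hausdorffMeasure_inter_coe {d : ℝ} (hd : 0 < d) (A : Set E) :
    μH[d] (A ∩ N) = μH[d] ((↑) ⁻¹' A : Set N) := by
  have h : Isometry ((↑) : N → E) := isometry_subtype_coe
  rw [h.hausdorffMeasure_preimage (Or.inl hd.le), Subtype.range_coe]

variable [FiniteDimensional ℝ E]

theorem hausdorffMeasure_ball_slice (x : N) {r : ℝ} (hr : 0 < r) (z : E) :
    μH[Module.finrank ℝ N] {w : N | p (w - (x + r • z)) ≤ r} =
      ENNReal.ofReal r ^ (Module.finrank ℝ N : ℝ) *
        μH[Module.finrank ℝ N] {w : N | p (w - z) ≤ 1} := by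
  have : {w : N | p (w - (x + r • z)) ≤ r} =
      (fun w => w + -x) ⁻¹' (r • {w : N | p (w - z) ≤ 1}) := by
    ext w
    rw [mem_preimage, mem_smul_set_iff_inv_smul_mem₀ hr.ne']
    have e : ((r⁻¹ • (w + -x) : N) : E) - z = r⁻¹ • ((w : E) - (x + r • z)) := by
      simp only [Submodule.coe_smul, Submodule.coe_add, Submodule.coe_neg, smul_sub, smul_add,
        smul_smul, inv_mul_cancel₀ hr.ne', one_smul, smul_neg]
      abel
    simp only [mem_ofPred_eq]
    rw [e, map_smul_eq_mul, Real.norm_of_nonneg (by positivity), inv_mul_le_iff₀ hr, mul_one]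
  rw [this, measure_preimage_add_right, Measure.addHaar_smul, abs_of_nonneg (by positivity),
    ENNReal.ofReal_pow hr.le, ENNReal.rpow_natCast]

theorem sliceSup_ne_top (ha : 0 < a) (hap : ∀ z, a * ‖z‖ ≤ p z) (hN : 0 < Module.finrank ℝ N) :
    sliceSup p (Module.finrank ℝ N) N ≠ ∞ := by
  refine ne_top_of_le_ne_top
    (b := μH[Module.finrank ℝ N] (closedBall (0 : N) (1 * (2 / a))))
    measure_closedBall_lt_top.ne ?_
  refine iSup₂_le fun z hz => ?_
  rw [hausdorffMeasure_inter_coe N (by exact_mod_cast hN)]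
  refine measure_mono ?_
  simpa using ball_slice_subset N ha hap 0 one_pos hz

theorem sliceSup_ne_zero (hb : 0 < b) (hpb : ∀ z, p z ≤ b * ‖z‖) (hN : 0 < Module.finrank ℝ N) :
    sliceSup p (Module.finrank ℝ N) N ≠ 0 := by
  refine (lt_of_lt_of_le (measure_closedBall_pos μH[Module.finrank ℝ N] (0 : N)
    (inv_pos.2 hb)) ?_).ne'
  refine le_iSup₂_of_le 0 (by simp) ?_
  rw [hausdorffMeasure_inter_coe N (by exact_mod_cast hN)]
  refine measure_mono fun w hw => ?_
  simp only [mem_closedBall_zero_iff, Submodule.coe_norm] at hw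
  simp only [sub_zero, mem_preimage, mem_ofPred_eq]
  refine (hpb w).trans ?_
  rw [← le_div_iff₀' hb, one_div]
  exact hw

theorem hausdorffMeasure_inter_ball_le (ha : 0 < a) (hap : ∀ z, a * ‖z‖ ≤ p z)
    (hN : 0 < Module.finrank ℝ N) (y : E) {t : ℝ} (ht : 0 ≤ t) :
    μH[Module.finrank ℝ N] ({w : E | p (w - y) ≤ t} ∩ N) ≤
      ENNReal.ofReal t ^ (Module.finrank ℝ N : ℝ) * sliceSup p (Module.finrank ℝ N) N := by
  have hd : (0 : ℝ) < Module.finrank ℝ N := by exact_mod_cast hN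
  rcases ht.eq_or_lt with rfl | ht
  · have : ({w : E | p (w - y) ≤ 0} ∩ N).Subsingleton := by
      refine subsingleton_singleton (a := y) |>.anti fun w hw => ?_
      have h1 := (hap (w - y)).trans hw.1
      have h2 : ‖w - y‖ ≤ 0 := by
        by_contra! h
        nlinarith
      simpa [sub_eq_zero] using h2
    have hna := Measure.nullSingletonClass_hausdorff E hd
    rw [this.measure_zero]
    exact zero_le
  · rcases ({w : E | p (w - y) ≤ t} ∩ N).eq_empty_or_nonempty with h | ⟨x, hx, hxN⟩
    · simp [h]
    · have hy : y = x + t • (t⁻¹ • (y - x)) := by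
        rw [smul_smul, mul_inv_cancel₀ ht.ne', one_smul]; abel
      have hz : p (t⁻¹ • (y - x)) ≤ 1 := by
        rw [map_smul_eq_mul, Real.norm_of_nonneg (by positivity), inv_mul_le_iff₀ ht, mul_one,
          map_sub_rev]
        exact hx
      rw [hausdorffMeasure_inter_coe N hd]
      have := hausdorffMeasure_ball_slice (p := p) N ⟨x, hxN⟩ ht (t⁻¹ • (y - x))
      simp only [← hy] at this
      rw [preimage_ofPred_eq, this]
      gcongr
      refine le_iSup₂_of_le _ hz ?_
      rw [hausdorffMeasure_inter_coe N hd]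
      rfl

theorem hausdorffMeasure_le_sliceSup_mul {S : Measure E}
    (hS : IsSphericalMeasure p (Module.finrank ℝ N) S) (ha : 0 < a) (hap : ∀ z, a * ‖z‖ ≤ p z)
    (hb : 0 < b) (hpb : ∀ z, p z ≤ b * ‖z‖) (hN : 0 < Module.finrank ℝ N) {A : Set E}
    (hA : A ⊆ N) :
    μH[Module.finrank ℝ N] A ≤ sliceSup p (Module.finrank ℝ N) N * S A := by
  have h0 := sliceSup_ne_zero N hb hpb hN
  have ht := sliceSup_ne_top N ha hap hN
  rw [mul_comm, ← ENNReal.div_le_iff_le_mul (Or.inl h0) (Or.inl ht)]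
  refine le_trans ?_ (hS.pre_le one_pos A)
  refine le_iInf fun y => le_iInf fun t => le_iInf fun h => ?_
  obtain ⟨h1, -, h3⟩ := h
  rw [ENNReal.div_le_iff_le_mul (Or.inl h0) (Or.inl ht), ← ENNReal.tsum_mul_right]
  calc μH[Module.finrank ℝ N] A
      ≤ μH[Module.finrank ℝ N] (⋃ j, {z : E | p (z - y j) ≤ t j} ∩ N) := by
        rw [← iUnion_inter]
        exact measure_mono (subset_inter h3 hA)
    _ ≤ _ := (measure_iUnion_le _).trans
        (ENNReal.tsum_le_tsum fun j => hausdorffMeasure_inter_ball_le N ha hap hN (y j) (h1 j))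

theorem hausdorffMeasure_slice_mul_pre_le {S : Measure E}
    (hS : IsSphericalMeasure p (Module.finrank ℝ N) S) (ha : 0 < a) (hap : ∀ z, a * ‖z‖ ≤ p z)
    (hb : 0 < b) (hpb : ∀ z, p z ≤ b * ‖z‖) (hN : 0 < Module.finrank ℝ N) {z : E} (hz : p z ≤ 1)
    {δ : ℝ} (hδ : 0 < δ) (s : Set N) :
    μH[Module.finrank ℝ N] {w : N | p (w - z) ≤ 1} *
      sphericalPre p (Module.finrank ℝ N) δ ((↑) '' s) ≤ μH[Module.finrank ℝ N] s := by
  have hd : (0 : ℝ) < Module.finrank ℝ N := by exact_mod_cast hN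
  set μ : Measure N := μH[Module.finrank ℝ N] with hμ
  set κ := μ {w : N | p (w - z) ≤ 1} with hκ
  by_cases hκ0 : κ = 0
  · simp [hκ0]
  have hpc : Continuous p := by
    refine (LipschitzWith.of_dist_le_mul (K := b.toNNReal) fun x y => ?_).continuous
    rw [Real.coe_toNNReal _ hb.le, dist_eq_norm, dist_eq_norm, Real.norm_eq_abs]
    exact (abs_sub_map_le_sub p x y).trans (hpb _)
  have hclosed : ∀ (y : E) (r : ℝ), IsClosed {w : N | p (w - y) ≤ r} := fun y r =>
    isClosed_le (hpc.comp (continuous_subtype_val.sub continuous_const)) continuous_const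
  have hconv : ∀ (y : E) (r : ℝ), Convex ℝ {w : N | p (w - y) ≤ r} := by
    intro y r
    have := ((p.convex_closedBall y r)).linear_preimage N.subtype
    simpa [Seminorm.closedBall, preimage_ofPred_eq] using this
  have hκt : κ ≠ ∞ := by
    refine ne_top_of_le_ne_top (b := μ (closedBall (0 : N) (1 * (2 / a))))
      measure_closedBall_lt_top.ne (measure_mono ?_)
    simpa using ball_slice_subset N ha hap 0 one_pos hz
  have hslice : ∀ (x : N) {r : ℝ}, 0 < r → μ {w : N | p (w - (x + r • z)) ≤ r} =
      ENNReal.ofReal r ^ (Module.finrank ℝ N : ℝ) * κ := fun x r hr =>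
    hausdorffMeasure_ball_slice N x hr z
  refine ENNReal.le_of_forall_pos_le_add fun η hη _ => ?_
  obtain ⟨U, hsU, hU, hμU⟩ := s.exists_isOpen_le_add μ (ENNReal.coe_ne_zero.2 hη.ne')
  have hR : 0 < 2 / a := by positivity
  obtain ⟨u, hut, huc, hud, hu0⟩ := Vitali.exists_disjoint_covering_ae μ s
    {q : N × ℝ | 0 < q.2 ∧ 2 * q.2 ≤ δ ∧ closedBall q.1 (q.2 * (2 / a)) ⊆ U}
    (μ (closedBall 0 (3 * (2 / a))) / κ).toNNReal (fun q => q.2 * (2 / a)) Prod.fst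
    (fun q => {w : N | p (w - (q.1 + q.2 • z)) ≤ q.2})
    (fun q hq => ball_slice_subset N ha hap q.1 hq.1 hz)
    (by
      rintro ⟨x, r⟩ ⟨hr, -⟩
      simp only at hr ⊢
      rw [ENNReal.coe_toNNReal (ENNReal.div_ne_top measure_closedBall_lt_top.ne hκ0), hslice x hr,
        show 3 * (r * (2 / a)) = r * (3 * (2 / a)) by ring,
        Measure.addHaar_closedBall_mul _ _ hr.le (by positivity), ENNReal.ofReal_pow hr.le,
        ENNReal.rpow_natCast, mul_left_comm, ENNReal.div_mul_cancel hκ0 hκt])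
    (by
      rintro ⟨x, r⟩ ⟨hr, -⟩
      simp only at hr ⊢
      rw [nonempty_iff_ne_empty]
      intro hempty
      have h1 := (hconv (x + r • z) r).addHaar_frontier μ
      rw [(hclosed _ _).frontier_eq, hempty, sdiff_empty, hslice x hr] at h1
      rcases mul_eq_zero.1 h1 with h | h
      · exact ((ENNReal.rpow_pos (ENNReal.ofReal_pos.2 hr) ENNReal.ofReal_ne_top).ne') h
      · exact hκ0 h)
    (fun q _ => hclosed _ _)
    (by
      intro x hx ε hε
      obtain ⟨ρ, hρ, hρU⟩ := Metric.nhds_basis_closedBall.mem_iff.1 (hU.mem_nhds (hsU hx))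
      have hm : 0 < min (δ / 2) (min ρ ε / (2 / a)) := by positivity
      refine ⟨(x, min (δ / 2) (min ρ ε / (2 / a))), ⟨hm, ?_, ?_⟩, ?_, rfl⟩
      · have := min_le_left (δ / 2) (min ρ ε / (2 / a))
        simp only
        linarith
      · refine (closedBall_subset_closedBall ?_).trans hρU
        simp only
        rw [← le_div_iff₀ hR]
        exact (min_le_right _ _).trans (by gcongr; exact min_le_left _ _)
      · simp only
        rw [← le_div_iff₀ hR]
        exact (min_le_right _ _).trans (by gcongr; exact min_le_right _ _))
  have : Countable u := huc.to_subtype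
  set V : Set N := ⋃ q ∈ u, {w : N | p (w - (q.1 + q.2 • z)) ≤ q.2} with hV
  have hnull : sphericalPre p (Module.finrank ℝ N) δ ((↑) '' (s \ V)) = 0 := by
    rw [← nonpos_iff_eq_zero]
    refine (hS.pre_le hδ _).trans_eq (hS.null_of_hausdorffMeasure_null hb hpb hd ?_)
    have h : Isometry ((↑) : N → E) := isometry_subtype_coe
    rw [h.hausdorffMeasure_image (Or.inl hd.le)]
    exact hu0
  have hpre : sphericalPre p (Module.finrank ℝ N) δ ((↑) '' s) ≤
      ∑' q : u, ENNReal.ofReal q.1.2 ^ (Module.finrank ℝ N : ℝ) := by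
    calc sphericalPre p (Module.finrank ℝ N) δ ((↑) '' s)
        ≤ sphericalPre p (Module.finrank ℝ N) δ ((↑) '' (s \ V) ∪ (↑) '' V) := by
          refine sphericalPre_mono ?_
          rw [← image_union, sdiff_union_self]
          exact image_mono subset_union_left
      _ ≤ 0 + sphericalPre p (Module.finrank ℝ N) δ ((↑) '' V) :=
          (sphericalPre_union_le hd hδ _ _).trans_eq (by rw [hnull])
      _ ≤ _ := by
          rw [zero_add]
          refine sphericalPre_le_tsum hd hδ (fun q : u => (q.1.1 : E) + q.1.2 • z)
            (fun q => q.1.2) (fun q => (hut q.2).1.le) (fun q => (hut q.2).2.1) ?_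
          rintro _ ⟨w, hw, rfl⟩
          obtain ⟨q, hq, hwq⟩ := mem_iUnion₂.1 hw
          exact mem_iUnion.2 ⟨⟨q, hq⟩, hwq⟩
  calc κ * sphericalPre p (Module.finrank ℝ N) δ ((↑) '' s)
      ≤ κ * ∑' q : u, ENNReal.ofReal q.1.2 ^ (Module.finrank ℝ N : ℝ) := by gcongr
    _ = ∑' q : u, μ {w : N | p (w - (q.1.1 + q.1.2 • z)) ≤ q.1.2} := by
        rw [← ENNReal.tsum_mul_left]
        exact tsum_congr fun q => by rw [hslice _ (hut q.2).1, mul_comm]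
    _ = μ V := (measure_biUnion huc hud fun q _ => (hclosed _ _).measurableSet).symm
    _ ≤ μ U := measure_mono (iUnion₂_subset fun q hq =>
        (ball_slice_subset N ha hap q.1 (hut hq).1 hz).trans (hut hq).2.2)
    _ ≤ μ s + η := hμU

/-- The area formula for subsets of a linear subspace. -/
theorem hausdorffMeasure_eq_sliceSup_mul {S : Measure E}
    (hS : IsSphericalMeasure p (Module.finrank ℝ N) S) (ha : 0 < a) (hap : ∀ z, a * ‖z‖ ≤ p z)
    (hb : 0 < b) (hpb : ∀ z, p z ≤ b * ‖z‖) (hN : 0 < Module.finrank ℝ N) {A : Set E}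
    (hA : A ⊆ N) :
    μH[Module.finrank ℝ N] A = sliceSup p (Module.finrank ℝ N) N * S A := by
  have hd : (0 : ℝ) < Module.finrank ℝ N := by exact_mod_cast hN
  refine (hausdorffMeasure_le_sliceSup_mul N hS ha hap hb hpb hN hA).antisymm ?_
  rw [sliceSup, ENNReal.iSup_mul]
  refine iSup_le fun z => ?_
  rw [ENNReal.iSup_mul]
  refine iSup_le fun hz => ?_
  rw [hS A, ENNReal.mul_iSup]
  refine iSup_le fun δ => ?_
  rw [ENNReal.mul_iSup]
  refine iSup_le fun hδ => ?_
  have h1 := hausdorffMeasure_slice_mul_pre_le N hS ha hap hb hpb hN hz hδ ((↑) ⁻¹' A)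
  have h2 : ((↑) '' ((↑) ⁻¹' A : Set N) : Set E) = A :=
    (Subtype.image_preimage_coe _ _).trans (inter_eq_self_of_subset_right hA)
  rw [h2, ← hausdorffMeasure_inter_coe N hd, inter_eq_self_of_subset_left hA] at h1
  rw [hausdorffMeasure_inter_coe N hd]
  exact h1

end Flat

theorem measure_le_of_locally_le {X : Type*} [TopologicalSpace X] [SecondCountableTopology X]
    [MeasurableSpace X] [OpensMeasurableSpace X] {μ₁ μ₂ : Measure X} {A : Set X}
    (hA : MeasurableSet A)
    (h : ∀ x ∈ A, ∃ U ∈ 𝓝 x, ∀ B ⊆ A ∩ U, MeasurableSet B → μ₁ B ≤ μ₂ B) :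
    μ₁ A ≤ μ₂ A := by
  choose! U hU hle using h
  obtain ⟨t, htA, htc, ht⟩ := TopologicalSpace.countable_cover_nhdsWithin
    (f := fun x => interior (U x)) (s := A) fun x hx =>
      mem_nhdsWithin_of_mem_nhds (interior_mem_nhds.2 (hU x hx))
  rcases t.eq_empty_or_nonempty with rfl | hne
  · have : A = ∅ := by simpa using ht
    simp [this]
  obtain ⟨x, rfl⟩ := htc.exists_eq_range hne
  rw [biUnion_range] at ht
  set V : ℕ → Set X := disjointed fun i => A ∩ interior (U (x i)) with hV
  have hVm : ∀ i, MeasurableSet (V i) :=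
    MeasurableSet.disjointed fun i => hA.inter isOpen_interior.measurableSet
  have hVs : ∀ i, V i ⊆ A ∩ U (x i) := fun i =>
    (disjointed_subset _ i).trans (inter_subset_inter_right _ interior_subset)
  have hAV : A = ⋃ i, V i := by
    rw [hV, iUnion_disjointed, ← inter_iUnion]
    exact (inter_eq_self_of_subset_left ht).symm
  rw [hAV, measure_iUnion (disjoint_disjointed _) hVm, measure_iUnion (disjoint_disjointed _) hVm]
  exact ENNReal.tsum_le_tsum fun i => hle _ (htA (mem_range_self i)) _ (hVs i) (hVm i)

theorem hausdorffMeasure_image_le_of_near_id {E : Type*} [NormedAddCommGroup E]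
    [MeasurableSpace E] [BorelSpace E] {d : ℝ} (hd : 0 ≤ d) {ε K : ℝ} (hε : 0 ≤ ε)
    (hK : 1 + ε ≤ K) {B : Set E} {g : E → E}
    (hg : ∀ u ∈ B, ∀ v ∈ B, ‖(g u - g v) - (u - v)‖ ≤ ε * ‖u - v‖) :
    μH[d] (g '' B) ≤ ENNReal.ofReal K ^ d * μH[d] B := by
  refine LipschitzOnWith.hausdorffMeasure_image_le (K := K.toNNReal) ?_ hd
  refine LipschitzOnWith.of_dist_le_mul fun u hu v hv => ?_
  rw [Real.coe_toNNReal _ (by linarith), dist_eq_norm, dist_eq_norm]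
  calc ‖g u - g v‖ = ‖((g u - g v) - (u - v)) + (u - v)‖ := by rw [sub_add_cancel]
    _ ≤ ε * ‖u - v‖ + ‖u - v‖ := (norm_add_le _ _).trans (by gcongr; exact hg u hu v hv)
    _ ≤ K * ‖u - v‖ := by nlinarith [norm_nonneg (u - v)]

section Tilt

variable {E : Type*} [NormedAddCommGroup E] [InnerProductSpace ℝ E] [FiniteDimensional ℝ E]
  [MeasurableSpace E] [BorelSpace E] {p : Seminorm ℝ E} {a b d : ℝ} {S : Measure E}

/-- The distortion factor for sets that are `ε`-close to a hyperplane. -/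
noncomputable def distortion (a b d ε : ℝ) : ℝ≥0∞ :=
  (ENNReal.ofReal (1 + 2 * b / a * (2 * ε)) ^ d) ^ 2

/-- A set with small slopes relative to the hyperplane `νᗮ` almost satisfies the area formula of
the hyperplane. -/
theorem area_formula_of_small_slope (hS : IsSphericalMeasure p d S) (ha : 0 < a) (hab : a ≤ b)
    (hap : ∀ z, a * ‖z‖ ≤ p z) (hpb : ∀ z, p z ≤ b * ‖z‖) (hd : 0 < d) {ν : E} (hν : ‖ν‖ = 1)
    (hfin : (Module.finrank ℝ (ℝ ∙ ν)ᗮ : ℝ) = d) {ε : ℝ} (hε : 0 ≤ ε) (hε2 : ε ≤ 1 / 2)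
    {A : Set E} (hA : ∀ z ∈ A, ∀ w ∈ A, |⟪z - w, ν⟫| ≤ ε * ‖z - w‖) :
    μH[d] A ≤ distortion a b d ε * (sliceSup p d (ℝ ∙ ν)ᗮ * S A) ∧
      sliceSup p d (ℝ ∙ ν)ᗮ * S A ≤ distortion a b d ε * μH[d] A := by
  have hb : 0 < b := ha.trans_le hab
  set P : E → E := fun z => z - ⟪z, ν⟫ • ν with hP
  have hPA : P '' A ⊆ ((ℝ ∙ ν)ᗮ : Submodule ℝ E) := by
    rintro _ ⟨z, -, rfl⟩
    rw [SetLike.mem_coe, Submodule.mem_orthogonal_singleton_iff_inner_left, inner_sub_left,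
      inner_smul_left, real_inner_self_eq_norm_sq, hν]
    simp
  have hflat : μH[d] (P '' A) = sliceSup p d (ℝ ∙ ν)ᗮ * S (P '' A) := by
    subst hfin
    exact hausdorffMeasure_eq_sliceSup_mul _ hS ha hap hb hpb (by exact_mod_cast hd) hPA
  have hPdiff : ∀ z w, (P z - P w) - (z - w) = -(⟪z - w, ν⟫ • ν) := by
    intro z w
    simp only [hP, inner_sub_left, sub_smul]
    abel
  have hP1 : ∀ z ∈ A, ∀ w ∈ A, ‖(P z - P w) - (z - w)‖ ≤ ε * ‖z - w‖ := by
    intro z hz w hw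
    rw [hPdiff, norm_neg, norm_smul, hν, mul_one]
    exact hA z hz w hw
  have hPlow : ∀ z ∈ A, ∀ w ∈ A, ‖z - w‖ ≤ 2 * ‖P z - P w‖ := by
    intro z hz w hw
    have h1 := hP1 z hz w hw
    have h2 : ‖z - w‖ ≤ ‖P z - P w‖ + ‖(P z - P w) - (z - w)‖ := by
      have := norm_sub_le (P z - P w) ((P z - P w) - (z - w))
      rwa [sub_sub_cancel] at this
    nlinarith [norm_nonneg (z - w)]
  have hinj : InjOn P A := by
    intro z hz w hw h
    have := hPlow z hz w hw
    rw [h, sub_self, norm_zero, mul_zero] at this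
    exact sub_eq_zero.1 (norm_le_zero_iff.1 this)
  set g := Function.invFunOn P A with hg
  have hgP : ∀ z ∈ A, g (P z) = z := fun z hz => hinj.leftInvOn_invFunOn hz
  have hgA : g '' (P '' A) = A := hinj.leftInvOn_invFunOn.image_image
  have hP2 : ∀ z ∈ A, ∀ w ∈ A, ‖(P z - P w) - (z - w)‖ ≤ 2 * ε * ‖z - w‖ := fun z hz w hw =>
    (hP1 z hz w hw).trans (by nlinarith [norm_nonneg (z - w)])
  have hg2 : ∀ u ∈ P '' A, ∀ v ∈ P '' A, ‖(g u - g v) - (u - v)‖ ≤ 2 * ε * ‖u - v‖ := by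
    rintro _ ⟨z, hz, rfl⟩ _ ⟨w, hw, rfl⟩
    rw [hgP z hz, hgP w hw, norm_sub_rev]
    nlinarith [hP1 z hz w hw, hPlow z hz w hw]
  have h2ε : 0 ≤ 2 * ε := by linarith
  have hK : 1 + 2 * ε ≤ 1 + 2 * b / a * (2 * ε) := by
    have : 1 ≤ 2 * b / a := by rw [le_div_iff₀ ha]; linarith
    nlinarith
  have m1 := hausdorffMeasure_image_le_of_near_id hd.le h2ε hK hP2
  have m2 := hausdorffMeasure_image_le_of_near_id hd.le h2ε hK hg2
  have s1 := hS.image_le ha hb hap hpb hd h2ε hP2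
  have s2 := hS.image_le ha hb hap hpb hd h2ε hg2
  rw [hgA] at m2 s2
  rw [distortion]
  set Λ := ENNReal.ofReal (1 + 2 * b / a * (2 * ε)) ^ d
  constructor
  · calc μH[d] A ≤ Λ * (sliceSup p d (ℝ ∙ ν)ᗮ * S (P '' A)) := hflat ▸ m2
      _ ≤ Λ * (sliceSup p d (ℝ ∙ ν)ᗮ * (Λ * S A)) := by gcongr
      _ = _ := by ring
  · calc sliceSup p d (ℝ ∙ ν)ᗮ * S A ≤ sliceSup p d (ℝ ∙ ν)ᗮ * (Λ * S (P '' A)) := by gcongr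
      _ = Λ * μH[d] (P '' A) := by rw [hflat]; ring
      _ ≤ Λ * (Λ * μH[d] A) := by gcongr
      _ = _ := by ring

theorem sliceSup_le_of_norm_sub_le (hS : IsSphericalMeasure p d S) (ha : 0 < a) (hab : a ≤ b)
    (hap : ∀ z, a * ‖z‖ ≤ p z) (hpb : ∀ z, p z ≤ b * ‖z‖) (hd : 0 < d) {ν ν' : E}
    (hν : ‖ν‖ = 1) (hfin : (Module.finrank ℝ (ℝ ∙ ν)ᗮ : ℝ) = d)
    (hfin' : (Module.finrank ℝ (ℝ ∙ ν')ᗮ : ℝ) = d) {ε : ℝ} (hε2 : ε ≤ 1 / 2)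
    (h : ‖ν - ν'‖ ≤ ε) :
    sliceSup p d (ℝ ∙ ν')ᗮ ≤ distortion a b d ε * sliceSup p d (ℝ ∙ ν)ᗮ := by
  have hb : 0 < b := ha.trans_le hab
  set N := (ℝ ∙ ν')ᗮ with hN
  set B : Set E := (↑) '' closedBall (0 : N) 1 with hB
  have hBN : B ⊆ N := by
    rintro _ ⟨w, -, rfl⟩
    exact w.2
  have hslope : ∀ z ∈ B, ∀ w ∈ B, |⟪z - w, ν⟫| ≤ ε * ‖z - w‖ := by
    intro z hz w hw
    have h0 : ⟪z - w, ν'⟫ = 0 :=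
      Submodule.mem_orthogonal_singleton_iff_inner_left.1 (N.sub_mem (hBN hz) (hBN hw))
    have : ⟪z - w, ν⟫ = ⟪z - w, ν - ν'⟫ := by rw [inner_sub_right, h0, sub_zero]
    rw [this, mul_comm]
    exact (abs_real_inner_le_norm _ _).trans (by gcongr)
  have hμB : μH[d] B = sliceSup p d N * S B := by
    have hd' := hd
    rw [← hfin'] at hS hd' ⊢
    exact hausdorffMeasure_eq_sliceSup_mul _ hS ha hap hb hpb (by exact_mod_cast hd') hBN
  have hμB' : μH[d] B = μH[Module.finrank ℝ N] (closedBall (0 : N) 1) := by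
    have h : Isometry ((↑) : N → E) := isometry_subtype_coe
    rw [h.hausdorffMeasure_image (Or.inl hd.le), hfin']
  have h0 : μH[d] B ≠ 0 := hμB' ▸ (measure_closedBall_pos _ _ one_pos).ne'
  have ht : μH[d] B ≠ ∞ := hμB' ▸ measure_closedBall_lt_top.ne
  have hS0 : S B ≠ 0 := fun h => h0 (by rw [hμB, h, mul_zero])
  have hSt : S B ≠ ∞ := by
    intro h
    rw [hμB, h] at ht
    exact ht (ENNReal.mul_top fun h' => h0 (by rw [hμB, h', zero_mul]))
  have := (area_formula_of_small_slope hS ha hab hap hpb hd hν hfin ((norm_nonneg _).trans h) hε2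
    hslope).1
  rw [hμB, ← mul_assoc] at this
  exact (ENNReal.mul_le_mul_iff_left hS0 hSt).1 this

end Tilt

section LevelSet

variable {E : Type*} [NormedAddCommGroup E] [InnerProductSpace ℝ E] [FiniteDimensional ℝ E]

theorem exists_nhds_small_slope {Ω : Set E} (hΩ : IsOpen Ω) {f : E → ℝ}
    (hf : ContDiffOn ℝ 1 f Ω) (hf' : ∀ x ∈ Ω, fderiv ℝ f x ≠ 0) {x : E} (hx : x ∈ Ω) {ε : ℝ}
    (hε : 0 < ε) :
    ∃ U ∈ 𝓝 x, (∀ z ∈ U, ∀ w ∈ U, f z = f w →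
        |⟪z - w, ‖gradient f x‖⁻¹ • gradient f x⟫| ≤ ε * ‖z - w‖) ∧
      ∀ z ∈ U, ‖‖gradient f z‖⁻¹ • gradient f z - ‖gradient f x‖⁻¹ • gradient f x‖ ≤ ε := by
  have hG : 0 < ‖gradient f x‖ := by
    rw [norm_pos_iff, gradient]
    simpa using hf' x hx
  have hstrict : HasStrictFDerivAt f (fderiv ℝ f x) x :=
    (hf.contDiffAt (hΩ.mem_nhds hx)).hasStrictFDerivAt one_ne_zero
  have h1 := hstrict.isLittleO.def (mul_pos hε hG)
  rw [nhds_prod_eq] at h1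
  obtain ⟨U, hU, hUf⟩ := Filter.mem_prod_self_iff.1 h1
  have hgrad : ContinuousAt (gradient f) x :=
    (InnerProductSpace.toDual ℝ E).symm.continuous.continuousAt.comp
      ((hf.continuousOn_fderiv_of_isOpen hΩ le_rfl).continuousAt (hΩ.mem_nhds hx))
  have hcont : ContinuousAt (fun z => ‖gradient f z‖⁻¹ • gradient f z) x :=
    (hgrad.norm.inv₀ hG.ne').smul hgrad
  have h2 := hcont (Metric.closedBall_mem_nhds _ hε)
  refine ⟨U ∩ _, Filter.inter_mem hU h2, fun z hz w hw hzw => ?_, fun z hz => ?_⟩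
  · have := hUf (mk_mem_prod hz.1 hw.1)
    simp only [mem_ofPred_eq, hzw, sub_self, zero_sub, norm_neg] at this
    have e : fderiv ℝ f x (z - w) = ⟪z - w, gradient f x⟫ := by
      rw [gradient, real_inner_comm, InnerProductSpace.toDual_symm_apply]
    rw [e, Real.norm_eq_abs] at this
    rw [inner_smul_right, abs_mul, abs_of_pos (inv_pos.2 hG), inv_mul_le_iff₀ hG]
    linarith
  · rw [← dist_eq_norm]
    exact hz.2

theorem tendsto_distortion {a b d : ℝ} :
    Filter.Tendsto (fun ε => distortion a b d ε ^ 2) (𝓝[>] 0) (𝓝 1) := by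
  have h1 : Filter.Tendsto (fun ε : ℝ => 1 + 2 * b / a * (2 * ε)) (𝓝 0) (𝓝 1) := by
    have : Continuous fun ε : ℝ => 1 + 2 * b / a * (2 * ε) := by fun_prop
    simpa using this.tendsto 0
  have h2 := ENNReal.Tendsto.pow (n := 2) (ENNReal.Tendsto.pow (n := 2)
    (((ENNReal.continuous_ofReal.tendsto _).comp h1).ennrpow_const d))
  simp only [ENNReal.ofReal_one, ENNReal.one_rpow, one_pow] at h2
  exact h2.mono_left nhdsWithin_le_nhds

theorem le_of_forall_le_distortion_mul {a b d : ℝ} {x y : ℝ≥0∞}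
    (h : ∀ ε, 0 < ε → ε ≤ 1 / 2 → x ≤ distortion a b d ε ^ 2 * y) : x ≤ y := by
  have h1 : Filter.Tendsto (fun ε => distortion a b d ε ^ 2 * y) (𝓝[>] 0) (𝓝 (1 * y)) :=
    ENNReal.Tendsto.mul_const tendsto_distortion (Or.inl one_ne_zero)
  rw [one_mul] at h1
  refine ge_of_tendsto h1 ?_
  filter_upwards [Ioc_mem_nhdsGT (show (0 : ℝ) < 1 / 2 by norm_num)] with ε hε
  exact h ε hε.1 hε.2

theorem finrank_orthogonal_span_singleton_eq_sub_one {n : ℕ} (hn : Module.finrank ℝ E = n)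
    {ν : E} (hν : ν ≠ 0) : (Module.finrank ℝ (ℝ ∙ ν)ᗮ : ℝ) = n - 1 := by
  have h := (ℝ ∙ ν).finrank_add_finrank_orthogonal
  rw [finrank_span_singleton hν, hn] at h
  rw [← h]
  push_cast
  ring

variable [MeasurableSpace E] [BorelSpace E]

/-- The area formula on a regular level set, for a seminorm comparable to the ambient norm. -/
theorem hausdorffMeasure_eq_lintegral_sliceSup {p : Seminorm ℝ E} {a b : ℝ} {S : Measure E}
    {n : ℕ} (hn : Module.finrank ℝ E = n) (hn2 : 2 ≤ n)
    (hS : IsSphericalMeasure p ((n : ℝ) - 1) S) (ha : 0 < a) (hab : a ≤ b)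
    (hap : ∀ z, a * ‖z‖ ≤ p z) (hpb : ∀ z, p z ≤ b * ‖z‖)
    {Ω : Set E} (hΩ : IsOpen Ω) {f : E → ℝ} (hf : ContDiffOn ℝ 1 f Ω)
    (hf' : ∀ x ∈ Ω, fderiv ℝ f x ≠ 0) {A : Set E} (hA : MeasurableSet A)
    (hAf : A ⊆ {x ∈ Ω | f x = 0}) :
    μH[(n : ℝ) - 1] A = ∫⁻ x in A,
      sliceSup p ((n : ℝ) - 1) (ℝ ∙ (‖gradient f x‖⁻¹ • gradient f x))ᗮ ∂S := by
  have hd : (0 : ℝ) < (n : ℝ) - 1 := by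
    have : (2 : ℝ) ≤ n := by exact_mod_cast hn2
    linarith
  set d := (n : ℝ) - 1 with hd_def
  set ν : E → E := fun x => ‖gradient f x‖⁻¹ • gradient f x with hν_def
  have hν : ∀ x ∈ Ω, ‖ν x‖ = 1 := by
    intro x hx
    have : gradient f x ≠ 0 := by
      rw [gradient]
      simpa using hf' x hx
    exact norm_smul_inv_norm this
  have hfin : ∀ x ∈ Ω, (Module.finrank ℝ (ℝ ∙ ν x)ᗮ : ℝ) = d := fun x hx =>
    finrank_orthogonal_span_singleton_eq_sub_one hn
      (norm_ne_zero_iff.1 (by rw [hν x hx]; exact one_ne_zero))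
  set β : E → ℝ≥0∞ := fun x => sliceSup p d (ℝ ∙ ν x)ᗮ with hβ
  have key : ∀ ε, 0 < ε → ε ≤ 1 / 2 → ∀ x ∈ A, ∃ U ∈ 𝓝 x, ∀ B ⊆ A ∩ U, MeasurableSet B →
      μH[d] B ≤ distortion a b d ε ^ 2 * ∫⁻ x in B, β x ∂S ∧
      ∫⁻ x in B, β x ∂S ≤ distortion a b d ε ^ 2 * μH[d] B := by
    intro ε hε hε2 x hx
    have hxΩ := (hAf hx).1
    obtain ⟨U, hU, hslope, hnear⟩ := exists_nhds_small_slope hΩ hf hf' hxΩ hε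
    refine ⟨U, hU, fun B hB hBm => ?_⟩
    obtain ⟨h1, h2⟩ := area_formula_of_small_slope hS ha hab hap hpb hd (hν x hxΩ) (hfin x hxΩ)
      hε.le hε2 (A := B) fun z hz w hw => hslope z (hB hz).2 w (hB hw).2
        ((hAf (hB hz).1).2.trans (hAf (hB hw).1).2.symm)
    have hβ1 : ∀ z ∈ B, β z ≤ distortion a b d ε * β x := fun z hz =>
      sliceSup_le_of_norm_sub_le hS ha hab hap hpb hd (hν x hxΩ) (hfin x hxΩ)
        (hfin z (hAf (hB hz).1).1) hε2 (by rw [norm_sub_rev]; exact hnear z (hB hz).2)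
    have hβ2 : ∀ z ∈ B, β x ≤ distortion a b d ε * β z := fun z hz =>
      sliceSup_le_of_norm_sub_le hS ha hab hap hpb hd (hν z (hAf (hB hz).1).1)
        (hfin z (hAf (hB hz).1).1) (hfin x hxΩ) hε2 (hnear z (hB hz).2)
    have hΛ : distortion a b d ε ≠ ∞ := by
      rw [distortion]
      exact ENNReal.pow_ne_top (ENNReal.rpow_ne_top_of_nonneg hd.le ENNReal.ofReal_ne_top)
    constructor
    · calc μH[d] B ≤ distortion a b d ε * (β x * S B) := h1
        _ = distortion a b d ε * ∫⁻ _ in B, β x ∂S := by rw [setLIntegral_const]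
        _ ≤ distortion a b d ε * ∫⁻ z in B, distortion a b d ε * β z ∂S := by
          gcongr 1
          exact setLIntegral_mono' hBm hβ2
        _ = _ := by rw [lintegral_const_mul' _ _ hΛ]; ring
    · calc ∫⁻ z in B, β z ∂S ≤ ∫⁻ _ in B, distortion a b d ε * β x ∂S :=
          setLIntegral_mono' hBm hβ1
        _ = distortion a b d ε * (β x * S B) := by rw [setLIntegral_const, mul_assoc]
        _ ≤ distortion a b d ε * (distortion a b d ε * μH[d] B) := by gcongr
        _ = _ := by ring
  apply le_antisymm
  · refine le_of_forall_le_distortion_mul (a := a) (b := b) (d := d) fun ε hε hε2 => ?_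
    have := measure_le_of_locally_le (μ₁ := μH[d])
      (μ₂ := distortion a b d ε ^ 2 • S.withDensity β) hA fun x hx => ?_
    · simpa [withDensity_apply _ hA] using this
    · obtain ⟨U, hU, h⟩ := key ε hε hε2 x hx
      refine ⟨U, hU, fun B hB hBm => ?_⟩
      simpa [withDensity_apply _ hBm] using (h B hB hBm).1
  · refine le_of_forall_le_distortion_mul (a := a) (b := b) (d := d) fun ε hε hε2 => ?_
    have := measure_le_of_locally_le (μ₁ := S.withDensity β)
      (μ₂ := distortion a b d ε ^ 2 • μH[d]) hA fun x hx => ?_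
    · simpa [withDensity_apply _ hA] using this
    · obtain ⟨U, hU, h⟩ := key ε hε hε2 x hx
      refine ⟨U, hU, fun B hB hBm => ?_⟩
      simpa [withDensity_apply _ hBm] using (h B hB hBm).2

/-- A seminorm with trivial kernel on a finite-dimensional space is comparable to the norm. -/
theorem exists_norm_equiv_bounds {F : Type*} [NormedAddCommGroup F] [NormedSpace ℝ F]
    [FiniteDimensional ℝ F] (p : Seminorm ℝ F) (hp : ∀ z, p z = 0 → z = 0) :
    ∃ a b : ℝ, 0 < a ∧ a ≤ b ∧ (∀ z, a * ‖z‖ ≤ p z) ∧ ∀ z, p z ≤ b * ‖z‖ := by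
  have hc : Continuous p := by
    rw [← continuousOn_univ]
    exact p.convexOn.continuousOn isOpen_univ
  obtain ⟨b, hb0, hb⟩ := p.bound_of_continuous_normedSpace hc
  rcases subsingleton_or_nontrivial F with h | h
  · exact ⟨1, 1, one_pos, le_rfl, fun z => by simp [Subsingleton.elim z 0],
      fun z => by simp [Subsingleton.elim z 0]⟩
  obtain ⟨x, hx, hmin⟩ := (isCompact_sphere (0 : F) 1).exists_isMinOn
    (NormedSpace.sphere_nonempty.2 zero_le_one) hc.continuousOn
  have hx1 : ‖x‖ = 1 := by simpa using hx
  have hpx : 0 < p x := (apply_nonneg p x).lt_of_ne' fun h0 => by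
    simp [hp x h0] at hx1
  refine ⟨p x, b, hpx, by simpa [hx1] using hb x, fun z => ?_, hb⟩
  rcases eq_or_ne z 0 with rfl | hz
  · simp
  have hz' : 0 < ‖z‖ := norm_pos_iff.2 hz
  have := hmin (show ‖z‖⁻¹ • z ∈ sphere (0 : F) 1 by simp [norm_smul, hz'.ne'])
  simp only [mem_ofPred_eq, map_smul_eq_mul, norm_inv, norm_norm] at this
  rwa [le_inv_mul_iff₀ hz', mul_comm] at this

end LevelSet

/-- **Area formula for the perimeter measure** (abelian instance): let `E` be an
`n`-dimensional real inner product space (`n ≥ 2`), let `Nm` be an arbitrary norm on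
`E` with unit ball `C = {z | Nm z ≤ 1}`, and let `Σ = {p ∈ Ω | f p = 0}` be the zero
level set of a `C¹` function `f` on an open set `Ω` with nonvanishing differential.
Let `S` be the spherical Hausdorff measure of dimension `n-1` with respect to `Nm`
with constant `2^{-(n-1)}`, i.e. the measure whose value on every set `A` is
`sup_{δ>0} inf { Σ_j t_j^{n-1} : A ⊆ ⋃_j B̄(y_j, t_j), 0 ≤ t_j, 2 t_j ≤ δ }`
(a covering by closed `Nm`-balls of diameter `2 t_j ≤ δ`, each contributing
`(diam/2)^{n-1} = t_j^{n-1}`). Then for every Borel set `A ⊆ Σ`,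
`H^{n-1}(A) = ∫_A β(Nm, ν(x)) dS(x)`, where
`β(Nm, ν) = sup_{z ∈ C} H^{n-1}((z + C) ∩ N(ν))` and `ν(x) = ∇f(x)/|∇f(x)|`. -/
theorem area_formula_for_perimeter
    {E : Type*} [NormedAddCommGroup E] [InnerProductSpace ℝ E]
    [FiniteDimensional ℝ E] [MeasurableSpace E] [BorelSpace E]
    (n : ℕ) (hn : Module.finrank ℝ E = n) (hn2 : 2 ≤ n)
    (Nm : E → ℝ)
    (hNm0 : ∀ z : E, Nm z = 0 ↔ z = 0)
    (hNmsmul : ∀ (a : ℝ) (z : E), Nm (a • z) = |a| * Nm z)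
    (hNmadd : ∀ z w : E, Nm (z + w) ≤ Nm z + Nm w)
    (Ω : Set E) (hΩ : IsOpen Ω)
    (f : E → ℝ) (hf : ContDiffOn ℝ 1 f Ω)
    (hf' : ∀ p ∈ Ω, fderiv ℝ f p ≠ 0)
    (S : Measure E)
    (hS : ∀ A : Set E, S A =
      ⨆ (δ : ℝ) (_ : 0 < δ),
        ⨅ (y : ℕ → E) (t : ℕ → ℝ)
          (_ : (∀ j, 0 ≤ t j) ∧ (∀ j, 2 * t j ≤ δ) ∧
            A ⊆ ⋃ j, {z : E | Nm (z - y j) ≤ t j}),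
          ∑' j, ENNReal.ofReal (t j) ^ ((n : ℝ) - 1)) :
    ∀ A : Set E, MeasurableSet A → A ⊆ {p ∈ Ω | f p = 0} →
      μH[(n : ℝ) - 1] A =
        ∫⁻ x in A,
          (⨆ (z : E) (_ : Nm z ≤ 1),
            μH[(n : ℝ) - 1] ({w : E | Nm (w - z) ≤ 1} ∩
              {w : E | ⟪w, ‖gradient f x‖⁻¹ • gradient f x⟫ = 0})) ∂S := by
  intro A hA hAf
  let p : Seminorm ℝ E := Seminorm.of Nm hNmadd hNmsmul
  obtain ⟨a, b, ha, hab, hap, hpb⟩ := exists_norm_equiv_bounds p fun z => (hNm0 z).1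
  rw [hausdorffMeasure_eq_lintegral_sliceSup (p := p) hn hn2 hS ha hab hap hpb hΩ hf hf' hA hAf]
  have hN : ∀ v : E, (((ℝ ∙ v)ᗮ : Submodule ℝ E) : Set E) = {w : E | ⟪w, v⟫ = 0} := fun v =>
    Set.ext fun w => Submodule.mem_orthogonal_singleton_iff_inner_left
  simp only [sliceSup, hN]
  rfl
end

section
/- Let H be a real inner product space of finite dimension n ≥ 2 and let C ⊆ H be a compact convex set with nonempty interior that contains the origin. Let v ∈ H \ {0} and let N denote the orthogonal complement of v. Then the function ψ(t) = [H^{n−1}(C ∩ (t·v + N))]^{1/(n−1)} is concave on the interval I = {t ∈ ℝ : C ∩ (t·v + N) ≠ ∅}, where H^{n−1} is the (n−1)-dimensional Hausdorff measure induced by the inner-product distance. -/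
open MeasureTheory Metric Set
open scoped Pointwise RealInnerProductSpace ENNReal Topology

/-- The one-dimensional Brunn–Minkowski inequality for compact sets. -/
theorem IsCompact.volume_add_le_of_add_subset {S T K : Set ℝ} (hS : IsCompact S)
    (hT : IsCompact T) (hS0 : S.Nonempty) (hT0 : T.Nonempty) (hK : S + T ⊆ K) :
    volume S + volume T ≤ volume K := by
  obtain ⟨s, hs, hsmax⟩ := hS.exists_isGreatest hS0
  obtain ⟨t, ht, htmin⟩ := hT.exists_isLeast hT0
  have hdisj : AEDisjoint volume ((t + ·) '' S) ((s + ·) '' T) := by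
    refine measure_mono_null (t := {s + t}) ?_ (by simp)
    rintro _ ⟨⟨x, hx, rfl⟩, ⟨y, hy, hxy⟩⟩
    have h₁ := hsmax hx
    have h₂ := htmin hy
    simp only [mem_singleton_iff] at hxy ⊢
    linarith
  have hmeas : NullMeasurableSet ((s + ·) '' T) volume :=
    (hT.image (continuous_const_add s)).measurableSet.nullMeasurableSet
  calc volume S + volume T
      = volume ((t + ·) '' S) + volume ((s + ·) '' T) := by
        simp only [image_add_left, measure_preimage_add]
    _ = volume ((t + ·) '' S ∪ (s + ·) '' T) := (measure_union₀ hmeas hdisj).symm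
    _ ≤ volume K := by
        refine measure_mono (union_subset ?_ ?_)
        · rintro _ ⟨x, hx, rfl⟩
          exact hK ⟨x, hx, t, ht, add_comm _ _⟩
        · rintro _ ⟨y, hy, rfl⟩
          exact hK ⟨s, hs, y, hy, rfl⟩

theorem MeasurableSet.volume_eq_iSup_nonempty_isCompact {S : Set ℝ} (hS : MeasurableSet S)
    (hS0 : S.Nonempty) :
    volume S = ⨆ A ∈ {A : Set ℝ | A ⊆ S ∧ IsCompact A ∧ A.Nonempty}, volume A := by
  obtain ⟨s, hs⟩ := hS0
  apply le_antisymm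
  · rw [hS.measure_eq_iSup_isCompact]
    refine iSup₂_le fun A hA ↦ iSup_le fun hAc ↦ ?_
    refine (measure_mono (subset_insert s A)).trans ?_
    exact le_iSup₂_of_le (insert s A)
      ⟨insert_subset hs hA, hAc.insert s, insert_nonempty _ _⟩ le_rfl
  · exact iSup₂_le fun A hA ↦ measure_mono hA.1

/-- The one-dimensional Brunn–Minkowski inequality for measurable sets. -/
theorem MeasurableSet.volume_add_le_of_add_subset {S T K : Set ℝ} (hS : MeasurableSet S)
    (hT : MeasurableSet T) (hS0 : S.Nonempty) (hT0 : T.Nonempty) (hK : S + T ⊆ K) :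
    volume S + volume T ≤ volume K := by
  rw [hS.volume_eq_iSup_nonempty_isCompact hS0, hT.volume_eq_iSup_nonempty_isCompact hT0]
  obtain ⟨s, hs⟩ := hS0
  obtain ⟨t, ht⟩ := hT0
  refine ENNReal.biSup_add_biSup_le
    (s := {A : Set ℝ | A ⊆ S ∧ IsCompact A ∧ A.Nonempty})
    (t := {A : Set ℝ | A ⊆ T ∧ IsCompact A ∧ A.Nonempty})
    ⟨{s}, singleton_subset_iff.2 hs, isCompact_singleton, singleton_nonempty s⟩
    ⟨{t}, singleton_subset_iff.2 ht, isCompact_singleton, singleton_nonempty t⟩ ?_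
  rintro A ⟨hA, hAc, hA0⟩ B ⟨hB, hBc, hB0⟩
  exact hAc.volume_add_le_of_add_subset hBc hA0 hB0 ((add_subset_add hA hB).trans hK)

/-- The sum form of the one-dimensional Prékopa–Leindler inequality, for functions whose
supremum is `1`. -/
theorem lintegral_add_le_of_rpow_mul_rpow_le {f g h : ℝ → ℝ} {a b : ℝ} (ha : 0 < a) (hb : 0 < b)
    (hab : a + b = 1) (hf : Measurable f) (hg : Measurable g) (hh : Measurable h)
    (hf0 : 0 ≤ f) (hg0 : 0 ≤ g) (hh0 : 0 ≤ h) (hf1 : IsLUB (range f) 1) (hg1 : IsLUB (range g) 1)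
    (hfg : ∀ s t, f s ^ a * g t ^ b ≤ h (a * s + b * t)) :
    ENNReal.ofReal a * (∫⁻ x, ENNReal.ofReal (f x)) +
        ENNReal.ofReal b * (∫⁻ x, ENNReal.ofReal (g x)) ≤ ∫⁻ x, ENNReal.ofReal (h x) := by
  have key : ∀ t ∈ Ioi (0 : ℝ), ENNReal.ofReal a * volume {x | t < f x} +
      ENNReal.ofReal b * volume {x | t < g x} ≤ volume {x | t < h x} := by
    intro t ht
    rcases lt_or_ge t 1 with ht1 | ht1
    · have hS : MeasurableSet {x | t < f x} := measurableSet_lt measurable_const hf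
      have hT : MeasurableSet {x | t < g x} := measurableSet_lt measurable_const hg
      obtain ⟨_, ⟨x, rfl⟩, hx⟩ := (lt_isLUB_iff hf1).1 ht1
      obtain ⟨_, ⟨y, rfl⟩, hy⟩ := (lt_isLUB_iff hg1).1 ht1
      have := (hS.const_smul₀ a).volume_add_le_of_add_subset (hT.const_smul₀ b)
        (K := {x | t < h x}) ⟨a • x, smul_mem_smul_set hx⟩ ⟨b • y, smul_mem_smul_set hy⟩ ?_
      · simpa [Measure.addHaar_smul, abs_of_pos ha, abs_of_pos hb] using this
      · rintro _ ⟨_, ⟨x, hx, rfl⟩, _, ⟨y, hy, rfl⟩, rfl⟩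
        refine lt_of_lt_of_le ?_ (hfg x y)
        calc t = t ^ a * t ^ b := by rw [← Real.rpow_add ht, hab, Real.rpow_one]
          _ < f x ^ a * g y ^ b :=
            mul_lt_mul'' (Real.rpow_lt_rpow (le_of_lt ht) hx ha)
              (Real.rpow_lt_rpow (le_of_lt ht) hy hb)
              (Real.rpow_nonneg (le_of_lt ht) _) (Real.rpow_nonneg (le_of_lt ht) _)
    · have h₁ : {x | t < f x} = ∅ :=
        eq_empty_of_forall_notMem fun x hx ↦ (hx.trans_le (hf1.1 ⟨x, rfl⟩)).not_ge ht1
      have h₂ : {x | t < g x} = ∅ :=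
        eq_empty_of_forall_notMem fun x hx ↦ (hx.trans_le (hg1.1 ⟨x, rfl⟩)).not_ge ht1
      simp [h₁, h₂]
  have hmeas (u : ℝ → ℝ) : Measurable fun t ↦ volume {x | t < u x} :=
    Antitone.measurable fun s t hst ↦ measure_mono fun x (hx : t < u x) ↦ hst.trans_lt hx
  rw [lintegral_eq_lintegral_meas_lt volume (ae_of_all _ hf0) hf.aemeasurable,
    lintegral_eq_lintegral_meas_lt volume (ae_of_all _ hg0) hg.aemeasurable,
    lintegral_eq_lintegral_meas_lt volume (ae_of_all _ hh0) hh.aemeasurable,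
    ← lintegral_const_mul _ (hmeas f), ← lintegral_const_mul _ (hmeas g),
    ← lintegral_add_left ((hmeas f).const_mul _)]
  exact setLIntegral_mono (hmeas h) key

/-- The one-dimensional Prékopa–Leindler inequality for bounded functions. -/
theorem integral_rpow_mul_integral_rpow_le {f g h : ℝ → ℝ} {a b : ℝ} (ha : 0 < a) (hb : 0 < b)
    (hab : a + b = 1) (hf : Measurable f) (hg : Measurable g) (hh : Measurable h)
    (hfi : Integrable f) (hgi : Integrable g) (hhi : Integrable h)
    (hf0 : 0 ≤ f) (hg0 : 0 ≤ g) (hh0 : 0 ≤ h) (hfb : BddAbove (range f)) (hgb : BddAbove (range g))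
    (hfg : ∀ s t, f s ^ a * g t ^ b ≤ h (a * s + b * t)) :
    (∫ x, f x) ^ a * (∫ x, g x) ^ b ≤ ∫ x, h x := by
  have lub_div {u : ℝ → ℝ} {c : ℝ} (hc : 0 < c) (hu : IsLUB (range u) c) :
      IsLUB (range fun x ↦ u x / c) 1 := by
    refine ⟨?_, fun d hd ↦ ?_⟩
    · rintro _ ⟨x, rfl⟩
      exact (div_le_one hc).2 (hu.1 ⟨x, rfl⟩)
    · have : c ≤ d * c := hu.2 <| by
        rintro _ ⟨x, rfl⟩
        exact (div_le_iff₀ hc).1 (hd ⟨x, rfl⟩)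
      exact le_of_mul_le_mul_right (by simpa using this) hc
  have hfM := isLUB_ciSup hfb
  have hgM := isLUB_ciSup hgb
  set M := ⨆ x, f x
  set N := ⨆ x, g x
  have hM0 : 0 ≤ M := (hf0 0).trans (hfM.1 ⟨0, rfl⟩)
  have hN0 : 0 ≤ N := (hg0 0).trans (hgM.1 ⟨0, rfl⟩)
  have hhint : 0 ≤ ∫ x, h x := integral_nonneg hh0
  rcases hM0.eq_or_lt with hM | hM
  · have : f = 0 := funext fun x ↦ le_antisymm ((hfM.1 ⟨x, rfl⟩).trans_eq hM.symm) (hf0 x)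
    simpa [this, Real.zero_rpow ha.ne'] using hhint
  rcases hN0.eq_or_lt with hN | hN
  · have : g = 0 := funext fun x ↦ le_antisymm ((hgM.1 ⟨x, rfl⟩).trans_eq hN.symm) (hg0 x)
    simpa [this, Real.zero_rpow hb.ne'] using hhint
  have hMa := Real.rpow_pos_of_pos hM a
  have hNb := Real.rpow_pos_of_pos hN b
  have hsum := lintegral_add_le_of_rpow_mul_rpow_le ha hb hab (hf.div_const M) (hg.div_const N)
    (hh.div_const (M ^ a * N ^ b)) (fun x ↦ div_nonneg (hf0 x) hM0)
    (fun x ↦ div_nonneg (hg0 x) hN0) (fun x ↦ div_nonneg (hh0 x) (by positivity))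
    (lub_div hM hfM) (lub_div hN hgM) fun s t ↦ by
      rw [Real.div_rpow (hf0 s) hM0, Real.div_rpow (hg0 t) hN0, div_mul_div_comm]
      exact div_le_div_of_nonneg_right (hfg s t) (by positivity)
  have ofReal_int {u : ℝ → ℝ} {c : ℝ} (hc : 0 ≤ c) (hu : 0 ≤ u) (hui : Integrable u) :
      ∫⁻ x, ENNReal.ofReal (u x / c) = ENNReal.ofReal ((∫ x, u x) / c) := by
    rw [← integral_div, ofReal_integral_eq_lintegral_ofReal (hui.div_const c)
      (ae_of_all _ fun x ↦ div_nonneg (hu x) hc)]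
  have hfint : 0 ≤ ∫ x, f x := integral_nonneg hf0
  have hgint : 0 ≤ ∫ x, g x := integral_nonneg hg0
  rw [ofReal_int hM0 hf0 hfi, ofReal_int hN0 hg0 hgi, ofReal_int (by positivity) hh0 hhi,
    ← ENNReal.ofReal_mul ha.le, ← ENNReal.ofReal_mul hb.le,
    ← ENNReal.ofReal_add (by positivity) (by positivity),
    ENNReal.ofReal_le_ofReal_iff (by positivity)] at hsum
  have := (Real.geom_mean_le_arith_mean2_weighted ha.le hb.le (div_nonneg hfint hM0)
    (div_nonneg hgint hN0) hab).trans hsum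
  rw [Real.div_rpow hfint hM0, Real.div_rpow hgint hN0, div_mul_div_comm] at this
  exact (div_le_div_iff_of_pos_right (by positivity)).1 this

/-- The multiplicative form of the Brunn–Minkowski inequality for compact sets and the
measure `μ`. -/
def MulBrunnMinkowski {E : Type*} [AddCommGroup E] [Module ℝ E] [TopologicalSpace E]
    [MeasurableSpace E] (μ : Measure E) : Prop :=
  ∀ ⦃a b : ℝ⦄, 0 < a → 0 < b → a + b = 1 → ∀ ⦃A B K : Set E⦄, IsCompact A → IsCompact B →
    IsCompact K → a • A + b • B ⊆ K → μ.real A ^ a * μ.real B ^ b ≤ μ.real K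

section

variable {E : Type*} [NormedAddCommGroup E] [NormedSpace ℝ E] [MeasurableSpace E] [BorelSpace E]

theorem MulBrunnMinkowski.of_equiv {F : Type*} [NormedAddCommGroup F] [NormedSpace ℝ F]
    [FiniteDimensional ℝ F] [MeasurableSpace F] [BorelSpace F]
    {μ : Measure E} [μ.IsAddHaarMeasure] {ν : Measure F} [ν.IsAddHaarMeasure] (h : MulBrunnMinkowski ν)
    (e : E ≃L[ℝ] F) : MulBrunnMinkowski μ := by
  intro a b ha hb hab A B K hA hB hK hABK
  have hμ := Measure.isAddLeftInvariant_eq_smul (μ.map e) ν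
  set c := Measure.addHaarScalarFactor (μ.map e) ν
  have hreal {S : Set E} : μ.real S = c * ν.real (e '' S) := by
    have : (μ.map e).real (e '' S) = μ.real S := by
      have hmap := e.toHomeomorph.measurableEmbedding.map_apply μ (e '' S)
      rw [e.coe_toHomeomorph, preimage_image_eq S e.injective] at hmap
      rw [measureReal_def, hmap, measureReal_def]
    rw [← this, hμ]
    simp [measureReal_def]
  have hν := h ha hb hab (hA.image e.continuous) (hB.image e.continuous) (hK.image e.continuous)
    (by
      rw [← image_smul_set, ← image_smul_set, ← image_add]
      exact image_mono hABK)
  rw [hreal, hreal, hreal, Real.mul_rpow c.coe_nonneg measureReal_nonneg,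
    Real.mul_rpow c.coe_nonneg measureReal_nonneg]
  calc (c : ℝ) ^ a * ν.real (e '' A) ^ a * ((c : ℝ) ^ b * ν.real (e '' B) ^ b)
      = (c : ℝ) ^ a * (c : ℝ) ^ b * (ν.real (e '' A) ^ a * ν.real (e '' B) ^ b) := by ring
    _ = c * (ν.real (e '' A) ^ a * ν.real (e '' B) ^ b) := by
      rw [← Real.rpow_add' c.coe_nonneg (by simp [hab]), hab, Real.rpow_one]
    _ ≤ c * ν.real (e '' K) := by gcongr

variable [FiniteDimensional ℝ E]

theorem MulBrunnMinkowski.prod {μ : Measure E} [μ.IsAddHaarMeasure] (h : MulBrunnMinkowski μ) :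
    MulBrunnMinkowski ((volume : Measure ℝ).prod μ) := by
  intro a b ha hb hab A B K hA hB hK hABK
  have hfib {S : Set (ℝ × E)} (hS : IsCompact S) (t : ℝ) : IsCompact (Prod.mk t ⁻¹' S) := by
    refine (hS.image continuous_snd).of_isClosed_subset
      (hS.isClosed.preimage (Continuous.prodMk_right t)) fun y hy ↦ ⟨(t, y), hy, rfl⟩
  have hmeas {S : Set (ℝ × E)} (hS : IsCompact S) :
      Measurable fun t ↦ μ.real (Prod.mk t ⁻¹' S) :=
    (measurable_measure_prodMk_left hS.measurableSet).ennreal_toReal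
  have hint {S : Set (ℝ × E)} (hS : IsCompact S) :
      Integrable fun t ↦ μ.real (Prod.mk t ⁻¹' S) :=
    Measure.integrable_measure_prodMk_left hS.measurableSet hS.measure_ne_top
  have hbdd {S : Set (ℝ × E)} (hS : IsCompact S) :
      BddAbove (range fun t ↦ μ.real (Prod.mk t ⁻¹' S)) := by
    refine ⟨μ.real (Prod.snd '' S), ?_⟩
    rintro _ ⟨t, rfl⟩
    exact measureReal_mono (fun y hy ↦ ⟨(t, y), hy, rfl⟩) (hS.image continuous_snd).measure_ne_top
  have heq {S : Set (ℝ × E)} (hS : IsCompact S) :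
      ((volume : Measure ℝ).prod μ).real S = ∫ t, μ.real (Prod.mk t ⁻¹' S) := by
    simp only [measureReal_def]
    rw [integral_toReal (measurable_measure_prodMk_left hS.measurableSet).aemeasurable
      (ae_of_all _ fun t ↦ (hfib hS t).measure_lt_top), Measure.prod_apply hS.measurableSet]
  rw [heq hA, heq hB, heq hK]
  refine integral_rpow_mul_integral_rpow_le ha hb hab (hmeas hA) (hmeas hB) (hmeas hK) (hint hA)
    (hint hB) (hint hK) (fun _ ↦ measureReal_nonneg) (fun _ ↦ measureReal_nonneg)
    (fun _ ↦ measureReal_nonneg) (hbdd hA) (hbdd hB) fun s t ↦ ?_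
  refine h ha hb hab (hfib hA s) (hfib hB t) (hfib hK _) ?_
  rintro _ ⟨_, ⟨x, hx, rfl⟩, _, ⟨y, hy, rfl⟩, rfl⟩
  exact hABK ⟨_, ⟨(s, x), hx, rfl⟩, _, ⟨(t, y), hy, rfl⟩, rfl⟩

theorem mulBrunnMinkowski_volume_pi (m : ℕ) :
    MulBrunnMinkowski (volume : Measure (Fin m → ℝ)) := by
  induction m with
  | zero =>
    intro a b ha hb hab A B K hA hB hK hABK
    rcases A.eq_empty_or_nonempty with rfl | ⟨x, hx⟩
    · simp [Real.zero_rpow ha.ne']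
    rcases B.eq_empty_or_nonempty with rfl | ⟨y, hy⟩
    · simp [Real.zero_rpow hb.ne']
    have hA' := Subsingleton.eq_univ_of_nonempty ⟨x, hx⟩
    have hB' := Subsingleton.eq_univ_of_nonempty ⟨y, hy⟩
    have hK' := Subsingleton.eq_univ_of_nonempty
      ⟨_, hABK ⟨_, ⟨x, hx, rfl⟩, _, ⟨y, hy, rfl⟩, rfl⟩⟩
    rw [hA', hB', hK']
    simp [measureReal_def, volume_pi]
  | succ m ih =>
    exact ih.prod.of_equiv (ContinuousLinearEquiv.ofFinrankEq (by simp [add_comm]))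

theorem mulBrunnMinkowski (μ : Measure E) [μ.IsAddHaarMeasure] : MulBrunnMinkowski μ :=
  (mulBrunnMinkowski_volume_pi (Module.finrank ℝ E)).of_equiv
    (ContinuousLinearEquiv.ofFinrankEq (by simp))

theorem measureReal_smul_rpow_inv_finrank (μ : Measure E) [μ.IsAddHaarMeasure]
    (hE : Module.finrank ℝ E ≠ 0) {r : ℝ} (hr : 0 ≤ r) (S : Set E) :
    μ.real (r • S) ^ (Module.finrank ℝ E : ℝ)⁻¹ =
      r * μ.real S ^ (Module.finrank ℝ E : ℝ)⁻¹ := by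
  rw [measureReal_def, Measure.addHaar_smul, ENNReal.toReal_mul,
    ENNReal.toReal_ofReal (abs_nonneg _), abs_of_nonneg (by positivity),
    Real.mul_rpow (by positivity) (by positivity), Real.pow_rpow_inv_natCast hr hE,
    measureReal_def]

/-- The **Brunn–Minkowski inequality** for compact sets. -/
theorem IsCompact.rpow_measureReal_add_le (μ : Measure E) [μ.IsAddHaarMeasure]
    (hE : Module.finrank ℝ E ≠ 0) {A B K : Set E} (hA : IsCompact A) (hB : IsCompact B)
    (hK : IsCompact K) (hA0 : A.Nonempty) (hB0 : B.Nonempty) (hABK : A + B ⊆ K) :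
    μ.real A ^ (Module.finrank ℝ E : ℝ)⁻¹ + μ.real B ^ (Module.finrank ℝ E : ℝ)⁻¹ ≤
      μ.real K ^ (Module.finrank ℝ E : ℝ)⁻¹ := by
  have hE' : (Module.finrank ℝ E : ℝ)⁻¹ ≠ 0 := by simpa using hE
  obtain ⟨x, hx⟩ := hA0
  obtain ⟨y, hy⟩ := hB0
  rcases (measureReal_nonneg : 0 ≤ μ.real A).eq_or_lt with hA1 | hA1
  · rw [← hA1, Real.zero_rpow hE', zero_add]
    refine Real.rpow_le_rpow measureReal_nonneg ?_ (by positivity)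
    rw [measureReal_def, ← measure_vadd μ x B]
    refine measureReal_mono ?_ hK.measure_ne_top
    rintro _ ⟨z, hz, rfl⟩
    exact hABK ⟨x, hx, z, hz, rfl⟩
  rcases (measureReal_nonneg : 0 ≤ μ.real B).eq_or_lt with hB1 | hB1
  · rw [← hB1, Real.zero_rpow hE', add_zero]
    refine Real.rpow_le_rpow measureReal_nonneg ?_ (by positivity)
    rw [measureReal_def, ← measure_vadd μ y A]
    refine measureReal_mono ?_ hK.measure_ne_top
    rintro _ ⟨z, hz, rfl⟩
    exact hABK ⟨z, hz, y, hy, add_comm _ _⟩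
  have hα := Real.rpow_pos_of_pos hA1 (Module.finrank ℝ E : ℝ)⁻¹
  have hβ := Real.rpow_pos_of_pos hB1 (Module.finrank ℝ E : ℝ)⁻¹
  have hA2 := measureReal_smul_rpow_inv_finrank μ hE (inv_nonneg.2 hα.le) A
  have hB2 := measureReal_smul_rpow_inv_finrank μ hE (inv_nonneg.2 hβ.le) B
  set α := μ.real A ^ (Module.finrank ℝ E : ℝ)⁻¹
  set β := μ.real B ^ (Module.finrank ℝ E : ℝ)⁻¹
  have hs : 0 < α + β := add_pos hα hβ
  have hK2 := measureReal_smul_rpow_inv_finrank μ hE (inv_nonneg.2 hs.le) K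
  rw [inv_mul_cancel₀ hα.ne', Real.rpow_inv_eq measureReal_nonneg zero_le_one (by simpa using hE),
    Real.one_rpow] at hA2
  rw [inv_mul_cancel₀ hβ.ne', Real.rpow_inv_eq measureReal_nonneg zero_le_one (by simpa using hE),
    Real.one_rpow] at hB2
  have key := mulBrunnMinkowski μ (div_pos hα hs) (div_pos hβ hs) (by field_simp)
    (hA.smul α⁻¹) (hB.smul β⁻¹) (hK.smul (α + β)⁻¹) (by
      rw [smul_smul, smul_smul, div_mul_eq_mul_div, div_mul_eq_mul_div, mul_inv_cancel₀ hα.ne',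
        mul_inv_cancel₀ hβ.ne', one_div, ← smul_add]
      exact smul_set_mono hABK)
  rw [hA2, hB2, Real.one_rpow, Real.one_rpow, one_mul] at key
  have := Real.one_le_rpow key (inv_nonneg.2 (Nat.cast_nonneg (Module.finrank ℝ E)))
  rwa [hK2, inv_mul_eq_div, one_le_div hs] at this

end

/-- **Busemann's theorem** (concavity of the `(n-1)`-th root of the parallel-section
function of a convex body): if `C` is a compact convex set with nonempty interior
containing the origin in an `n`-dimensional real inner product space (`n ≥ 2`),
`v ≠ 0` and `N = {w | ⟪w, v⟫ = 0}` is the hyperplane orthogonal to `v`, then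
`ψ(t) = (H^{n-1}(C ∩ (t • v +ᵥ N)))^{1/(n-1)}` is concave on
`I = {t | C ∩ (t • v +ᵥ N) ≠ ∅}`. -/
theorem busemann_concave_section_function
    {H : Type*} [NormedAddCommGroup H] [InnerProductSpace ℝ H]
    [FiniteDimensional ℝ H] [MeasurableSpace H] [BorelSpace H]
    (n : ℕ) (hn : Module.finrank ℝ H = n) (hn2 : 2 ≤ n)
    (C : Set H) (hCcomp : IsCompact C) (hCconv : Convex ℝ C)
    (hCint : (interior C).Nonempty) (hC0 : (0 : H) ∈ C)
    (v : H) (hv : v ≠ 0) :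
    ∀ t τ θ : ℝ,
      (C ∩ (t • v +ᵥ {w : H | ⟪w, v⟫ = 0})).Nonempty →
      (C ∩ (τ • v +ᵥ {w : H | ⟪w, v⟫ = 0})).Nonempty →
      0 ≤ θ → θ ≤ 1 →
      θ * (μH[(n : ℝ) - 1] (C ∩ (t • v +ᵥ {w : H | ⟪w, v⟫ = 0}))).toReal ^
            (1 / ((n : ℝ) - 1)) +
        (1 - θ) * (μH[(n : ℝ) - 1] (C ∩ (τ • v +ᵥ {w : H | ⟪w, v⟫ = 0}))).toReal ^
            (1 / ((n : ℝ) - 1)) ≤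
      (μH[(n : ℝ) - 1]
          (C ∩ ((θ * t + (1 - θ) * τ) • v +ᵥ {w : H | ⟪w, v⟫ = 0}))).toReal ^
        (1 / ((n : ℝ) - 1)) := by
  intro t τ θ ht hτ hθ0 hθ1
  let N : Submodule ℝ H := (ℝ ∙ v)ᗮ
  have hN : {w : H | ⟪w, v⟫ = 0} = (N : Set H) := by
    ext w
    simp [N, Submodule.mem_orthogonal_singleton_iff_inner_left]
  have hfin : Module.finrank ℝ N = n - 1 := by
    have : Fact (Module.finrank ℝ H = (n - 1) + 1) := ⟨by omega⟩
    exact Submodule.finrank_orthogonal_span_singleton hv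
  have hcast : (Module.finrank ℝ N : ℝ) = (n : ℝ) - 1 := by
    rw [hfin, Nat.cast_sub (by omega), Nat.cast_one]
  have hiso (s : ℝ) : Isometry fun w : N ↦ s • v + (w : H) :=
    (IsometryEquiv.addLeft (s • v)).isometry.comp N.subtypeₗᵢ.isometry
  have himage (s : ℝ) : C ∩ (s • v +ᵥ {w : H | ⟪w, v⟫ = 0}) =
      (fun w : N ↦ s • v + (w : H)) '' ((fun w : N ↦ s • v + (w : H)) ⁻¹' C) := by
    rw [image_preimage_eq_inter_range, hN]
    congr 1
    ext x
    simp [mem_vadd_set]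
  have hcompact (s : ℝ) : IsCompact ((fun w : N ↦ s • v + (w : H)) ⁻¹' C) :=
    (hiso s).isClosedEmbedding.isCompact_preimage hCcomp
  have hmeasure (s : ℝ) : (μH[(n : ℝ) - 1] (C ∩ (s • v +ᵥ {w : H | ⟪w, v⟫ = 0}))).toReal =
      (μH[Module.finrank ℝ N] : Measure N).real ((fun w : N ↦ s • v + (w : H)) ⁻¹' C) := by
    rw [himage, (hiso s).hausdorffMeasure_image (Or.inl _), hcast, measureReal_def]
    rw [← hcast]
    positivity
  rw [himage, image_nonempty] at ht hτ
  have hne : Module.finrank ℝ N ≠ 0 := by omega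
  have hθ1' : 0 ≤ 1 - θ := sub_nonneg.2 hθ1
  rw [hmeasure, hmeasure, hmeasure, ← hcast, one_div,
    ← measureReal_smul_rpow_inv_finrank _ hne hθ0, ← measureReal_smul_rpow_inv_finrank _ hne hθ1']
  refine ((hcompact t).smul θ).rpow_measureReal_add_le _ hne ((hcompact τ).smul (1 - θ))
    (hcompact _) ht.smul_set hτ.smul_set ?_
  rintro _ ⟨_, ⟨x, hx, rfl⟩, _, ⟨y, hy, rfl⟩, rfl⟩
  have := hCconv hx hy hθ0 hθ1' (by ring)
  rw [mem_preimage]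
  convert this using 1
  simp only [Submodule.coe_add, Submodule.coe_smul]
  module
end

section
/- Let E be a real inner product space of finite dimension n ≥ 2, let C ⊆ E be a compact convex set with nonempty interior which is centrally symmetric (C = −C), let v ∈ E \ {0} and let N = {w ∈ E : ⟨w,v⟩ = 0}. Then for every z ∈ E one has H^{n−1}((z + C) ∩ N) ≤ H^{n−1}(C ∩ N), and consequently sup_{z ∈ C} H^{n−1}((z + C) ∩ N) = H^{n−1}(C ∩ N). (This is the content of the theorem that for a homogeneous distance with convex unit ball, β(d, v) = H^{n−1}(N(v) ∩ B(0,1)), in the abelian instance where the unit ball of any norm is a symmetric convex body.) -/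
open MeasureTheory Metric Set
open scoped Pointwise RealInnerProductSpace ENNReal Topology

theorem ENNReal.mul_le_sq_of_add_le_two_mul {a b c : ℝ≥0∞} (h : a + b ≤ 2 * c) :
    a * b ≤ c ^ 2 := by
  rcases eq_or_ne c ⊤ with rfl | hc
  · simp
  have hab : a + b ≠ ⊤ := ne_top_of_le_ne_top (ENNReal.mul_ne_top (by simp) hc) h
  rw [ENNReal.add_ne_top] at hab
  lift a to NNReal using hab.1
  lift b to NNReal using hab.2
  lift c to NNReal using hc
  norm_cast at h ⊢
  rw [← NNReal.coe_le_coe] at h ⊢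
  push_cast at h ⊢
  nlinarith [sq_nonneg ((a : ℝ) - b), a.2, b.2, c.2]

theorem Real.volume_add_le_two_mul_of_isCompact {K L Z : Set ℝ}
    (hK : IsCompact K) (hL : IsCompact L) (hK₀ : K.Nonempty) (hL₀ : L.Nonempty)
    (h : ∀ x ∈ K, ∀ y ∈ L, midpoint ℝ x y ∈ Z) :
    volume K + volume L ≤ 2 * volume Z := by
  obtain ⟨a, ha⟩ := hK.exists_isGreatest hK₀
  obtain ⟨b, hb⟩ := hL.exists_isLeast hL₀
  have hmid : ∀ x y : ℝ, midpoint ℝ x y = (x + y) / 2 := fun x y => by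
    rw [midpoint_eq_smul_add]; simp; ring
  simp only [hmid] at h
  have hinter : (b +ᵥ K) ∩ (a +ᵥ L) ⊆ {a + b} := by
    rintro _ ⟨⟨x, hx, rfl⟩, ⟨y, hy, hxy⟩⟩
    have h₁ := ha.2 hx
    have h₂ := hb.2 hy
    simp only [vadd_eq_add] at hxy
    simp only [vadd_eq_add, mem_singleton_iff]
    linarith
  have hsub : (b +ᵥ K) ∪ (a +ᵥ L) ⊆ (2 : ℝ) • Z := by
    rintro _ (⟨x, hx, rfl⟩ | ⟨y, hy, rfl⟩)
    · exact ⟨_, h x hx b hb.1, by simp; ring⟩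
    · exact ⟨_, h a ha.1 y hy, by simp; ring⟩
  calc
    volume K + volume L = volume (b +ᵥ K) + volume (a +ᵥ L) := by
      rw [measure_vadd, measure_vadd]
    _ = volume ((b +ᵥ K) ∪ (a +ᵥ L)) + volume ((b +ᵥ K) ∩ (a +ᵥ L)) :=
      (measure_union_add_inter _ (hL.vadd a).measurableSet).symm
    _ = volume ((b +ᵥ K) ∪ (a +ᵥ L)) := by
      rw [measure_mono_null hinter (by simp), add_zero]
    _ ≤ volume ((2 : ℝ) • Z) := measure_mono hsub
    _ = 2 * volume Z := by rw [Measure.addHaar_smul]; simp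

theorem Real.volume_add_le_two_mul {X Y Z : Set ℝ}
    (hX : MeasurableSet X) (hY : MeasurableSet Y) (hX₀ : X.Nonempty) (hY₀ : Y.Nonempty)
    (h : ∀ x ∈ X, ∀ y ∈ Y, midpoint ℝ x y ∈ Z) :
    volume X + volume Y ≤ 2 * volume Z := by
  obtain ⟨x₀, hx₀⟩ := hX₀
  obtain ⟨y₀, hy₀⟩ := hY₀
  rw [hX.measure_eq_iSup_isCompact, hY.measure_eq_iSup_isCompact]
  simp only [iSup_and']
  refine ENNReal.biSup_add_biSup_le' (p := fun K => K ⊆ X ∧ IsCompact K)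
    (q := fun L => L ⊆ Y ∧ IsCompact L) ⟨∅, by simp⟩ ⟨∅, by simp⟩ ?_
  rintro K ⟨hKX, hK⟩ L ⟨hLY, hL⟩
  refine (add_le_add (measure_mono (subset_insert x₀ K)) (measure_mono (subset_insert y₀ L))).trans
    (volume_add_le_two_mul_of_isCompact (hK.insert x₀) (hL.insert y₀) (insert_nonempty _ _)
      (insert_nonempty _ _) fun x hx y hy => h x ?_ y ?_)
  · exact insert_subset hx₀ hKX hx
  · exact insert_subset hy₀ hLY hy

theorem MeasureTheory.lintegral_eq_lintegral_Ioo_meas_lt {α : Type*} [MeasurableSpace α]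
    {μ : Measure α} {f : α → ℝ≥0∞} (hf : Measurable f) (hf₁ : ∀ x, f x ≤ 1) :
    ∫⁻ x, f x ∂μ = ∫⁻ t in Ioo (0 : ℝ) 1, μ {x | ENNReal.ofReal t < f x} := by
  have hfin : ∀ x, f x ≠ ⊤ := fun x => ne_top_of_le_ne_top ENNReal.one_ne_top (hf₁ x)
  have h := lintegral_eq_lintegral_meas_lt μ (f := fun x => (f x).toReal)
    (.of_forall fun x => ENNReal.toReal_nonneg) hf.ennreal_toReal.aemeasurable
  simp only [ENNReal.ofReal_toReal (hfin _)] at h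
  rw [h, ← Ioo_union_Ici_eq_Ioi (zero_lt_one (α := ℝ)), lintegral_union measurableSet_Ici
    (by rw [Set.disjoint_left]; exact fun x hx hx' => not_le.2 hx.2 hx')]
  have h₀ : ∫⁻ t in Ici (1 : ℝ), μ {x | t < (f x).toReal} = 0 := by
    rw [setLIntegral_congr_fun measurableSet_Ici (g := fun _ => 0) ?_]
    · simp
    intro t ht
    have : {x | t < (f x).toReal} = ∅ := by
      ext x
      simpa using (ENNReal.toReal_mono ENNReal.one_ne_top (hf₁ x)).trans (by simpa using ht)
    simp [this]
  rw [h₀, add_zero]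
  refine setLIntegral_congr_fun measurableSet_Ioo fun t ht => ?_
  simp only [ENNReal.ofReal_lt_iff_lt_toReal ht.1.le (hfin _)]

theorem Real.lintegral_add_le_two_mul_of_iSup_eq_one {f g h : ℝ → ℝ≥0∞}
    (hf : Measurable f) (hg : Measurable g) (hh : Measurable h)
    (hf₁ : ⨆ x, f x = 1) (hg₁ : ⨆ x, g x = 1)
    (hfg : ∀ x y, f x * g y ≤ h (midpoint ℝ x y) ^ 2) :
    (∫⁻ x, f x) + ∫⁻ x, g x ≤ 2 * ∫⁻ x, h x := by
  have key : ∀ t ∈ Ioo (0 : ℝ) 1, volume {x | ENNReal.ofReal t < f x} +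
      volume {x | ENNReal.ofReal t < g x} ≤ 2 * volume {x | ENNReal.ofReal t < min (h x) 1} := by
    intro t ht
    have ht₁ : ENNReal.ofReal t < 1 := by simpa using ht.2
    refine volume_add_le_two_mul (measurableSet_lt measurable_const hf)
      (measurableSet_lt measurable_const hg) ?_ ?_ fun x hx y hy => lt_min ?_ ht₁
    · exact lt_iSup_iff.1 (ht₁.trans_eq hf₁.symm)
    · exact lt_iSup_iff.1 (ht₁.trans_eq hg₁.symm)
    · refine lt_of_pow_lt_pow_left' 2 (lt_of_lt_of_le ?_ (hfg x y))
      rw [sq]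
      exact ENNReal.mul_lt_mul hx hy
  rw [lintegral_eq_lintegral_Ioo_meas_lt hf fun x => hf₁ ▸ le_iSup f x,
    lintegral_eq_lintegral_Ioo_meas_lt hg fun x => hg₁ ▸ le_iSup g x]
  calc
    _ = ∫⁻ t in Ioo (0 : ℝ) 1, (volume {x | ENNReal.ofReal t < f x} +
          volume {x | ENNReal.ofReal t < g x}) := by
      refine (lintegral_add_left (Antitone.measurable fun s t hst => measure_mono fun x hx => ?_)
        _).symm
      exact (ENNReal.ofReal_le_ofReal hst).trans_lt hx
    _ ≤ ∫⁻ t in Ioo (0 : ℝ) 1, 2 * volume {x | ENNReal.ofReal t < min (h x) 1} :=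
      setLIntegral_mono' measurableSet_Ioo key
    _ = 2 * ∫⁻ x, min (h x) 1 := by
      rw [lintegral_const_mul' _ _ (by simp), ← lintegral_eq_lintegral_Ioo_meas_lt
        (hh.min measurable_const) fun x => min_le_right _ _]
    _ ≤ 2 * ∫⁻ x, h x := by gcongr; exact min_le_left _ _

/-- The one-dimensional Prékopa–Leindler inequality with weights `1 / 2`. -/
theorem Real.lintegral_mul_lintegral_le_sq {f g h : ℝ → ℝ≥0∞}
    (hf : Measurable f) (hg : Measurable g) (hh : Measurable h)
    (hfb : ⨆ x, f x ≠ ⊤) (hgb : ⨆ x, g x ≠ ⊤)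
    (hfg : ∀ x y, f x * g y ≤ h (midpoint ℝ x y) ^ 2) :
    (∫⁻ x, f x) * ∫⁻ x, g x ≤ (∫⁻ x, h x) ^ 2 := by
  set F := ⨆ x, f x with hF
  set G := ⨆ x, g x with hG
  rcases eq_or_ne F 0 with hF₀ | hF₀
  · have : f = 0 := funext fun x => ENNReal.iSup_eq_zero.1 hF₀ x
    simp [this]
  rcases eq_or_ne G 0 with hG₀ | hG₀
  · have : g = 0 := funext fun x => ENNReal.iSup_eq_zero.1 hG₀ x
    simp [this]
  set r : ℝ≥0∞ := (F⁻¹ * G⁻¹) ^ (1 / 2 : ℝ) with hr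
  have hr2 : r ^ 2 = F⁻¹ * G⁻¹ := by
    rw [hr, ← ENNReal.rpow_natCast, ← ENNReal.rpow_mul]; norm_num
  have hFG : F⁻¹ * G⁻¹ ≠ 0 := mul_ne_zero (by simpa) (by simpa)
  have hFG' : F⁻¹ * G⁻¹ ≠ ⊤ := ENNReal.mul_ne_top (by simpa) (by simpa)
  have h₁ : ⨆ x, F⁻¹ * f x = 1 := by
    rw [← ENNReal.mul_iSup, ← hF, ENNReal.inv_mul_cancel hF₀ hfb]
  have h₂ : ⨆ x, G⁻¹ * g x = 1 := by
    rw [← ENNReal.mul_iSup, ← hG, ENNReal.inv_mul_cancel hG₀ hgb]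
  have h₃ := ENNReal.mul_le_sq_of_add_le_two_mul <|
    lintegral_add_le_two_mul_of_iSup_eq_one (hf.const_mul F⁻¹) (hg.const_mul G⁻¹)
      (hh.const_mul r) h₁ h₂ fun x y => by
        rw [mul_pow, hr2, mul_mul_mul_comm]
        gcongr
        exact hfg x y
  rw [lintegral_const_mul _ hf, lintegral_const_mul _ hg, lintegral_const_mul _ hh,
    mul_pow, hr2, mul_mul_mul_comm] at h₃
  exact (ENNReal.mul_le_mul_iff_right hFG hFG').1 h₃

/-- The multiplicative Brunn–Minkowski inequality for midpoints of compact sets. -/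
def MidpointBrunnMinkowski {E : Type*} [AddCommGroup E] [Module ℝ E] [TopologicalSpace E]
    [MeasurableSpace E] (μ : Measure E) : Prop :=
  ∀ ⦃A B D : Set E⦄, IsCompact A → IsCompact B → IsCompact D →
    (∀ a ∈ A, ∀ b ∈ B, midpoint ℝ a b ∈ D) → μ A * μ B ≤ μ D ^ 2

namespace MidpointBrunnMinkowski

theorem of_subsingleton {E : Type*} [AddCommGroup E] [Module ℝ E] [TopologicalSpace E]
    [MeasurableSpace E] [Subsingleton E] (μ : Measure E) : MidpointBrunnMinkowski μ := by
  intro A B D _ _ _ h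
  rcases A.eq_empty_or_nonempty with rfl | ⟨a, ha⟩
  · simp
  rcases B.eq_empty_or_nonempty with rfl | ⟨b, hb⟩
  · simp
  have hD := h a ha b hb
  rw [Subsingleton.eq_univ_of_nonempty ⟨a, ha⟩, Subsingleton.eq_univ_of_nonempty ⟨b, hb⟩,
    Subsingleton.eq_univ_of_nonempty ⟨_, hD⟩, sq]

variable {E F : Type*} [NormedAddCommGroup E] [NormedSpace ℝ E] [MeasurableSpace E] [BorelSpace E]
  [NormedAddCommGroup F] [NormedSpace ℝ F] [MeasurableSpace F] [BorelSpace F]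

theorem of_continuousLinearEquiv [FiniteDimensional ℝ F] {ν : Measure F} [ν.IsAddHaarMeasure]
    (hν : MidpointBrunnMinkowski ν) (e : E ≃L[ℝ] F) (μ : Measure E) [μ.IsAddHaarMeasure] :
    MidpointBrunnMinkowski μ := by
  intro A B D hA hB hD h
  have hμ : ∀ s, μ s = Measure.addHaarScalarFactor (μ.map e) ν * ν (e '' s) := fun s => by
    have := congrArg (fun m : Measure F => m (e '' s))
      (Measure.isAddLeftInvariant_eq_smul (μ.map e) ν)
    have hm : μ.map e (e '' s) = μ s := by
      rw [← e.injective.preimage_image s]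
      exact e.toHomeomorph.measurableEmbedding.map_apply _ _ |>.trans (by
        simp [e.injective.preimage_image])
    simpa [hm] using this
  rw [hμ A, hμ B, hμ D, mul_pow, mul_mul_mul_comm, ← sq]
  gcongr
  refine hν (hA.image e.continuous) (hB.image e.continuous) (hD.image e.continuous) ?_
  rintro _ ⟨a, ha, rfl⟩ _ ⟨b, hb, rfl⟩
  exact ⟨_, h a ha b hb, by simp [midpoint_eq_smul_add]⟩

theorem volume_prod [SecondCountableTopology E] {μ : Measure E} [SFinite μ]
    [IsFiniteMeasureOnCompacts μ] (hμ : MidpointBrunnMinkowski μ) :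
    MidpointBrunnMinkowski ((volume : Measure ℝ).prod μ) := by
  intro A B D hA hB hD h
  have hbdd : ∀ {s : Set (ℝ × E)}, IsCompact s → ⨆ x, μ (Prod.mk x ⁻¹' s) ≠ ⊤ := fun hs =>
    ne_top_of_le_ne_top (hs.image continuous_snd).measure_lt_top.ne <|
      iSup_le fun x => measure_mono fun y hy => ⟨_, hy, rfl⟩
  have hsec : ∀ {s : Set (ℝ × E)}, IsCompact s → ∀ x, IsCompact (Prod.mk x ⁻¹' s) := fun hs x =>
    (hs.image continuous_snd).of_isClosed_subset
      (hs.isClosed.preimage (Continuous.prodMk_right x)) fun y hy => ⟨_, hy, rfl⟩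
  rw [Measure.prod_apply hA.measurableSet, Measure.prod_apply hB.measurableSet,
    Measure.prod_apply hD.measurableSet]
  refine Real.lintegral_mul_lintegral_le_sq (measurable_measure_prodMk_left hA.measurableSet)
    (measurable_measure_prodMk_left hB.measurableSet)
    (measurable_measure_prodMk_left hD.measurableSet) (hbdd hA) (hbdd hB) fun x y =>
      hμ (hsec hA x) (hsec hB y) (hsec hD _) fun a ha b hb => ?_
  have := h _ ha _ hb
  simpa [midpoint_eq_smul_add] using this

theorem volume_pi (n : ℕ) : MidpointBrunnMinkowski (volume : Measure (Fin n → ℝ)) := by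
  induction n with
  | zero => exact of_subsingleton _
  | succ n ih =>
    exact ih.volume_prod.of_continuousLinearEquiv
      (ContinuousLinearEquiv.ofFinrankEq (by simp [add_comm])) _

theorem of_isAddHaarMeasure [FiniteDimensional ℝ E] (μ : Measure E) [μ.IsAddHaarMeasure] :
    MidpointBrunnMinkowski μ :=
  (volume_pi (Module.finrank ℝ E)).of_continuousLinearEquiv
    (ContinuousLinearEquiv.ofFinrankEq (by simp)) μ

end MidpointBrunnMinkowski

/-- For a centrally symmetric compact convex body `C` in an `n`-dimensional real inner
product space (`n ≥ 2`) and `v ≠ 0` with orthogonal hyperplane `N = {w | ⟪w, v⟫ = 0}`: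
every translated section satisfies `H^{n-1}((z + C) ∩ N) ≤ H^{n-1}(C ∩ N)`, and
consequently `sup_{z ∈ C} H^{n-1}((z + C) ∩ N) = H^{n-1}(C ∩ N)`. -/
theorem beta_of_convex_symmetric_body
    {E : Type*} [NormedAddCommGroup E] [InnerProductSpace ℝ E]
    [FiniteDimensional ℝ E] [MeasurableSpace E] [BorelSpace E]
    (n : ℕ) (hn : Module.finrank ℝ E = n) (hn2 : 2 ≤ n)
    (C : Set E) (hCcomp : IsCompact C) (hCconv : Convex ℝ C)
    (hCint : (interior C).Nonempty) (hCsym : C = -C)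
    (v : E) (hv : v ≠ 0) :
    (∀ z : E,
        μH[(n : ℝ) - 1] ((z +ᵥ C) ∩ {w : E | ⟪w, v⟫ = 0}) ≤
          μH[(n : ℝ) - 1] (C ∩ {w : E | ⟪w, v⟫ = 0})) ∧
      (⨆ (z : E) (_ : z ∈ C),
          μH[(n : ℝ) - 1] ((z +ᵥ C) ∩ {w : E | ⟪w, v⟫ = 0})) =
        μH[(n : ℝ) - 1] (C ∩ {w : E | ⟪w, v⟫ = 0}) := by
  have hneg : ∀ {c}, c ∈ C → -c ∈ C := fun {c} hc => by rw [hCsym]; simpa using hc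
  have hle : ∀ z : E, μH[(n : ℝ) - 1] ((z +ᵥ C) ∩ {w : E | ⟪w, v⟫ = 0}) ≤
      μH[(n : ℝ) - 1] (C ∩ {w : E | ⟪w, v⟫ = 0}) := by
    intro z
    let N : Submodule ℝ E := (ℝ ∙ v)ᗮ
    have hN : Module.finrank ℝ N = n - 1 := by
      have : Fact (Module.finrank ℝ E = (n - 1) + 1) := ⟨by omega⟩
      exact Submodule.finrank_orthogonal_span_singleton hv
    have hd : (n : ℝ) - 1 = (Module.finrank ℝ N : ℝ) := by
      rw [hN, Nat.cast_sub (by omega), Nat.cast_one]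
    have hNset : {w : E | ⟪w, v⟫ = 0} = range ((↑) : N → E) := by
      ext w
      simp [N, Submodule.mem_orthogonal_singleton_iff_inner_left]
    have hsec : ∀ s : Set E, μH[(n : ℝ) - 1] (s ∩ {w : E | ⟪w, v⟫ = 0}) =
        μH[(Module.finrank ℝ N : ℝ)] (((↑) : N → E) ⁻¹' s) := fun s => by
      rw [hNset, ← isometry_subtype_coe.hausdorffMeasure_preimage (.inl (by rw [hd]; positivity)),
        hd]
    have hcl : Topology.IsClosedEmbedding ((↑) : N → E) :=
      N.closed_of_finiteDimensional.isClosedEmbedding_subtypeVal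
    have hA : IsCompact (((↑) : N → E) ⁻¹' (z +ᵥ C)) := hcl.isCompact_preimage (hCcomp.vadd z)
    have hD : IsCompact (((↑) : N → E) ⁻¹' C) := hcl.isCompact_preimage hCcomp
    have hBM := MidpointBrunnMinkowski.of_isAddHaarMeasure
      (μH[(Module.finrank ℝ N : ℝ)] : Measure N) hA hA.neg hD ?_
    · rw [Measure.measure_neg, ← sq] at hBM
      rw [hsec, hsec]
      exact (ENNReal.pow_le_pow_left_iff two_ne_zero).1 hBM
    rintro a ⟨c, hc, hca⟩ b ⟨c', hc', hcb⟩
    have hmid := hCconv.midpoint_mem hc (hneg hc')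
    have : ((midpoint ℝ a b : N) : E) = midpoint ℝ c (-c') := by
      simp only [vadd_eq_add, Submodule.coe_neg] at hca hcb
      have hb : (b : E) = -(z + c') := by rw [hcb, neg_neg]
      simp only [midpoint_eq_smul_add, Submodule.coe_smul, Submodule.coe_add, ← hca, hb]
      congr 1
      abel
    simpa [this] using hmid
  refine ⟨hle, le_antisymm (iSup₂_le fun z _ => hle z) ?_⟩
  obtain ⟨c, hc⟩ := hCint.mono interior_subset
  have h₀ : (0 : E) ∈ C := by
    simpa [midpoint_self_neg] using hCconv.midpoint_mem hc (hneg hc)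
  exact (by rw [zero_vadd] : _ ≤ _).trans (le_iSup₂_of_le 0 h₀ le_rfl)
end

section
/- Let X be a nontrivial finite-dimensional real normed vector space, let α > 0, and let μ be a Borel regular measure over X such that there exists a countable open covering of X whose elements have finite μ-measure. Let B ⊆ A ⊆ X be Borel sets. Then the spherical Federer density x ↦ θ^α(μ, x) is a Borel function on A. Moreover, if S^α(A) < +∞ and μ⌞A is absolutely continuous with respect to S^α⌞A, then μ(B) = ∫_B θ^α(μ, x) dS^α(x). (This is the measure-theoretic area formula of Theorem 1.1; in a normed vector space the hypotheses of diametric regularity and fine covering by closed balls hold automatically, since diam B̄(y,t) = 2t and every point lies in closed balls of arbitrarily small positive diameter.) -/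
open MeasureTheory Metric Set
open scoped ENNReal Topology

/-- The spherical Federer density `θ^α(μ, x)` of a Borel measure `μ` on a normed
space, with respect to the geometric constant `c_α = 2^{-α}`:
`θ^α(μ, x) = inf_{r>0} sup { μ(B̄(y,t)) / t^α : 0 < t < r, dist x y ≤ t }`. -/
noncomputable def sphericalFedererDensity {X : Type*} [NormedAddCommGroup X]
    [MeasurableSpace X] (α : ℝ) (μ : Measure X) (x : X) : ℝ≥0∞ :=
  ⨅ (r : ℝ) (_ : 0 < r), ⨆ (y : X) (t : ℝ) (_ : 0 < t) (_ : t < r)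
    (_ : dist x y ≤ t),
    μ (Metric.closedBall y t) / ENNReal.ofReal t ^ α

/-- The supremum of `μ (closedBall y t) / t ^ α` over the closed balls of radius `t < r`
containing `x`; its infimum over `r > 0` is the spherical Federer density. -/
noncomputable def sphericalDensityAtScale {X : Type*} [NormedAddCommGroup X]
    [MeasurableSpace X] (α : ℝ) (μ : Measure X) (r : ℝ) (x : X) : ℝ≥0∞ :=
  ⨆ (y : X) (t : ℝ) (_ : 0 < t) (_ : t < r) (_ : dist x y ≤ t),
    μ (closedBall y t) / ENNReal.ofReal t ^ α

section Density

variable {X : Type*} [NormedAddCommGroup X] [MeasurableSpace X] {α : ℝ} {μ : Measure X}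

theorem sphericalFedererDensity_eq_iInf (x : X) :
    sphericalFedererDensity α μ x = ⨅ (r : ℝ) (_ : 0 < r), sphericalDensityAtScale α μ r x :=
  rfl

theorem lt_sphericalDensityAtScale_iff {c : ℝ≥0∞} {r : ℝ} {x : X} :
    c < sphericalDensityAtScale α μ r x ↔ ∃ y t, 0 < t ∧ t < r ∧ dist x y ≤ t ∧
      c < μ (closedBall y t) / ENNReal.ofReal t ^ α := by
  simp only [sphericalDensityAtScale, lt_iSup_iff, exists_prop]

theorem sphericalDensityAtScale_mono (x : X) :
    Monotone fun r => sphericalDensityAtScale α μ r x := by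
  intro r s hrs
  refine le_of_forall_lt fun c hc => ?_
  obtain ⟨y, t, ht, htr, hx, h⟩ := lt_sphericalDensityAtScale_iff.1 hc
  exact lt_sphericalDensityAtScale_iff.2 ⟨y, t, ht, htr.trans_le hrs, hx, h⟩

theorem continuous_ofReal_rpow (hα : 0 ≤ α) :
    Continuous fun t : ℝ => ENNReal.ofReal t ^ α := by
  have : α = (α.toNNReal : ℝ) := (Real.coe_toNNReal _ hα).symm
  exact ENNReal.continuous_rpow_const.comp ENNReal.continuous_ofReal

theorem ofReal_rpow_ne_zero {t : ℝ} (ht : 0 < t) : ENNReal.ofReal t ^ α ≠ 0 :=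
  (ENNReal.rpow_pos (ENNReal.ofReal_pos.2 ht) ENNReal.ofReal_ne_top).ne'

theorem ofReal_rpow_ne_top (hα : 0 ≤ α) {t : ℝ} : ENNReal.ofReal t ^ α ≠ ∞ :=
  ENNReal.rpow_ne_top_of_nonneg hα ENNReal.ofReal_ne_top

theorem lowerSemicontinuous_sphericalDensityAtScale (hα : 0 ≤ α) (r : ℝ) :
    LowerSemicontinuous (sphericalDensityAtScale α μ r) := by
  refine lowerSemicontinuous_iff_isOpen_preimage.2 fun c => isOpen_iff_mem_nhds.2 fun x hx => ?_
  obtain ⟨y, t, ht, htr, hxy, h⟩ := lt_sphericalDensityAtScale_iff.1 hx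
  have hcont : Filter.Tendsto (fun s : ℝ => μ (closedBall y t) / ENNReal.ofReal s ^ α) (𝓝 t)
      (𝓝 (μ (closedBall y t) / ENNReal.ofReal t ^ α)) :=
    ENNReal.Tendsto.const_div ((continuous_ofReal_rpow hα).tendsto t)
      (Or.inl (ofReal_rpow_ne_top hα))
  have hev : ∀ᶠ s in 𝓝[>] t, c < μ (closedBall y t) / ENNReal.ofReal s ^ α ∧ s < r :=
    nhdsWithin_le_nhds ((hcont.eventually_const_lt h).and (gt_mem_nhds htr))
  obtain ⟨s, ⟨hs, hsr⟩, hts : t < s⟩ := (hev.and self_mem_nhdsWithin).exists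
  filter_upwards [isOpen_ball.mem_nhds (mem_ball.2 (hxy.trans_lt hts))] with z hz
  exact lt_sphericalDensityAtScale_iff.2 ⟨y, s, ht.trans hts, hsr, (mem_ball.1 hz).le,
    hs.trans_le (ENNReal.div_le_div_right (measure_mono (closedBall_subset_closedBall hts.le)) _)⟩

theorem sphericalFedererDensity_eq_iInf_nat (x : X) :
    sphericalFedererDensity α μ x = ⨅ n : ℕ, sphericalDensityAtScale α μ (1 / (n + 1)) x := by
  rw [sphericalFedererDensity_eq_iInf]
  refine le_antisymm (le_iInf fun n => iInf₂_le _ Nat.one_div_pos_of_nat)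
    (le_iInf₂ fun r hr => ?_)
  obtain ⟨n, hn⟩ := exists_nat_one_div_lt hr
  exact (iInf_le _ n).trans (sphericalDensityAtScale_mono x hn.le)

theorem measurable_sphericalFedererDensity [BorelSpace X] (hα : 0 ≤ α) :
    Measurable (sphericalFedererDensity α μ) := by
  simp_rw [funext (sphericalFedererDensity_eq_iInf_nat (α := α) (μ := μ))]
  exact .iInf fun n => (lowerSemicontinuous_sphericalDensityAtScale hα _).measurable

/-- A ball meeting the set where the density at scale `r` is less than `c` satisfies the
corresponding bound, degenerate balls included. -/
theorem measure_closedBall_le_of_sphericalDensityAtScale_lt (hα : 0 ≤ α) {c : ℝ≥0∞}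
    {r t : ℝ} {x y : X} (hx : sphericalDensityAtScale α μ r x < c) (hc : c ≠ ∞) (ht : 0 ≤ t)
    (htr : t < r) (hxy : dist x y ≤ t) :
    μ (closedBall y t) ≤ c * ENNReal.ofReal t ^ α := by
  have hlim : Filter.Tendsto (fun s : ℝ => c * ENNReal.ofReal s ^ α) (𝓝[>] t)
      (𝓝 (c * ENNReal.ofReal t ^ α)) :=
    ENNReal.Tendsto.const_mul (((continuous_ofReal_rpow hα).tendsto t).mono_left
      nhdsWithin_le_nhds) (Or.inr hc)
  refine ge_of_tendsto hlim ?_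
  filter_upwards [self_mem_nhdsWithin, nhdsWithin_le_nhds (gt_mem_nhds htr)] with s hts hsr
  replace hts : t < s := hts
  refine (measure_mono (closedBall_subset_closedBall hts.le)).trans ?_
  rw [← ENNReal.div_le_iff (ofReal_rpow_ne_zero (ht.trans_lt hts)) (ofReal_rpow_ne_top hα)]
  exact not_lt.1 fun h => hx.not_ge (lt_sphericalDensityAtScale_iff.2
    ⟨y, s, ht.trans_lt hts, hsr, hxy.trans hts.le, h⟩).le

end Density

section Comparison

variable {X : Type*} [NormedAddCommGroup X]

/-- The size `δ` approximation of the spherical Hausdorff measure. -/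
noncomputable def sphericalPremeasure (α δ : ℝ) (A : Set X) : ℝ≥0∞ :=
  ⨅ (y : ℕ → X) (t : ℕ → ℝ)
    (_ : (∀ j, 0 ≤ t j) ∧ (∀ j, 2 * t j ≤ δ) ∧ A ⊆ ⋃ j, closedBall (y j) (t j)),
    ∑' j, ENNReal.ofReal (t j) ^ α

variable {α δ : ℝ}

theorem sphericalPremeasure_mono {A B : Set X} (h : A ⊆ B) :
    sphericalPremeasure α δ A ≤ sphericalPremeasure α δ B :=
  le_iInf₂ fun y t => le_iInf fun ht =>
    iInf₂_le_of_le y t (iInf_le_of_le ⟨ht.1, ht.2.1, h.trans ht.2.2⟩ le_rfl)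

theorem sphericalPremeasure_le_tsum (hα : 0 < α) (hδ : 0 ≤ δ) {ι : Type*} [Countable ι]
    {A : Set X} (y : ι → X) (t : ι → ℝ) (ht : ∀ i, 0 ≤ t i) (htδ : ∀ i, 2 * t i ≤ δ)
    (hA : A ⊆ ⋃ i, closedBall (y i) (t i)) :
    sphericalPremeasure α δ A ≤ ∑' i, ENNReal.ofReal (t i) ^ α := by
  obtain ⟨e, he⟩ := exists_injective_nat ι
  have hext (P : ℝ → Prop) (h0 : P 0) (h : ∀ i, P (t i)) (j : ℕ) :
      P (Function.extend e t 0 j) := by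
    by_cases hj : ∃ i, e i = j
    · obtain ⟨i, rfl⟩ := hj
      simpa only [he.extend_apply] using h i
    · simpa only [Function.extend_apply' _ _ _ hj, Pi.zero_apply] using h0
  refine iInf₂_le_of_le (Function.extend e y 0) (Function.extend e t 0)
    (iInf_le_of_le ⟨hext (0 ≤ ·) le_rfl ht, hext (2 * · ≤ δ) (by simpa using hδ) htδ, ?_⟩ ?_)
  · refine hA.trans (iUnion_subset fun i => subset_iUnion_of_subset (e i) ?_)
    rw [he.extend_apply, he.extend_apply]
  · rw [← tsum_extend_zero he]
    refine (tsum_congr fun j => ?_).le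
    by_cases hj : ∃ i, e i = j
    · obtain ⟨i, rfl⟩ := hj
      simp only [he.extend_apply]
    · simp [Function.extend_apply' _ _ _ hj, hα]

variable [MeasurableSpace X] {μ S : Measure X}

theorem measure_le_mul_of_sphericalFedererDensity_lt (hα : 0 ≤ α)
    (hS : ∀ A : Set X, S A = ⨆ (δ : ℝ) (_ : 0 < δ), sphericalPremeasure α δ A)
    {c : ℝ≥0∞} (hc : c ≠ ∞) {E : Set X} (hE : ∀ x ∈ E, sphericalFedererDensity α μ x < c) :
    μ E ≤ c * S E := by
  rcases E.eq_empty_or_nonempty with rfl | ⟨x₀, hx₀⟩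
  · simp
  have hc0 : c ≠ 0 := (pos_of_gt (hE x₀ hx₀)).ne'
  let F : ℕ → Set X := fun n => {x ∈ E | sphericalDensityAtScale α μ (1 / (n + 1)) x < c}
  have hF : Monotone F := fun m n hmn x hx =>
    ⟨hx.1, (sphericalDensityAtScale_mono x (Nat.one_div_le_one_div hmn)).trans_lt hx.2⟩
  have hEF : E ⊆ ⋃ n, F n := fun x hx => by
    have h := hE x hx
    rw [sphericalFedererDensity_eq_iInf_nat, iInf_lt_iff] at h
    exact mem_iUnion.2 (h.imp fun n hn => ⟨hx, hn⟩)
  refine (measure_mono hEF).trans ?_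
  rw [hF.measure_iUnion]
  refine iSup_le fun n => ?_
  have hn : (0 : ℝ) < 1 / (n + 1) := Nat.one_div_pos_of_nat
  rw [mul_comm, ← ENNReal.div_le_iff hc0 hc, hS]
  refine le_iSup₂_of_le (1 / (n + 1) : ℝ) hn
    (le_trans ?_ (sphericalPremeasure_mono (A := F n) fun x hx => hx.1))
  refine le_iInf₂ fun y t => le_iInf fun ⟨ht, htδ, hcov⟩ => ENNReal.div_le_of_le_mul ?_
  calc μ (F n) ≤ μ (⋃ j, F n ∩ closedBall (y j) (t j)) := by
        rw [← inter_iUnion]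
        exact measure_mono (subset_inter subset_rfl hcov)
    _ ≤ ∑' j, μ (F n ∩ closedBall (y j) (t j)) := measure_iUnion_le _
    _ ≤ ∑' j, c * ENNReal.ofReal (t j) ^ α := by
        refine ENNReal.tsum_le_tsum fun j => ?_
        rcases (F n ∩ closedBall (y j) (t j)).eq_empty_or_nonempty with h | ⟨x, hxF, hx⟩
        · simp [h]
        · exact (measure_mono inter_subset_right).trans
            (measure_closedBall_le_of_sphericalDensityAtScale_lt hα hxF.2 hc (ht j)
              (by linarith [htδ j, ht j]) hx)
    _ = (∑' j, ENNReal.ofReal (t j) ^ α) * c := by rw [ENNReal.tsum_mul_left, mul_comm]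

/-- Vitali covering argument: a fine family of balls inside an open set of finite measure. -/
theorem sphericalPremeasure_le_div_of_lt_sphericalFedererDensity [NormedSpace ℝ X]
    [SecondCountableTopology X] [BorelSpace X] (hα : 0 < α) (hδ : 0 < δ)
    {c : ℝ≥0∞} (hc0 : c ≠ 0) (hc : c ≠ ∞) {E U : Set X} (hU : IsOpen U) (hμU : μ U ≠ ∞)
    (hEU : E ⊆ U) (hE : ∀ x ∈ E, c < sphericalFedererDensity α μ x) :
    sphericalPremeasure α δ E ≤ μ U / c := by
  let T : Set (X × ℝ) := {p | 0 < p.2 ∧ 10 * p.2 ≤ δ ∧ closedBall p.1 p.2 ⊆ U ∧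
    c * ENNReal.ofReal p.2 ^ α ≤ μ (closedBall p.1 p.2)}
  have hfine : ∀ x ∈ E, ∀ V ∈ 𝓝 x,
      ∃ p ∈ T, x ∈ closedBall p.1 p.2 ∧ closedBall p.1 p.2 ⊆ V := by
    intro x hx V hV
    obtain ⟨ε, hε, hεV⟩ := nhds_basis_ball.mem_iff.1
      (Filter.inter_mem hV (hU.mem_nhds (hEU hx)))
    have h := (hE x hx).trans_le (iInf₂_le (min (ε / 2) (δ / 10)) (by positivity))
    obtain ⟨y, t, ht, htr, hxy, h⟩ := lt_sphericalDensityAtScale_iff.1 h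
    rw [lt_min_iff] at htr
    have hsub : closedBall y t ⊆ V ∩ U := by
      refine Subset.trans (fun z hz => mem_ball.2 ?_) hεV
      have := dist_triangle_right z x y
      rw [mem_closedBall] at hz
      linarith
    refine ⟨(y, t), ⟨ht, by linarith, hsub.trans inter_subset_right, ?_⟩, hxy,
      hsub.trans inter_subset_left⟩
    rw [← ENNReal.le_div_iff_mul_le (Or.inl (ofReal_rpow_ne_zero ht))
      (Or.inl (ofReal_rpow_ne_top hα.le))]
    exact h.le
  obtain ⟨u, huT, hdisj, hcov⟩ := Vitali.exists_disjoint_subfamily_covering_enlargement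
    (fun p : X × ℝ => closedBall p.1 p.2) T Prod.snd 2 one_lt_two (fun p hp => hp.1.le) (δ / 10)
    (fun p hp => by linarith [hp.2.1]) (fun p hp => nonempty_closedBall.2 hp.1.le)
  have hucount : u.Countable := hdisj.countable_of_nonempty_interior fun p hp =>
    ⟨p.1, ball_subset_interior_closedBall (mem_ball_self (huT hp).1)⟩
  have : Countable u := hucount.to_subtype
  let f : u → ℝ≥0∞ := fun p => ENNReal.ofReal p.1.2 ^ α
  have hsum : ∑' p, f p ≤ μ U / c := by
    rw [ENNReal.le_div_iff_mul_le (Or.inl hc0) (Or.inl hc), mul_comm, ← ENNReal.tsum_mul_left]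
    calc ∑' p : u, c * f p ≤ ∑' p : u, μ (closedBall p.1.1 p.1.2) :=
          ENNReal.tsum_le_tsum fun p => (huT p.2).2.2.2
      _ = μ (⋃ p ∈ u, closedBall p.1 p.2) :=
          (measure_biUnion hucount hdisj fun p _ => measurableSet_closedBall).symm
      _ ≤ μ U := measure_mono (iUnion₂_subset fun p hp => (huT hp).2.2.1)
  have hfin : ∑' p, f p ≠ ∞ := ne_top_of_le_ne_top (ENNReal.div_ne_top hμU hc0) hsum
  have key (F : Finset u) : sphericalPremeasure α δ E ≤
      ∑' p, f p + ENNReal.ofReal 5 ^ α * ∑' p : {p // p ∉ F}, f p := by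
    classical
    let t : u → ℝ := fun p => if p ∈ F then p.1.2 else 5 * p.1.2
    have hpos (p : u) : 0 < p.1.2 := (huT p.2).1
    have hle (p : u) : 10 * p.1.2 ≤ δ := (huT p.2).2.1
    refine (sphericalPremeasure_le_tsum hα hδ.le (fun p : u => p.1.1) t ?_ ?_ ?_).trans ?_
    · intro p
      dsimp only [t]
      split_ifs <;> linarith [hpos p]
    · intro p
      dsimp only [t]
      split_ifs <;> linarith [hpos p, hle p]
    · intro x hx
      rw [mem_iUnion]
      by_cases hxF : ∃ p ∈ F, x ∈ closedBall p.1.1 p.1.2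
      · obtain ⟨p, hp, hxp⟩ := hxF
        exact ⟨p, by simpa only [t, if_pos hp] using hxp⟩
      have hclosed : IsClosed (⋃ p ∈ F, closedBall p.1.1 p.1.2) :=
        F.finite_toSet.isClosed_biUnion fun p _ => isClosed_closedBall
      obtain ⟨a, haT, hxa, ha⟩ := hfine x hx _ (hclosed.isOpen_compl.mem_nhds (by
        simpa only [mem_compl_iff, mem_iUnion, exists_prop] using hxF))
      obtain ⟨b, hb, ⟨z, hza, hzb⟩, hab⟩ := hcov a haT
      have hbF : (⟨b, hb⟩ : u) ∉ F := fun h => ha hza (mem_biUnion h hzb)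
      refine ⟨⟨b, hb⟩, ?_⟩
      simp only [t, if_neg hbF, mem_closedBall] at hxa hza hzb ⊢
      linarith [dist_triangle x a.1 b.1, dist_triangle_left a.1 b.1 z]
    · have hcompl : ∑' p : {p // p ∉ F}, f p = ∑' p, {p | p ∉ F}.indicator f p :=
        tsum_subtype {p | p ∉ F} f
      rw [hcompl, ← ENNReal.tsum_mul_left, ← ENNReal.tsum_add]
      refine ENNReal.tsum_le_tsum fun p => ?_
      by_cases hp : p ∈ F
      · simp [t, f, hp]
      · simp only [t, if_neg hp, indicator_of_mem (show p ∈ {p | p ∉ F} from hp), f]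
        rw [ENNReal.ofReal_mul (by norm_num), ENNReal.mul_rpow_of_nonneg _ _ hα.le]
        exact le_add_self
  have hlim := ENNReal.Tendsto.const_mul (a := ENNReal.ofReal 5 ^ α)
    (ENNReal.tendsto_tsum_compl_atTop_zero hfin) (Or.inr (ofReal_rpow_ne_top hα.le))
  have hlim' := hlim.const_add (∑' p, f p)
  rw [mul_zero, add_zero] at hlim'
  exact (ge_of_tendsto' hlim' key).trans hsum

theorem mul_measure_le_of_lt_sphericalFedererDensity [NormedSpace ℝ X]
    [SecondCountableTopology X] [BorelSpace X] [μ.OuterRegular] (hα : 0 < α)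
    (hS : ∀ A : Set X, S A = ⨆ (δ : ℝ) (_ : 0 < δ), sphericalPremeasure α δ A)
    {c : ℝ≥0∞} (hc : c ≠ ∞) {E : Set X} (hE : ∀ x ∈ E, c < sphericalFedererDensity α μ x) :
    c * S E ≤ μ E := by
  rcases eq_or_ne c 0 with rfl | hc0
  · simp
  refine le_of_forall_gt fun r hr => ?_
  obtain ⟨U, hEU, hU, hUr⟩ := E.exists_isOpen_lt_of_lt r hr
  refine lt_of_le_of_lt ?_ hUr
  rw [mul_comm, ← ENNReal.le_div_iff_mul_le (Or.inl hc0) (Or.inl hc), hS]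
  exact iSup₂_le fun δ hδ => sphericalPremeasure_le_div_of_lt_sphericalFedererDensity hα hδ hc0 hc
    hU hUr.ne_top hEU hE

end Comparison

/-- If a measurable `g` satisfies the density comparison inequalities between two measures on
its sublevel and superlevel sets, then it is a density. -/
theorem eq_withDensity_of_forall_lt {X : Type*} [MeasurableSpace X] {μ S : Measure X}
    [SigmaFinite μ] [IsFiniteMeasure S] (hμS : μ ≪ S) {g : X → ℝ≥0∞} (hg : Measurable g)
    (hlt : ∀ c : ℝ≥0∞, c ≠ ∞ → ∀ E, MeasurableSet E → (∀ x ∈ E, g x < c) → μ E ≤ c * S E)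
    (hgt : ∀ c : ℝ≥0∞, c ≠ ∞ → ∀ E, MeasurableSet E → (∀ x ∈ E, c < g x) → c * S E ≤ μ E) :
    μ = S.withDensity g := by
  set f := μ.rnDeriv S
  have hf : Measurable f := μ.measurable_rnDeriv S
  have hμ : S.withDensity f = μ := Measure.withDensity_rnDeriv_eq μ S hμS
  have hfE {E : Set X} (hE : MeasurableSet E) : ∫⁻ x in E, f x ∂S = μ E := by
    rw [← withDensity_apply _ hE, hμ]
  have h1 (q : ℚ) : ∀ᵐ x ∂S, g x < Real.toNNReal q → f x ≤ Real.toNNReal q := by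
    have hm := measurableSet_lt hg (measurable_const (a := (Real.toNNReal q : ℝ≥0∞)))
    refine (ae_restrict_iff' hm).1 (ae_le_of_forall_setLIntegral_le_of_sigmaFinite hf
      fun s hs _ => ?_)
    rw [Measure.restrict_restrict hs, hfE (hs.inter hm), setLIntegral_const]
    exact hlt _ ENNReal.coe_ne_top _ (hs.inter hm) fun x hx => hx.2
  have h2 (q : ℚ) : ∀ᵐ x ∂S, Real.toNNReal q < g x → Real.toNNReal q ≤ f x := by
    have hm := measurableSet_lt (measurable_const (a := (Real.toNNReal q : ℝ≥0∞))) hg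
    refine (ae_restrict_iff' hm).1 (ae_le_of_forall_setLIntegral_le_of_sigmaFinite
      measurable_const fun s hs _ => ?_)
    rw [Measure.restrict_restrict hs, hfE (hs.inter hm), setLIntegral_const]
    exact hgt _ ENNReal.coe_ne_top _ (hs.inter hm) fun x hx => hx.2
  have hfg : f =ᵐ[S] g := by
    filter_upwards [ae_all_iff.2 h1, ae_all_iff.2 h2] with x hx1 hx2
    refine le_antisymm (not_lt.1 fun h => ?_) (not_lt.1 fun h => ?_)
    · obtain ⟨q, -, hgq, hqf⟩ := ENNReal.lt_iff_exists_rat_btwn.1 h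
      exact (hx1 q hgq).not_gt hqf
    · obtain ⟨q, -, hfq, hqg⟩ := ENNReal.lt_iff_exists_rat_btwn.1 h
      exact (hx2 q hqg).not_gt hfq
  rw [← hμ, withDensity_congr_ae hfg]

/-- **Measure-theoretic area formula** (Theorem 1.1, in a normed space): let `X` be a
nontrivial finite-dimensional real normed space, `α > 0`, and `μ` a Borel measure on
`X` admitting a countable open cover of `X` by sets of finite measure. Let `S` be the
`α`-dimensional spherical Hausdorff measure with constant `2^{-α}`, i.e. the measure
whose value on every set `A` is
`sup_{δ>0} inf { Σ_j t_j^α : A ⊆ ⋃_j B̄(y_j, t_j), 0 ≤ t_j, 2 t_j ≤ δ }`.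
Then for Borel sets `B ⊆ A ⊆ X`: the spherical Federer density `θ^α(μ, ·)` is Borel
on `A`; and if `S(A) < ∞` and `μ ⌞ A` is absolutely continuous with respect to
`S ⌞ A` (every subset of `A` that is `S`-null is `μ`-null), then
`μ(B) = ∫_B θ^α(μ, x) dS(x)`. -/
theorem measure_theoretic_area_formula
    {X : Type*} [NormedAddCommGroup X] [NormedSpace ℝ X]
    [FiniteDimensional ℝ X] [Nontrivial X] [MeasurableSpace X] [BorelSpace X]
    (α : ℝ) (hα : 0 < α)
    (μ : Measure X)
    (hcov : ∃ U : ℕ → Set X, (∀ i, IsOpen (U i)) ∧ (⋃ i, U i) = Set.univ ∧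
      ∀ i, μ (U i) < ∞)
    (S : Measure X)
    (hS : ∀ A : Set X, S A =
      ⨆ (δ : ℝ) (_ : 0 < δ),
        ⨅ (y : ℕ → X) (t : ℕ → ℝ)
          (_ : (∀ j, 0 ≤ t j) ∧ (∀ j, 2 * t j ≤ δ) ∧
            A ⊆ ⋃ j, Metric.closedBall (y j) (t j)),
          ∑' j, ENNReal.ofReal (t j) ^ α)
    (A B : Set X) (hA : MeasurableSet A) (hB : MeasurableSet B) (hBA : B ⊆ A) :
    Measurable (fun x : A => sphericalFedererDensity α μ (x : X)) ∧
      (S A < ∞ → (∀ s ⊆ A, S s = 0 → μ s = 0) →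
        μ B = ∫⁻ x in B, sphericalFedererDensity α μ x ∂S) := by
  have hmeas := measurable_sphericalFedererDensity (μ := μ) hα.le
  refine ⟨hmeas.comp measurable_subtype_coe, fun hSA hac => ?_⟩
  have : ProperSpace X := FiniteDimensional.proper ℝ X
  obtain ⟨U, hUo, hUuniv, hUfin⟩ := hcov
  have : IsLocallyFiniteMeasure μ := ⟨fun x => by
    obtain ⟨i, hi⟩ := mem_iUnion.1 (hUuniv ▸ mem_univ x)
    exact ⟨U i, (hUo i).mem_nhds hi, hUfin i⟩⟩
  have : IsFiniteMeasure (S.restrict A) := ⟨by rwa [Measure.restrict_apply_univ]⟩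
  have hμS : μ.restrict A ≪ S.restrict A := .mk fun s hs h => by
    rw [Measure.restrict_apply hs] at h ⊢
    exact hac _ inter_subset_right h
  have hdens := eq_withDensity_of_forall_lt hμS hmeas
    (fun c hc E hE h => by
      rw [Measure.restrict_apply hE, Measure.restrict_apply hE]
      exact measure_le_mul_of_sphericalFedererDensity_lt hα.le hS hc fun x hx => h x hx.1)
    (fun c hc E hE h => by
      rw [Measure.restrict_apply hE, Measure.restrict_apply hE]
      exact mul_measure_le_of_lt_sphericalFedererDensity hα hS hc fun x hx => h x hx.1)
  rw [← Measure.restrict_eq_self μ hBA, hdens, withDensity_apply _ hB,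
    Measure.restrict_restrict hB, inter_eq_left.2 hBA]
end

section
/- Let E be a real inner product space of finite dimension n ≥ 2, let C ⊆ E be a compact convex set with nonempty interior which is centrally symmetric (C = −C), let v ∈ E \ {0} and let N = {w ∈ E : ⟨w,v⟩ = 0}. Then for every t ∈ ℝ, H^{n−1}(C ∩ (t·v + N)) ≤ H^{n−1}(C ∩ N); that is, among all sections of C by hyperplanes parallel to N, the central section C ∩ N has maximal (n−1)-dimensional Hausdorff measure. -/
open MeasureTheory Metric Set
open scoped Pointwise RealInnerProductSpace ENNReal Topology

/-- The midpoint Prékopa–Leindler inequality for a measure on a real vector space. -/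
def PrekopaLeindler {F : Type*} [AddCommGroup F] [Module ℝ F] [MeasurableSpace F]
    (μ : Measure F) : Prop :=
  ∀ f g h : F → ℝ≥0∞, Measurable f → Measurable g → Measurable h →
    (∀ x y, f x * g y ≤ h ((2⁻¹ : ℝ) • (x + y)) ^ 2) →
    (∫⁻ x, f x ∂μ) * (∫⁻ x, g x ∂μ) ≤ (∫⁻ x, h x ∂μ) ^ 2

theorem ENNReal.mul_le_sq_of_add_le_two_mul_s5 {p q r : ℝ≥0∞} (h : p + q ≤ 2 * r) :
    p * q ≤ r ^ 2 := by
  rcases eq_or_ne r ∞ with rfl | hr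
  · simp
  have hs : p + q ≠ ∞ := ne_top_of_le_ne_top (ENNReal.mul_ne_top ENNReal.ofNat_ne_top hr) h
  rw [ENNReal.add_ne_top] at hs
  lift p to NNReal using hs.1
  lift q to NNReal using hs.2
  lift r to NNReal using hr
  norm_cast at h ⊢
  rw [← NNReal.coe_le_coe] at h ⊢
  push_cast at h ⊢
  nlinarith [sq_nonneg ((p : ℝ) - q), p.coe_nonneg, q.coe_nonneg, r.coe_nonneg]

theorem Real.volume_preimage_two_mul_sub (s : Set ℝ) (b : ℝ) :
    2 * volume ((fun z : ℝ => 2 * z - b) ⁻¹' s) = volume s := by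
  have h : (fun z : ℝ => 2 * z - b) ⁻¹' s = (fun z => 2 * z) ⁻¹' ((fun z => z - b) ⁻¹' s) := rfl
  rw [h, Real.volume_preimage_mul_left two_ne_zero,
    show volume ((fun z => z - b) ⁻¹' s) = volume s from measure_preimage_add_right volume (-b) s,
    ← mul_assoc]
  have : (2 : ℝ≥0∞) = ENNReal.ofReal 2 := by simp
  rw [this, ← ENNReal.ofReal_mul zero_le_two]
  norm_num

theorem IsCompact.volume_add_volume_le_two_mul {K L S : Set ℝ} (hK : IsCompact K)
    (hL : IsCompact L) (hKne : K.Nonempty) (hLne : L.Nonempty)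
    (h : ∀ x ∈ K, ∀ y ∈ L, 2⁻¹ * (x + y) ∈ S) :
    volume K + volume L ≤ 2 * volume S := by
  obtain ⟨a, ha, hmax⟩ := hK.exists_isGreatest hKne
  obtain ⟨b, hb, hmin⟩ := hL.exists_isLeast hLne
  set K' := (fun z : ℝ => 2 * z - b) ⁻¹' K
  set L' := (fun z : ℝ => 2 * z - a) ⁻¹' L
  have hsub : K' ∪ L' ⊆ S := by
    rintro z (hz | hz)
    · convert h _ hz _ hb using 1; ring
    · convert h _ ha _ hz using 1; ring
  have hdisj : AEDisjoint volume K' L' := by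
    refine measure_mono_null (t := {2⁻¹ * (a + b)}) ?_ (measure_singleton _)
    rintro z ⟨hz₁, hz₂⟩
    have h₁ := hmax hz₁
    have h₂ := hmin hz₂
    simp only [Set.mem_singleton_iff]
    linarith
  have hL' : MeasurableSet L' := hL.measurableSet.preimage (by fun_prop)
  rw [← Real.volume_preimage_two_mul_sub K b, ← Real.volume_preimage_two_mul_sub L a, ← mul_add,
    ← measure_union₀ hL'.nullMeasurableSet hdisj]
  gcongr

/-- One-dimensional Brunn–Minkowski inequality, stated with midpoints. -/
theorem Real.volume_add_volume_le_two_mul {A B S : Set ℝ} (hA : MeasurableSet A)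
    (hB : MeasurableSet B) (hAne : A.Nonempty) (hBne : B.Nonempty)
    (h : ∀ x ∈ A, ∀ y ∈ B, 2⁻¹ * (x + y) ∈ S) :
    volume A + volume B ≤ 2 * volume S := by
  obtain ⟨x, hx⟩ := hAne
  obtain ⟨y, hy⟩ := hBne
  rw [hA.measure_eq_iSup_isCompact, hB.measure_eq_iSup_isCompact]
  simp only [iSup_and']
  refine ENNReal.biSup_add_biSup_le' ⟨∅, empty_subset A, isCompact_empty⟩
    ⟨∅, empty_subset B, isCompact_empty⟩ fun K ⟨hKA, hK⟩ L ⟨hLB, hL⟩ => ?_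
  have key := (hK.insert x).volume_add_volume_le_two_mul (hL.insert y) (insert_nonempty x K)
    (insert_nonempty y L) fun _ hx' _ hy' =>
      h _ (insert_subset hx hKA hx') _ (insert_subset hy hLB hy')
  refine le_trans ?_ key
  gcongr
  · exact subset_insert x K
  · exact subset_insert y L

theorem lintegral_eq_lintegral_meas_ofReal_lt {α : Type*} [MeasurableSpace α] (μ : Measure α)
    {f : α → ℝ≥0∞} (hf : Measurable f) (hf1 : ∀ x, f x ≤ 1) :
    ∫⁻ x, f x ∂μ = ∫⁻ t in Ioo (0 : ℝ) 1, μ {x | ENNReal.ofReal t < f x} := by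
  have hfin : ∀ x, f x ≠ ∞ := fun x => ne_top_of_le_ne_top ENNReal.one_ne_top (hf1 x)
  have key := lintegral_eq_lintegral_meas_lt (f := fun x => (f x).toReal) μ
    (Filter.Eventually.of_forall fun _ => ENNReal.toReal_nonneg) hf.ennreal_toReal.aemeasurable
  simp only [ENNReal.ofReal_toReal (hfin _)] at key
  have hset : ∀ t ∈ Ioi (0 : ℝ), μ {x | t < (f x).toReal} =
      (Ioo (0 : ℝ) 1).indicator (fun t => μ {x | ENNReal.ofReal t < f x}) t := by
    intro t ht
    by_cases ht1 : t < 1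
    · rw [indicator_of_mem (show t ∈ Ioo (0 : ℝ) 1 from ⟨ht, ht1⟩)]
      simp only [ENNReal.ofReal_lt_iff_lt_toReal (le_of_lt ht) (hfin _)]
    · rw [indicator_of_notMem fun h => ht1 h.2]
      convert measure_empty (μ := μ)
      ext x
      have := ENNReal.toReal_mono ENNReal.one_ne_top (hf1 x)
      simp only [ENNReal.toReal_one] at this
      simp only [mem_ofPred_eq, mem_empty_iff_false, iff_false, not_lt]
      linarith [not_lt.1 ht1]
  rw [key, setLIntegral_congr_fun measurableSet_Ioi hset, lintegral_indicator measurableSet_Ioo,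
    Measure.restrict_restrict measurableSet_Ioo, inter_eq_left.2 Ioo_subset_Ioi_self]

theorem Real.lintegral_add_lintegral_le_of_iSup_eq_one {f g h : ℝ → ℝ≥0∞} (hf : Measurable f)
    (hg : Measurable g) (hh : Measurable h) (hf1 : ⨆ x, f x = 1) (hg1 : ⨆ x, g x = 1)
    (H : ∀ x y, f x * g y ≤ h (2⁻¹ * (x + y)) ^ 2) :
    (∫⁻ x, f x) + (∫⁻ x, g x) ≤ 2 * ∫⁻ x, h x := by
  have hfle : ∀ x, f x ≤ 1 := fun x => hf1 ▸ le_iSup f x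
  have hgle : ∀ x, g x ≤ 1 := fun x => hg1 ▸ le_iSup g x
  have hmono : Antitone fun t : ℝ => volume {x | ENNReal.ofReal t < f x} := fun s t hst =>
    measure_mono fun x hx => (ENNReal.ofReal_le_ofReal hst).trans_lt hx
  calc (∫⁻ x, f x) + (∫⁻ x, g x)
      = ∫⁻ t in Ioo (0 : ℝ) 1, (volume {x | ENNReal.ofReal t < f x} +
          volume {x | ENNReal.ofReal t < g x}) := by
        rw [lintegral_eq_lintegral_meas_ofReal_lt _ hf hfle,
          lintegral_eq_lintegral_meas_ofReal_lt _ hg hgle, lintegral_add_left hmono.measurable]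
    _ ≤ ∫⁻ t in Ioo (0 : ℝ) 1, 2 * volume {x | ENNReal.ofReal t < min (h x) 1} := by
        refine setLIntegral_mono' measurableSet_Ioo fun t ht => ?_
        have ht1 : ENNReal.ofReal t < 1 := by simpa using ht.2
        refine Real.volume_add_volume_le_two_mul (measurableSet_lt measurable_const hf)
          (measurableSet_lt measurable_const hg) (lt_iSup_iff.1 (ht1.trans_eq hf1.symm))
          (lt_iSup_iff.1 (ht1.trans_eq hg1.symm)) fun x hx y hy => lt_min ?_ ht1
        refine lt_of_pow_lt_pow_left' 2 (lt_of_lt_of_le ?_ (H x y))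
        rw [sq]
        exact ENNReal.mul_lt_mul hx hy
    _ = 2 * ∫⁻ x, min (h x) 1 := by
        rw [lintegral_const_mul' _ _ ENNReal.ofNat_ne_top,
          lintegral_eq_lintegral_meas_ofReal_lt _ (hh.min measurable_const)
            fun x => min_le_right _ _]
    _ ≤ 2 * ∫⁻ x, h x := by
        gcongr
        exact min_le_left _ _

theorem Real.lintegral_mul_lintegral_le_of_iSup_ne_top {f g h : ℝ → ℝ≥0∞} (hf : Measurable f)
    (hg : Measurable g) (hh : Measurable h) (hftop : ⨆ x, f x ≠ ∞) (hgtop : ⨆ x, g x ≠ ∞)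
    (H : ∀ x y, f x * g y ≤ h (2⁻¹ * (x + y)) ^ 2) :
    (∫⁻ x, f x) * (∫⁻ x, g x) ≤ (∫⁻ x, h x) ^ 2 := by
  set a := ⨆ x, f x with ha
  set b := ⨆ x, g x with hb
  rcases eq_or_ne a 0 with ha0 | ha0
  · simp [show f = 0 from funext fun x => le_zero_iff.1 (ha0 ▸ le_iSup f x)]
  rcases eq_or_ne b 0 with hb0 | hb0
  · simp [show g = 0 from funext fun x => le_zero_iff.1 (hb0 ▸ le_iSup g x)]
  set c := (a * b) ^ (2⁻¹ : ℝ)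
  have hc : c ^ 2 = a * b := by
    rw [← ENNReal.rpow_natCast, ← ENNReal.rpow_mul]; simp
  have hab0 : a * b ≠ 0 := mul_ne_zero ha0 hb0
  have habtop : a * b ≠ ∞ := ENNReal.mul_ne_top hftop hgtop
  have key := ENNReal.mul_le_sq_of_add_le_two_mul_s5 <|
    Real.lintegral_add_lintegral_le_of_iSup_eq_one (f := fun x => a⁻¹ * f x)
      (g := fun x => b⁻¹ * g x) (h := fun x => c⁻¹ * h x)
      (hf.const_mul _) (hg.const_mul _) (hh.const_mul _)
      (by rw [← ENNReal.mul_iSup, ENNReal.inv_mul_cancel ha0 hftop])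
      (by rw [← ENNReal.mul_iSup, ENNReal.inv_mul_cancel hb0 hgtop])
      (fun x y => by
        rw [mul_mul_mul_comm, mul_pow, ← ENNReal.inv_pow, hc,
          ENNReal.mul_inv (Or.inl ha0) (Or.inl hftop)]
        gcongr
        exact H x y)
  rw [lintegral_const_mul _ hf, lintegral_const_mul _ hg, lintegral_const_mul _ hh,
    mul_mul_mul_comm, mul_pow, ← ENNReal.inv_pow, hc,
    ← ENNReal.mul_inv (Or.inl ha0) (Or.inl hftop)] at key
  exact (ENNReal.mul_le_mul_iff_right (ENNReal.inv_ne_zero.2 habtop)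
    (ENNReal.inv_ne_top.2 hab0)).1 key

theorem lintegral_eq_iSup_lintegral_min_natCast {α : Type*} [MeasurableSpace α] (μ : Measure α)
    {f : α → ℝ≥0∞} (hf : Measurable f) :
    ∫⁻ x, f x ∂μ = ⨆ n : ℕ, ∫⁻ x, min (f x) n ∂μ := by
  rw [← lintegral_iSup (fun n => hf.min measurable_const)
    (fun m n hmn x => min_le_min_left _ (Nat.cast_le.2 hmn))]
  congr with x
  rw [← inf_iSup_eq, ENNReal.iSup_natCast, inf_top_eq]

namespace PrekopaLeindler

theorem volume_real : PrekopaLeindler (volume : Measure ℝ) := by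
  intro f g h hf hg hh H
  rw [lintegral_eq_iSup_lintegral_min_natCast _ hf, lintegral_eq_iSup_lintegral_min_natCast _ hg]
  simp only [ENNReal.iSup_mul, ENNReal.mul_iSup, iSup_le_iff]
  exact fun m n => Real.lintegral_mul_lintegral_le_of_iSup_ne_top (hf.min measurable_const)
    (hg.min measurable_const) hh
    (ne_top_of_le_ne_top (ENNReal.natCast_ne_top _) (iSup_le fun _ => min_le_right _ _))
    (ne_top_of_le_ne_top (ENNReal.natCast_ne_top _) (iSup_le fun _ => min_le_right _ _))
    fun x y => (mul_le_mul' (min_le_left _ _) (min_le_left _ _)).trans (H x y)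

variable {F G : Type*} [AddCommGroup F] [Module ℝ F] [MeasurableSpace F]
  [AddCommGroup G] [Module ℝ G] [MeasurableSpace G] {μ : Measure F} {ν : Measure G}

theorem prod [SFinite ν] (hμ : PrekopaLeindler μ) (hν : PrekopaLeindler ν) :
    PrekopaLeindler (μ.prod ν) := by
  intro f g h hf hg hh H
  rw [lintegral_prod _ hf.aemeasurable, lintegral_prod _ hg.aemeasurable,
    lintegral_prod _ hh.aemeasurable]
  exact hμ _ _ _ hf.lintegral_prod_right' hg.lintegral_prod_right' hh.lintegral_prod_right'
    fun x y => hν _ _ _ (hf.comp measurable_prodMk_left) (hg.comp measurable_prodMk_left)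
      (hh.comp measurable_prodMk_left) fun z w => H (x, z) (y, w)

theorem map (hμ : PrekopaLeindler μ) (L : F →ₗ[ℝ] G) (hL : Measurable L) :
    PrekopaLeindler (μ.map L) := by
  intro f g h hf hg hh H
  rw [lintegral_map hf hL, lintegral_map hg hL, lintegral_map hh hL]
  refine hμ _ _ _ (hf.comp hL) (hg.comp hL) (hh.comp hL) fun x y => ?_
  simpa using H (L x) (L y)

theorem smul (hμ : PrekopaLeindler μ) (c : NNReal) : PrekopaLeindler (c • μ) := by
  intro f g h hf hg hh H
  simp only [lintegral_smul_measure, ENNReal.smul_def, smul_eq_mul]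
  rw [mul_mul_mul_comm, mul_pow, ← sq]
  gcongr
  exact hμ f g h hf hg hh H

theorem volume_pi (d : ℕ) : PrekopaLeindler (volume : Measure (Fin d → ℝ)) := by
  induction d with
  | zero =>
    intro f g h hf hg hh H
    have H₀ := H 0 0
    rw [Subsingleton.elim ((2⁻¹ : ℝ) • (0 + 0) : Fin 0 → ℝ) 0] at H₀
    simpa only [Measure.volume_pi_eq_dirac 0, lintegral_dirac' _ hf, lintegral_dirac' _ hg,
      lintegral_dirac' _ hh] using H₀
  | succ d ih =>
    have hcons : ⇑(MeasurableEquiv.piFinSuccAbove (fun _ : Fin (d + 1) => ℝ) 0).symm =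
        Fin.consLinearEquiv ℝ fun _ => ℝ := by
      ext x i
      refine Fin.cases ?_ (fun j => ?_) i <;> rfl
    have e := (volume_preserving_piFinSuccAbove (fun _ : Fin (d + 1) => ℝ) 0).symm
    rw [hcons] at e
    rw [← e.map_eq]
    exact (volume_real.prod ih).map (Fin.consLinearEquiv ℝ fun _ => ℝ).toLinearMap e.measurable

theorem of_isAddHaarMeasure {F : Type*} [NormedAddCommGroup F] [NormedSpace ℝ F]
    [FiniteDimensional ℝ F] [MeasurableSpace F] [BorelSpace F] (μ : Measure F)
    [μ.IsAddHaarMeasure] : PrekopaLeindler μ := by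
  let L : (Fin (Module.finrank ℝ F) → ℝ) ≃L[ℝ] F :=
    ContinuousLinearEquiv.ofFinrankEq (by simp)
  have := L.isAddHaarMeasure_map volume
  rw [Measure.isAddLeftInvariant_eq_smul μ (volume.map L)]
  exact ((volume_pi _).map L.toLinearMap L.continuous.measurable).smul _

/-- Multiplicative Brunn–Minkowski inequality. -/
theorem measure_mul_measure_le_sq (hμ : PrekopaLeindler μ) {A B S : Set F}
    (hA : MeasurableSet A) (hB : MeasurableSet B) (hS : MeasurableSet S)
    (H : ∀ x ∈ A, ∀ y ∈ B, (2⁻¹ : ℝ) • (x + y) ∈ S) :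
    μ A * μ B ≤ μ S ^ 2 := by
  have key := hμ (A.indicator 1) (B.indicator 1) (S.indicator 1) (measurable_one.indicator hA)
    (measurable_one.indicator hB) (measurable_one.indicator hS) fun x y => by
      by_cases hx : x ∈ A
      · by_cases hy : y ∈ B
        · rw [indicator_of_mem hx, indicator_of_mem hy, indicator_of_mem (H x hx y hy)]
          simp
        · simp [hy]
      · simp [hx]
  simpa only [lintegral_indicator_one, hA, hB, hS] using key

end PrekopaLeindler

/-- For a centrally symmetric compact convex body `C` in an `n`-dimensional real inner
product space (`n ≥ 2`) and `v ≠ 0` with orthogonal hyperplane `N = {w | ⟪w, v⟫ = 0}`,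
the central section maximizes the `(n-1)`-dimensional Hausdorff measure among all
sections of `C` by hyperplanes parallel to `N`:
`H^{n-1}(C ∩ (t • v +ᵥ N)) ≤ H^{n-1}(C ∩ N)` for all `t ∈ ℝ`. -/
theorem central_section_maximal
    {E : Type*} [NormedAddCommGroup E] [InnerProductSpace ℝ E]
    [FiniteDimensional ℝ E] [MeasurableSpace E] [BorelSpace E]
    (n : ℕ) (hn : Module.finrank ℝ E = n) (hn2 : 2 ≤ n)
    (C : Set E) (hCcomp : IsCompact C) (hCconv : Convex ℝ C)
    (hCint : (interior C).Nonempty) (hCsym : C = -C)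
    (v : E) (hv : v ≠ 0) :
    ∀ t : ℝ,
      μH[(n : ℝ) - 1] (C ∩ (t • v +ᵥ {w : E | ⟪w, v⟫ = 0})) ≤
        μH[(n : ℝ) - 1] (C ∩ {w : E | ⟪w, v⟫ = 0}) := by
  subst hn
  intro t
  let N : Submodule ℝ E := (ℝ ∙ v)ᗮ
  have hN : {w : E | ⟪w, v⟫ = 0} = (N : Set E) := by
    ext w
    simp [N, Submodule.mem_orthogonal_singleton_iff_inner_left]
  have hdim : (Module.finrank ℝ E : ℝ) - 1 = (Module.finrank ℝ N : ℝ) := by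
    have : Fact (Module.finrank ℝ E = (Module.finrank ℝ E - 1) + 1) := ⟨by omega⟩
    rw [Submodule.finrank_orthogonal_span_singleton (n := Module.finrank ℝ E - 1) hv,
      Nat.cast_sub (by omega), Nat.cast_one]
  rw [hN, hdim]
  set d := Module.finrank ℝ N
  have hd : (0 : ℝ) ≤ d := Nat.cast_nonneg d
  let A : Set N := {w | t • v + (w : E) ∈ C}
  let S : Set N := {w | (w : E) ∈ C}
  have hA : MeasurableSet A :=
    (hCcomp.isClosed.preimage (by fun_prop : Continuous fun w : N => t • v + (w : E))).measurableSet
  have hS : MeasurableSet S := (hCcomp.isClosed.preimage continuous_subtype_val).measurableSet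
  have hCneg : ∀ x ∈ C, -x ∈ C := fun x hx => by
    rw [hCsym] at hx
    exact hx
  have hsecS : C ∩ N = N.subtypeₗᵢ '' S := by
    ext x
    simp [S, and_comm]
  have hsecA : C ∩ (t • v +ᵥ (N : Set E)) = t • v +ᵥ (N.subtypeₗᵢ '' A) := by
    ext x
    simp only [mem_inter_iff, mem_vadd_set, mem_image, vadd_eq_add]
    constructor
    · rintro ⟨hx, w, hw, rfl⟩
      exact ⟨w, ⟨⟨w, hw⟩, hx, rfl⟩, rfl⟩
    · rintro ⟨_, ⟨w, hw, rfl⟩, rfl⟩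
      exact ⟨hw, w, w.2, rfl⟩
  rw [hsecA, hsecS, hausdorffMeasure_vadd _ (Or.inl hd),
    N.subtypeₗᵢ.isometry.hausdorffMeasure_image (Or.inl hd),
    N.subtypeₗᵢ.isometry.hausdorffMeasure_image (Or.inl hd)]
  have hHaar : (μH[d] : Measure N).IsAddHaarMeasure := isAddHaarMeasure_hausdorffMeasure
  have key := (PrekopaLeindler.of_isAddHaarMeasure (μH[d] : Measure N)).measure_mul_measure_le_sq
    hA hA.neg hS fun x hx y hy => by
      have hy' := hCneg _ hy
      have := hCconv hx hy' (by norm_num : (0 : ℝ) ≤ 2⁻¹) (by norm_num : (0 : ℝ) ≤ 2⁻¹)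
        (by norm_num)
      have heq : (((2⁻¹ : ℝ) • (x + y) : N) : E) =
          (2⁻¹ : ℝ) • (t • v + (x : E)) + (2⁻¹ : ℝ) • -(t • v + ((-y : N) : E)) := by
        simp only [Submodule.coe_smul, Submodule.coe_add, Submodule.coe_neg]
        module
      exact (congrArg (· ∈ C) heq).mpr this
  rw [Measure.measure_neg, ← sq] at key
  exact (ENNReal.pow_le_pow_left_iff two_ne_zero).1 key
end

section
/- Let E be a real inner product space of finite dimension n ≥ 2, let Ω ⊆ E be open, let f : Ω → ℝ be continuously Fréchet differentiable, and let x ∈ Ω satisfy f(x) = 0. Let v ∈ E with Df(x)(v) ≠ 0, let N = ker Df(x), let V be a neighborhood of 0 in N, and let φ : V → ℝ be a continuous function with φ(0) = 0 such that x + w + φ(w)·v ∈ Ω and f(x + w + φ(w)·v) = 0 for every w ∈ V. Then for every w ∈ N, lim_{t→0⁺} φ(t·w)/t = 0. (This is the delicate directional differentiability of the merely continuous implicit function at the base point, used in the upper blow-up theorem.) -/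
open MeasureTheory Metric Set Filter
open scoped RealInnerProductSpace Topology

/-- Directional differentiability at the base point of the merely continuous implicit
function (used in the upper blow-up theorem): let `E` be an `n`-dimensional real inner
product space (`n ≥ 2`), `f : Ω → ℝ` continuously Fréchet differentiable on the open
set `Ω`, `x ∈ Ω` with `f x = 0`, `v` with `Df(x)(v) ≠ 0`, `N = ker Df(x)`, `V` a
relatively open neighborhood of `0` in `N` and `φ : V → ℝ` continuous with `φ 0 = 0`
such that `x + w + φ(w) • v ∈ Ω` and `f(x + w + φ(w) • v) = 0` for all `w ∈ V`. Then
for every `w ∈ N`, `φ(t • w)/t → 0` as `t → 0⁺`. -/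
theorem implicit_function_directional_limit
    {E : Type*} [NormedAddCommGroup E] [InnerProductSpace ℝ E]
    [FiniteDimensional ℝ E]
    (n : ℕ) (hn : Module.finrank ℝ E = n) (hn2 : 2 ≤ n)
    (Ω : Set E) (hΩ : IsOpen Ω)
    (f : E → ℝ) (hf : ContDiffOn ℝ 1 f Ω)
    (x : E) (hxΩ : x ∈ Ω) (hfx : f x = 0)
    (v : E) (hv : fderiv ℝ f x v ≠ 0)
    (V : Set E) (hVN : V ⊆ {w : E | fderiv ℝ f x w = 0})
    (hV : V ∈ 𝓝[{w : E | fderiv ℝ f x w = 0}] 0)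
    (φ : E → ℝ) (hφ : ContinuousOn φ V) (hφ0 : φ 0 = 0)
    (hgraph : ∀ w ∈ V, x + w + φ w • v ∈ Ω ∧ f (x + w + φ w • v) = 0) :
    ∀ w ∈ {w : E | fderiv ℝ f x w = 0},
      Tendsto (fun t : ℝ => φ (t • w) / t) (𝓝[>] 0) (𝓝 0) := by
  intro w hw
  set N : Set E := {w : E | fderiv ℝ f x w = 0} with hN
  have h0N : (0 : E) ∈ N := map_zero (fderiv ℝ f x)
  have h0V : (0 : E) ∈ V := mem_of_mem_nhdsWithin h0N hV
  have hsmul : Tendsto (fun t : ℝ => t • w) (𝓝[>] 0) (𝓝 0) := by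
    have h : Tendsto (fun t : ℝ => t • w) (𝓝 0) (𝓝 ((0 : ℝ) • w)) :=
      (continuous_id.smul continuous_const).tendsto 0
    rw [zero_smul] at h
    exact h.mono_left nhdsWithin_le_nhds
  have hker (t : ℝ) : fderiv ℝ f x (t • w) = 0 := by
    rw [map_smul, show fderiv ℝ f x w = 0 from hw, smul_zero]
  have hsmulN : Tendsto (fun t : ℝ => t • w) (𝓝[>] 0) (𝓝[N] 0) :=
    tendsto_nhdsWithin_iff.2 ⟨hsmul, Eventually.of_forall hker⟩
  have hmemV : ∀ᶠ t : ℝ in 𝓝[>] 0, t • w ∈ V := hsmulN hV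
  have hφlim : Tendsto (fun t : ℝ => φ (t • w)) (𝓝[>] 0) (𝓝 0) := by
    have h := (hφ 0 h0V).tendsto.comp (tendsto_nhdsWithin_iff.2 ⟨hsmul, hmemV⟩)
    rwa [hφ0] at h
  have hincr : Tendsto (fun t : ℝ => t • w + φ (t • w) • v) (𝓝[>] 0) (𝓝 0) := by
    simpa using hsmul.add (hφlim.smul_const v)
  have hd : HasFDerivAt f (fderiv ℝ f x) x :=
    ((hf.contDiffAt (hΩ.mem_nhds hxΩ)).differentiableAt one_ne_zero).hasFDerivAt
  have hrem : (fun t : ℝ => φ (t • w) * fderiv ℝ f x v)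
      =o[𝓝[>] 0] fun t : ℝ => t • w + φ (t • w) • v := by
    refine (((hasFDerivAt_iff_isLittleO_nhds_zero.1 hd).comp_tendsto hincr).neg_left).congr'
      ?_ EventuallyEq.rfl
    filter_upwards [hmemV] with t ht
    have hzero := (hgraph _ ht).2
    rw [add_assoc] at hzero
    simp only [Function.comp_apply, hzero, hfx, map_add, hker, map_smul, smul_eq_mul]
    ring
  have hφo : (fun t : ℝ => φ (t • w)) =o[𝓝[>] 0] fun t : ℝ => t • w + φ (t • w) • v := by
    refine (hrem.const_mul_left (fderiv ℝ f x v)⁻¹).congr_left fun t => ?_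
    field_simp
  have hφv : (fun t : ℝ => φ (t • w) • v) =o[𝓝[>] 0] fun t : ℝ => t • w + φ (t • w) • v := by
    refine Asymptotics.IsBigO.trans_isLittleO ?_ hφo
    exact Asymptotics.IsBigO.of_bound ‖v‖ (Eventually.of_forall fun t => by
      rw [norm_smul, mul_comm])
  have hlin : (fun t : ℝ => t • w) =O[𝓝[>] 0] fun t : ℝ => t :=
    Asymptotics.IsBigO.of_bound ‖w‖ (Eventually.of_forall fun t => by
      rw [norm_smul, mul_comm])
  have hO : (fun t : ℝ => t • w + φ (t • w) • v) =O[𝓝[>] 0] fun t : ℝ => t :=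
    (hφv.right_isBigO_sub.congr_right fun t => add_sub_cancel_right _ _).trans hlin
  exact (hφo.trans_isBigO hO).tendsto_div_nhds_zero
end

section
/- Let E be a real inner product space of finite dimension n ≥ 2 and let ‖·‖ be an arbitrary norm on E with unit ball C = {z ∈ E : ‖z‖ ≤ 1} and closed balls B̄(y,t) = y + t·C. Let Ω ⊆ E be open, f : Ω → ℝ continuously Fréchet differentiable with Df(x) ≠ 0 for all x ∈ Ω, Σ = {x ∈ Ω : f(x) = 0}, and ν(x) = ∇f(x)/|∇f(x)|. Then for every x ∈ Σ, the centered density exists and lim_{r→0⁺} H^{n−1}(Σ ∩ B̄(x,r)) / r^{n−1} = H^{n−1}(C ∩ N(ν(x))), where N(ν(x)) = {w ∈ E : ⟨w, ν(x)⟩ = 0}. (This is the centered blow-up of the perimeter measure of a parametrized regular hypersurface, in the abelian instance; combined with the upper blow-up it shows that the Federer density and the centered density coincide when the unit ball is convex.) -/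
open MeasureTheory Metric Set Filter
open scoped Pointwise RealInnerProductSpace ENNReal Topology

section NormComparison

variable {E : Type*} [NormedAddCommGroup E] [InnerProductSpace ℝ E]

/-- On a nontrivial finite-dimensional space, a definite seminorm dominates the norm. -/
theorem Seminorm.exists_norm_le_mul_of_definite [FiniteDimensional ℝ E] [Nontrivial E]
    (N : Seminorm ℝ E) (hN : ∀ z, N z = 0 → z = 0) :
    ∃ c : ℝ, 0 < c ∧ ∀ z, ‖z‖ ≤ c * N z := by
  have hcont : Continuous N := N.convexOn.locallyLipschitz.continuous
  obtain ⟨z₀, hz₀, hmin⟩ := (isCompact_sphere (0 : E) 1).exists_isMinOn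
    (NormedSpace.sphere_nonempty.2 zero_le_one) hcont.continuousOn
  have hz₀' : ‖z₀‖ = 1 := by simpa using hz₀
  have hpos : 0 < N z₀ := by
    refine lt_of_le_of_ne (apply_nonneg N _) fun h => ?_
    rw [hN z₀ h.symm] at hz₀'
    simp at hz₀'
  refine ⟨(N z₀)⁻¹, inv_pos.2 hpos, fun z => ?_⟩
  rcases eq_or_ne z 0 with rfl | hz
  · simp
  have hnz : 0 < ‖z‖ := norm_pos_iff.2 hz
  have h := hmin (show ‖z‖⁻¹ • z ∈ sphere (0 : E) 1 by
    simp [norm_smul, hnz.ne'])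
  simp only [mem_ofPred_eq, map_smul_eq_mul, norm_inv, norm_norm] at h
  rw [inv_mul_eq_div, le_div_iff₀ hnz] at h
  rw [inv_mul_eq_div, le_div_iff₀ hpos]
  linarith

/-- Closed balls of a seminorm intersected with a hyperplane scale linearly. -/
theorem Seminorm.smul_unitBall_inter_hyperplane (N : Seminorm ℝ E) (ν : E) {t : ℝ} (ht : 0 < t) :
    t • ({z | N z ≤ 1} ∩ {w | ⟪w, ν⟫ = 0}) = {w | N w ≤ t ∧ ⟪w, ν⟫ = 0} := by
  ext w
  rw [mem_smul_set_iff_inv_smul_mem₀ ht.ne']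
  simp only [mem_inter_iff, mem_ofPred_eq, map_smul_eq_mul, norm_inv, Real.norm_of_nonneg ht.le,
    real_inner_smul_left, mul_eq_zero, inv_eq_zero, ht.ne', false_or]
  rw [inv_mul_le_iff₀ ht, mul_one]

end NormComparison

section HyperplaneProjection

variable {E : Type*} [NormedAddCommGroup E] [InnerProductSpace ℝ E]

/-- The map `v ↦ v - ⟪v, ν⟫ ν`: for a unit vector `ν`, the orthogonal projection onto `ν^⊥`. -/
def hyperplaneProj (ν v : E) : E := v - ⟪v, ν⟫ • ν

theorem hyperplaneProj_sub (ν v w : E) :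
    hyperplaneProj ν (v - w) = hyperplaneProj ν v - hyperplaneProj ν w := by
  simp only [hyperplaneProj, inner_sub_left, sub_smul]
  abel

theorem inner_hyperplaneProj {ν : E} (hν : ‖ν‖ = 1) (v : E) : ⟪hyperplaneProj ν v, ν⟫ = 0 := by
  simp [hyperplaneProj, inner_sub_left, real_inner_smul_left, hν]

theorem norm_hyperplaneProj_le {ν : E} (hν : ‖ν‖ = 1) (v : E) : ‖hyperplaneProj ν v‖ ≤ ‖v‖ := by
  refine abs_le_of_sq_le_sq' ?_ (norm_nonneg _) |>.2
  rw [hyperplaneProj, @norm_sub_sq_real, real_inner_smul_right, norm_smul, hν, mul_one,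
    Real.norm_eq_abs, sq_abs]
  nlinarith [sq_nonneg ⟪v, ν⟫]

theorem norm_le_norm_hyperplaneProj_add {ν : E} (hν : ‖ν‖ = 1) (v : E) :
    ‖v‖ ≤ ‖hyperplaneProj ν v‖ + |⟪v, ν⟫| := by
  have h : v = hyperplaneProj ν v + ⟪v, ν⟫ • ν := by simp [hyperplaneProj]
  calc ‖v‖ = ‖hyperplaneProj ν v + ⟪v, ν⟫ • ν‖ := by rw [← h]
    _ ≤ _ := by
      refine (norm_add_le _ _).trans ?_
      rw [norm_smul, hν, mul_one, Real.norm_eq_abs]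

theorem lipschitzWith_hyperplaneProj_sub {ν : E} (hν : ‖ν‖ = 1) (x : E) :
    LipschitzWith 1 fun p => hyperplaneProj ν (p - x) := by
  refine LipschitzWith.of_dist_le_mul fun p q => ?_
  rw [dist_eq_norm, dist_eq_norm, ← hyperplaneProj_sub, sub_sub_sub_cancel_right, NNReal.coe_one,
    one_mul]
  exact norm_hyperplaneProj_le hν _

end HyperplaneProjection

/-- A map that contracts distances on `S` by at most the factor `K` controls the Hausdorff measure
of `S` by that of its image. -/
theorem hausdorffMeasure_le_image_of_dist_le {X Y : Type*} [MetricSpace X] [MeasurableSpace X]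
    [BorelSpace X] [MetricSpace Y] [MeasurableSpace Y] [BorelSpace Y] {φ : X → Y} {S : Set X}
    {K : NNReal} (h : ∀ p ∈ S, ∀ q ∈ S, dist p q ≤ K * dist (φ p) (φ q)) {d : ℝ} (hd : 0 ≤ d) :
    μH[d] S ≤ (K : ℝ≥0∞) ^ d * μH[d] (φ '' S) := by
  rcases S.eq_empty_or_nonempty with rfl | ⟨x₀, -⟩
  · simp
  have : Nonempty X := ⟨x₀⟩
  have hinj : InjOn φ S := fun p hp q hq hpq => by
    have := h p hp q hq
    rw [hpq, dist_self, mul_zero] at this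
    exact dist_le_zero.1 this
  have hleft := hinj.leftInvOn_invFunOn
  have hlip : LipschitzOnWith K (Function.invFunOn φ S) (φ '' S) := by
    refine LipschitzOnWith.of_dist_le_mul ?_
    rintro _ ⟨p, hp, rfl⟩ _ ⟨q, hq, rfl⟩
    rw [hleft hp, hleft hq]
    exact h p hp q hq
  have := hlip.hausdorffMeasure_image_le hd
  rwa [hleft.image_image] at this

section AlmostFlat

variable {E : Type*} [NormedAddCommGroup E] [InnerProductSpace ℝ E]

/-- If `F` is nearly the linear function `⟪·, ν⟫` near a zero `x`, then over each small vector of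
the hyperplane `ν^⊥` there is a zero of `F` at small height. -/
theorem exists_zero_over_hyperplane {F : E → ℝ} {x ν : E} {δ η : ℝ}
    (hν : ‖ν‖ = 1) (hη : 0 < η) (hη2 : η ≤ 1 / 2) (hFx : F x = 0)
    (hF : ∀ p ∈ ball x δ, ∀ q ∈ ball x δ, |F p - F q - ⟪p - q, ν⟫| ≤ η * ‖p - q‖)
    (hcont : ContinuousOn F (ball x δ)) {v : E} (hv : ⟪v, ν⟫ = 0) (hvδ : 2 * ‖v‖ < δ) :
    ∃ t : ℝ, |t| ≤ 2 * η * ‖v‖ ∧ x + (v + t • ν) ∈ ball x δ ∧ F (x + (v + t • ν)) = 0 := by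
  have hvn := norm_nonneg v
  set T := 2 * η * ‖v‖ with hT
  have hT0 : 0 ≤ T := by positivity
  have hTv : T ≤ ‖v‖ := by nlinarith
  have hnorm : ∀ t : ℝ, |t| ≤ T → ‖v + t • ν‖ ≤ ‖v‖ + T := fun t ht => by
    refine (norm_add_le _ _).trans ?_
    rw [norm_smul, hν, mul_one, Real.norm_eq_abs]
    linarith
  have hmem : ∀ t : ℝ, |t| ≤ T → x + (v + t • ν) ∈ ball x δ := fun t ht => by
    rw [mem_ball, dist_eq_norm, add_sub_cancel_left]
    linarith [hnorm t ht]
  have hx : x ∈ ball x δ := mem_ball_self (by linarith)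
  have hbound : ∀ t : ℝ, |t| ≤ T → |F (x + (v + t • ν)) - t| ≤ T := fun t ht => by
    have h := hF _ (hmem t ht) x hx
    rw [add_sub_cancel_left, hFx, sub_zero, inner_add_left, hv, real_inner_smul_left,
      real_inner_self_eq_norm_sq, hν, one_pow, mul_one, zero_add] at h
    nlinarith [hnorm t ht]
  have hc : ContinuousOn (fun t : ℝ => F (x + (v + t • ν))) (Icc (-T) T) :=
    hcont.comp (by fun_prop) fun t ht => hmem t (abs_le.2 ht)
  have hlo := abs_le.1 (hbound (-T) (by rw [abs_neg, abs_of_nonneg hT0]))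
  have hhi := abs_le.1 (hbound T (by rw [abs_of_nonneg hT0]))
  obtain ⟨t, ht, ht0⟩ := intermediate_value_Icc (neg_le_self hT0) hc
    (show (0 : ℝ) ∈ Icc _ _ from ⟨by linarith [hlo.2], by linarith [hhi.1]⟩)
  exact ⟨t, abs_le.2 ht, hmem t (abs_le.2 ht), ht0⟩

variable [MeasurableSpace E] [BorelSpace E]

/-- Upper estimate: an almost flat zero set in a seminorm ball has at most the measure of a slightly
larger flat section. -/
theorem hausdorffMeasure_zeroSet_le (N : Seminorm ℝ E) {F : E → ℝ} {x ν : E} {c δ η s r d : ℝ}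
    (hd : 0 ≤ d) (hν : ‖ν‖ = 1) (hη : 0 < η) (hc : ∀ z, ‖z‖ ≤ c * N z) (hFx : F x = 0)
    (hF : ∀ p ∈ ball x δ, ∀ q ∈ ball x δ, |F p - F q - ⟪p - q, ν⟫| ≤ η * ‖p - q‖)
    (hs : 0 < s) (hηs : 1 ≤ s * (1 - η)) (hηs' : 1 + η * c * N ν ≤ s) (hc0 : 0 < c)
    (hr : 0 < r) (hrδ : c * r < δ) {A : Set E} (hA : ∀ p ∈ A, F p = 0 ∧ N (p - x) ≤ r) :
    μH[d] A ≤ ENNReal.ofReal s ^ d *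
      (ENNReal.ofReal (s * r) ^ d * μH[d] ({z | N z ≤ 1} ∩ {w | ⟪w, ν⟫ = 0})) := by
  have hmem : ∀ p ∈ A, p ∈ ball x δ := fun p hp => by
    rw [mem_ball, dist_eq_norm]
    exact ((hc _).trans (mul_le_mul_of_nonneg_left (hA p hp).2 hc0.le)).trans_lt hrδ
  have hx : x ∈ ball x δ := mem_ball_self ((mul_pos hc0 hr).trans hrδ)
  have hheight : ∀ p ∈ A, ∀ q ∈ ball x δ, F q = 0 → |⟪p - q, ν⟫| ≤ η * ‖p - q‖ :=
    fun p hp q hq hq0 => by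
      have h := hF p (hmem p hp) q hq
      rwa [(hA p hp).1, hq0, sub_zero, zero_sub, abs_neg] at h
  have h1 := hausdorffMeasure_le_image_of_dist_le (φ := fun p => hyperplaneProj ν (p - x))
    (S := A) (K := s.toNNReal) (fun p hp q hq => by
      rw [dist_eq_norm, dist_eq_norm, ← hyperplaneProj_sub, sub_sub_sub_cancel_right,
        Real.coe_toNNReal _ hs.le]
      have h := norm_le_norm_hyperplaneProj_add hν (p - q)
      have h' := hheight p hp q (hmem q hq) (hA q hq).1
      have h2 : (1 - η) * ‖p - q‖ ≤ ‖hyperplaneProj ν (p - q)‖ := by linarith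
      calc ‖p - q‖ ≤ s * (1 - η) * ‖p - q‖ := le_mul_of_one_le_left (norm_nonneg _) hηs
        _ = s * ((1 - η) * ‖p - q‖) := by ring
        _ ≤ _ := mul_le_mul_of_nonneg_left h2 hs.le) hd
  refine h1.trans (mul_le_mul_right ?_ _)
  have h3 : ENNReal.ofReal (s * r) ^ d * μH[d] ({z | N z ≤ 1} ∩ {w | ⟪w, ν⟫ = 0}) =
      μH[d] {w | N w ≤ s * r ∧ ⟪w, ν⟫ = 0} := by
    rw [← N.smul_unitBall_inter_hyperplane ν (mul_pos hs hr),
      Measure.hausdorffMeasure_smul₀ hd (mul_pos hs hr).ne', ENNReal.smul_def, smul_eq_mul,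
      ENNReal.coe_rpow_of_nonneg _ hd, ← enorm_eq_nnnorm, Real.enorm_of_nonneg (mul_pos hs hr).le]
  rw [h3]
  refine measure_mono ?_
  rintro _ ⟨p, hp, rfl⟩
  refine ⟨?_, inner_hyperplaneProj hν _⟩
  have hpr := (hA p hp).2
  have hN : 0 ≤ N ν := apply_nonneg N ν
  have ht : |⟪p - x, ν⟫| ≤ η * (c * r) :=
    (hheight p hp x hx hFx).trans (mul_le_mul_of_nonneg_left
      ((hc _).trans (mul_le_mul_of_nonneg_left hpr hc0.le)) hη.le)
  calc N (hyperplaneProj ν (p - x)) ≤ N (p - x) + N (⟪p - x, ν⟫ • ν) := map_sub_le_add N _ _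
    _ = N (p - x) + |⟪p - x, ν⟫| * N ν := by rw [map_smul_eq_mul, Real.norm_eq_abs]
    _ ≤ r + η * (c * r) * N ν := add_le_add hpr (mul_le_mul_of_nonneg_right ht hN)
    _ = (1 + η * c * N ν) * r := by ring
    _ ≤ s * r := mul_le_mul_of_nonneg_right hηs' hr.le

/-- Lower estimate: an almost flat zero set in a seminorm ball has at least the measure of a slightly
smaller flat section. -/
theorem le_hausdorffMeasure_zeroSet (N : Seminorm ℝ E) {F : E → ℝ} {x ν : E} {c δ η s r d : ℝ}
    (hd : 0 ≤ d) (hν : ‖ν‖ = 1) (hη : 0 < η) (hη2 : η ≤ 1 / 2) (hc : ∀ z, ‖z‖ ≤ c * N z)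
    (hFx : F x = 0)
    (hF : ∀ p ∈ ball x δ, ∀ q ∈ ball x δ, |F p - F q - ⟪p - q, ν⟫| ≤ η * ‖p - q‖)
    (hcont : ContinuousOn F (ball x δ))
    (hs : 1 ≤ s) (hηs : 1 + 2 * η * c * N ν ≤ s) (hc0 : 0 < c)
    (hr : 0 < r) (hrδ : 2 * (c * r) < δ) {A : Set E}
    (hA : ∀ p ∈ ball x δ, F p = 0 → N (p - x) ≤ r → p ∈ A) :
    ENNReal.ofReal (s⁻¹ * r) ^ d * μH[d] ({z | N z ≤ 1} ∩ {w | ⟪w, ν⟫ = 0}) ≤ μH[d] A := by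
  have hs0 : 0 < s := one_pos.trans_le hs
  have hsr : 0 < s⁻¹ * r := mul_pos (inv_pos.2 hs0) hr
  have h1 := (lipschitzWith_hyperplaneProj_sub hν x).hausdorffMeasure_image_le hd A
  rw [ENNReal.coe_one, ENNReal.one_rpow, one_mul] at h1
  refine le_trans ?_ h1
  have h3 : ENNReal.ofReal (s⁻¹ * r) ^ d * μH[d] ({z | N z ≤ 1} ∩ {w | ⟪w, ν⟫ = 0}) =
      μH[d] {w | N w ≤ s⁻¹ * r ∧ ⟪w, ν⟫ = 0} := by
    rw [← N.smul_unitBall_inter_hyperplane ν hsr,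
      Measure.hausdorffMeasure_smul₀ hd hsr.ne', ENNReal.smul_def, smul_eq_mul,
      ENNReal.coe_rpow_of_nonneg _ hd, ← enorm_eq_nnnorm, Real.enorm_of_nonneg hsr.le]
  rw [h3]
  refine measure_mono ?_
  rintro v ⟨hvN, hv⟩
  have hvr : N v ≤ r := hvN.trans (mul_le_of_le_one_left hr.le (inv_le_one_of_one_le₀ hs))
  have hvδ : 2 * ‖v‖ < δ := by
    have := (hc v).trans (mul_le_mul_of_nonneg_left hvr hc0.le)
    linarith
  obtain ⟨t, ht, htδ, ht0⟩ := exists_zero_over_hyperplane hν hη hη2 hFx hF hcont hv hvδ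
  refine ⟨x + (v + t • ν), hA _ htδ ht0 ?_, ?_⟩
  · have hN : 0 ≤ N ν := apply_nonneg N ν
    have hNv : 0 ≤ N v := apply_nonneg N v
    rw [add_sub_cancel_left]
    calc N (v + t • ν) ≤ N v + N (t • ν) := map_add_le_add N _ _
      _ = N v + |t| * N ν := by rw [map_smul_eq_mul, Real.norm_eq_abs]
      _ ≤ N v + 2 * η * (c * N v) * N ν := by
        gcongr
        exact ht.trans (mul_le_mul_of_nonneg_left (hc v) (by positivity))
      _ = (1 + 2 * η * c * N ν) * N v := by ring
      _ ≤ s * (s⁻¹ * r) := mul_le_mul hηs hvN hNv hs0.le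
      _ = r := by field_simp
  · simp [hyperplaneProj, inner_add_left, hv, real_inner_smul_left, hν]

end AlmostFlat

/-- After normalisation by the norm of the gradient, a strictly differentiable function is nearly
the linear function given by its unit normal. -/
theorem HasStrictFDerivAt.exists_ball_abs_sub_inner_le {E : Type*} [NormedAddCommGroup E]
    [InnerProductSpace ℝ E] [CompleteSpace E] {f : E → ℝ} {x : E}
    (hf : HasStrictFDerivAt f (fderiv ℝ f x) x) (hg : gradient f x ≠ 0) {η : ℝ} (hη : 0 < η) :
    ∃ δ > 0, ∀ p ∈ ball x δ, ∀ q ∈ ball x δ,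
      |‖gradient f x‖⁻¹ * f p - ‖gradient f x‖⁻¹ * f q -
        ⟪p - q, ‖gradient f x‖⁻¹ • gradient f x⟫| ≤ η * ‖p - q‖ := by
  have hm : 0 < ‖gradient f x‖ := norm_pos_iff.2 hg
  obtain ⟨S, hS, happ⟩ := hf.approximates_deriv_on_nhds
    (c := (η * ‖gradient f x‖).toNNReal) (Or.inr (Real.toNNReal_pos.2 (mul_pos hη hm)))
  obtain ⟨δ, hδ, hball⟩ := Metric.mem_nhds_iff.1 hS
  refine ⟨δ, hδ, fun p hp q hq => ?_⟩
  have h := happ p (hball hp) q (hball hq)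
  rw [Real.coe_toNNReal _ (mul_pos hη hm).le, ← toDual_gradient, InnerProductSpace.toDual_apply_apply,
    Real.norm_eq_abs] at h
  rw [real_inner_smul_right, real_inner_comm, ← mul_sub, ← mul_sub, abs_mul, abs_inv, abs_norm,
    inv_mul_le_iff₀ hm]
  linarith

/-- A function squeezed between `(1 + ε)⁻ᵈ H` and `(1 + ε)²ᵈ H` for every `ε > 0` tends to `H`. -/
theorem ENNReal.tendsto_of_eventually_rpow_bounds {α : Type*} {l : Filter α} {u : α → ℝ≥0∞}
    {H : ℝ≥0∞} {d : ℝ}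
    (h : ∀ ε > (0 : ℝ), ∀ᶠ a in l, ENNReal.ofReal (1 + ε)⁻¹ ^ d * H ≤ u a ∧
      u a ≤ ENNReal.ofReal (1 + ε) ^ d * (ENNReal.ofReal (1 + ε) ^ d * H)) :
    Tendsto u l (𝓝 H) := by
  have hbase : Tendsto (fun ε : ℝ => ENNReal.ofReal (1 + ε) ^ d) (𝓝[>] 0) (𝓝 1) := by
    have : ContinuousAt (fun ε : ℝ => 1 + ε) 0 := by fun_prop
    have h2 := (ENNReal.tendsto_ofReal this.tendsto).ennrpow_const d
    simp only [add_zero, ENNReal.ofReal_one, ENNReal.one_rpow] at h2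
    exact h2.mono_left nhdsWithin_le_nhds
  have hbase' : Tendsto (fun ε : ℝ => ENNReal.ofReal (1 + ε)⁻¹ ^ d) (𝓝[>] 0) (𝓝 1) := by
    have : ContinuousAt (fun ε : ℝ => (1 + ε)⁻¹) 0 :=
      ContinuousAt.inv₀ (by fun_prop) (by norm_num)
    have h2 := (ENNReal.tendsto_ofReal this.tendsto).ennrpow_const d
    simp only [add_zero, inv_one, ENNReal.ofReal_one, ENNReal.one_rpow] at h2
    exact h2.mono_left nhdsWithin_le_nhds
  have hlo : Tendsto (fun ε : ℝ => ENNReal.ofReal (1 + ε)⁻¹ ^ d * H) (𝓝[>] 0) (𝓝 H) := by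
    simpa using ENNReal.Tendsto.mul_const hbase' (b := H) (Or.inl one_ne_zero)
  have hhi' : Tendsto (fun ε : ℝ => ENNReal.ofReal (1 + ε) ^ d * H) (𝓝[>] 0) (𝓝 H) := by
    simpa using ENNReal.Tendsto.mul_const hbase (b := H) (Or.inl one_ne_zero)
  have hhi : Tendsto (fun ε : ℝ => ENNReal.ofReal (1 + ε) ^ d * (ENNReal.ofReal (1 + ε) ^ d * H))
      (𝓝[>] 0) (𝓝 H) := by
    simpa using ENNReal.Tendsto.mul hbase (Or.inl one_ne_zero) hhi' (Or.inr ENNReal.one_ne_top)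
  refine tendsto_order.2 ⟨fun a ha => ?_, fun a ha => ?_⟩
  · obtain ⟨ε, hε, hε0⟩ := ((hlo.eventually (lt_mem_nhds ha)).and self_mem_nhdsWithin).exists
    exact (h ε hε0).mono fun _ hb => hε.trans_le hb.1
  · obtain ⟨ε, hε, hε0⟩ := ((hhi.eventually (gt_mem_nhds ha)).and self_mem_nhdsWithin).exists
    exact (h ε hε0).mono fun _ hb => hb.2.trans_lt hε

/-- **Centered blow-up of the perimeter measure** (abelian instance): let `E` be an
`n`-dimensional real inner product space (`n ≥ 2`), let `Nm` be an arbitrary norm on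
`E` with unit ball `C = {z | Nm z ≤ 1}` and closed balls `B̄(y,t) = {z | Nm (z-y) ≤ t}`,
and let `Σ = {p ∈ Ω | f p = 0}` be the zero level set of a `C¹` function `f` on an
open set `Ω` with nonvanishing differential. Then for every `x ∈ Σ` the centered
density exists:
`lim_{r→0⁺} H^{n-1}(Σ ∩ B̄(x,r)) / r^{n-1} = H^{n-1}(C ∩ N(ν(x)))`,
where `ν(x) = ∇f(x)/|∇f(x)|` and `N(ν) = {w | ⟪w, ν⟫ = 0}`. -/
theorem centered_blowup_of_perimeter
    {E : Type*} [NormedAddCommGroup E] [InnerProductSpace ℝ E]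
    [FiniteDimensional ℝ E] [MeasurableSpace E] [BorelSpace E]
    (n : ℕ) (hn : Module.finrank ℝ E = n) (hn2 : 2 ≤ n)
    (Nm : E → ℝ)
    (hNm0 : ∀ z : E, Nm z = 0 ↔ z = 0)
    (hNmsmul : ∀ (a : ℝ) (z : E), Nm (a • z) = |a| * Nm z)
    (hNmadd : ∀ z w : E, Nm (z + w) ≤ Nm z + Nm w)
    (Ω : Set E) (hΩ : IsOpen Ω)
    (f : E → ℝ) (hf : ContDiffOn ℝ 1 f Ω)
    (hf' : ∀ p ∈ Ω, fderiv ℝ f p ≠ 0)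
    (x : E) (hxΩ : x ∈ Ω) (hfx : f x = 0) :
    Tendsto
      (fun r : ℝ =>
        μH[(n : ℝ) - 1] ({p ∈ Ω | f p = 0} ∩ {z : E | Nm (z - x) ≤ r}) /
          ENNReal.ofReal r ^ ((n : ℝ) - 1))
      (𝓝[>] 0)
      (𝓝 (μH[(n : ℝ) - 1] ({z : E | Nm z ≤ 1} ∩
        {w : E | ⟪w, ‖gradient f x‖⁻¹ • gradient f x⟫ = 0}))) := by
  have hd : (0 : ℝ) ≤ (n : ℝ) - 1 := by
    have : (2 : ℝ) ≤ n := by exact_mod_cast hn2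
    linarith
  generalize (n : ℝ) - 1 = d at hd
  have : Nontrivial E := Module.nontrivial_of_finrank_pos (R := ℝ) (by omega)
  let N : Seminorm ℝ E := Seminorm.of Nm hNmadd hNmsmul
  obtain ⟨c, hc0, hc⟩ := N.exists_norm_le_mul_of_definite fun z => (hNm0 z).1
  have hΩx : Ω ∈ 𝓝 x := hΩ.mem_nhds hxΩ
  have hg : gradient f x ≠ 0 := fun h => hf' x hxΩ (by rw [← toDual_gradient, h, map_zero])
  have hm : ‖gradient f x‖ ≠ 0 := norm_ne_zero_iff.2 hg
  have hstrict := (hf.contDiffAt hΩx).hasStrictFDerivAt one_ne_zero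
  set ν := ‖gradient f x‖⁻¹ • gradient f x with hνdef
  have hν : ‖ν‖ = 1 := by rw [hνdef, norm_smul, norm_inv, norm_norm, inv_mul_cancel₀ hm]
  refine ENNReal.tendsto_of_eventually_rpow_bounds (d := d) fun ε hε => ?_
  have hNν : 0 ≤ N ν := apply_nonneg N ν
  obtain ⟨η, hη, hη2, hηs, hηN⟩ : ∃ η : ℝ, 0 < η ∧ η ≤ 1 / 2 ∧ 1 ≤ (1 + ε) * (1 - η) ∧
      1 + 2 * η * c * N ν ≤ 1 + ε := by
    have hev : ∀ᶠ η : ℝ in 𝓝[>] 0, η < 1 / 2 ∧ 1 < (1 + ε) * (1 - η) ∧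
        1 + 2 * η * c * N ν < 1 + ε := by
      refine nhdsWithin_le_nhds ?_
      refine (eventually_lt_nhds (by norm_num)).and (Eventually.and ?_ ?_)
      · have hcont : ContinuousAt (fun η : ℝ => (1 + ε) * (1 - η)) 0 := by fun_prop
        exact hcont.eventually (lt_mem_nhds (by simpa using hε))
      · have hcont : ContinuousAt (fun η : ℝ => 1 + 2 * η * c * N ν) 0 := by fun_prop
        exact hcont.eventually (gt_mem_nhds (by simpa using hε))
    obtain ⟨η, h, h0⟩ := (hev.and self_mem_nhdsWithin).exists
    exact ⟨η, h0, h.1.le, h.2.1.le, h.2.2.le⟩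
  obtain ⟨δ₁, hδ₁, hF₁⟩ := hstrict.exists_ball_abs_sub_inner_le hg hη
  obtain ⟨δ₂, hδ₂, hball⟩ := Metric.mem_nhds_iff.1 hΩx
  obtain ⟨δ, hδ, hδle₁, hδle₂⟩ : ∃ δ > 0, δ ≤ δ₁ ∧ δ ≤ δ₂ :=
    ⟨min δ₁ δ₂, lt_min hδ₁ hδ₂, min_le_left _ _, min_le_right _ _⟩
  have hF : ∀ p ∈ ball x δ, ∀ q ∈ ball x δ,
      |‖gradient f x‖⁻¹ * f p - ‖gradient f x‖⁻¹ * f q - ⟪p - q, ν⟫| ≤ η * ‖p - q‖ :=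
    fun p hp q hq => hF₁ p (ball_subset_ball hδle₁ hp) q (ball_subset_ball hδle₁ hq)
  have hΩball : ball x δ ⊆ Ω := (ball_subset_ball hδle₂).trans hball
  have hcont : ContinuousOn (fun p => ‖gradient f x‖⁻¹ * f p) (ball x δ) :=
    continuousOn_const.mul (hf.continuousOn.mono hΩball)
  have hsmall : ∀ᶠ r : ℝ in 𝓝[>] 0, 2 * (c * r) < δ := by
    have h : ContinuousAt (fun r : ℝ => 2 * (c * r)) 0 := by fun_prop
    exact nhdsWithin_le_nhds (h.eventually (gt_mem_nhds (by simpa using hδ)))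
  filter_upwards [hsmall, self_mem_nhdsWithin] with r hrδ hr
  have hr0 : 0 < r := hr
  have hs : 0 < 1 + ε := by linarith
  have hrpos : 0 < ENNReal.ofReal r := ENNReal.ofReal_pos.2 hr0
  have hden0 : ENNReal.ofReal r ^ d ≠ 0 := (ENNReal.rpow_pos hrpos ENNReal.ofReal_ne_top).ne'
  have hdent : ENNReal.ofReal r ^ d ≠ ∞ := ENNReal.rpow_ne_top_of_nonneg hd ENNReal.ofReal_ne_top
  constructor
  · have h := le_hausdorffMeasure_zeroSet N (F := fun p => ‖gradient f x‖⁻¹ * f p) (x := x)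
      (s := 1 + ε) (A := {p ∈ Ω | f p = 0} ∩ {z : E | Nm (z - x) ≤ r}) hd hν hη hη2 hc
      (by simp [hfx]) hF hcont (by linarith) hηN hc0 hr0 hrδ fun p hp hp0 hpr =>
        ⟨⟨hΩball hp, (mul_eq_zero.1 hp0).resolve_left (inv_ne_zero hm)⟩, hpr⟩
    rw [ENNReal.le_div_iff_mul_le (Or.inl hden0) (Or.inl hdent)]
    rw [ENNReal.ofReal_mul (inv_nonneg.2 hs.le), ENNReal.mul_rpow_of_nonneg _ _ hd,
      mul_right_comm] at h
    exact h
  · have hηN' : 1 + η * c * N ν ≤ 1 + ε := by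
      have : 0 ≤ η * c * N ν := by positivity
      linarith
    have h := hausdorffMeasure_zeroSet_le N (F := fun p => ‖gradient f x‖⁻¹ * f p) (x := x)
      (s := 1 + ε) (r := r) (A := {p ∈ Ω | f p = 0} ∩ {z : E | Nm (z - x) ≤ r}) hd hν hη hc
      (by simp [hfx]) hF hs hηs hηN' hc0 hr0 (by linarith [mul_pos hc0 hr0])
      fun p hp => ⟨by simp [hp.1.2], hp.2⟩
    refine ENNReal.div_le_of_le_mul ?_
    rw [ENNReal.ofReal_mul hs.le, ENNReal.mul_rpow_of_nonneg _ _ hd,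
      mul_right_comm _ (ENNReal.ofReal r ^ d), ← mul_assoc] at h
    exact h
end
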